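/- arXiv:2401.05522 — 2 statements merged into one kernel-verified Lean document; each statement's English description precedes it below -/
import Mathlib

section
/- For all integers n ≥ 1, s_+(n) − 120/n⁵ < (p̄(n+1)/p̄(n))^{1/(n+1)} < s_+(n) + 850/n⁵, where s_+(n) = Σ_{i=0}^{9} a_i/n^{i/2} with a_0 = 1, a_1 = a_2 = 0, a_3 = π/2, a_4 = −1, a_5 = (4 − 5π²)/(8π), a_6 = (4 + 12π² + π⁴)/(8π²), a_7 = (8 − 14π² + 3π⁴)/(16π³), a_8 = (24 − 48π² − 52π⁴ − 15π⁶)/(48π⁴), a_9 = (192 − 432π² + 360π⁴ + 249π⁶ + 8π⁸)/(384π⁵). -/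
open Real

/-- The overpartition function. -/
noncomputable def pbar (n : ℕ) : ℕ :=
  ∑ k ∈ Finset.range (n + 1),
    (Nat.Partition.distincts k).card * Fintype.card (Nat.Partition (n - k))

/-- `s_+(n) = Σ_{i=0}^{9} a_i / n^{i/2}`. -/
noncomputable def sPlus (n : ℕ) : ℝ :=
  1 + (π / 2) / (n : ℝ) ^ ((3 : ℝ) / 2) + (-1) / (n : ℝ) ^ (2 : ℝ)
    + ((4 - 5 * π ^ 2) / (8 * π)) / (n : ℝ) ^ ((5 : ℝ) / 2)
    + ((4 + 12 * π ^ 2 + π ^ 4) / (8 * π ^ 2)) / (n : ℝ) ^ (3 : ℝ)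
    + ((8 - 14 * π ^ 2 + 3 * π ^ 4) / (16 * π ^ 3)) / (n : ℝ) ^ ((7 : ℝ) / 2)
    + ((24 - 48 * π ^ 2 - 52 * π ^ 4 - 15 * π ^ 6) / (48 * π ^ 4)) / (n : ℝ) ^ (4 : ℝ)
    + ((192 - 432 * π ^ 2 + 360 * π ^ 4 + 249 * π ^ 6 + 8 * π ^ 8) / (384 * π ^ 5))
        / (n : ℝ) ^ ((9 : ℝ) / 2)

open PowerSeries in
/-- The finite products `∏_{i=1}^N (1 + X^i) / (1 - X^i)`. -/
noncomputable def overProd (N : ℕ) : ℝ⟦X⟧ :=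
  ∏ i ∈ Finset.range N, ((1 + X ^ (i + 1)) * (1 - X ^ (i + 1))⁻¹)

open PowerSeries in
lemma overProd_zero : overProd 0 = 1 := by simp [overProd]

open PowerSeries in
lemma one_sub_X_pow_mul_inv (k : ℕ) (hk : k ≠ 0) :
    (1 - X ^ k : ℝ⟦X⟧) * (1 - X ^ k)⁻¹ = 1 :=
  PowerSeries.mul_inv_cancel _ (by simp [hk])

open PowerSeries in
lemma overProd_succ_mul (N : ℕ) :
    overProd (N + 1) * (1 - X ^ (N + 1)) = overProd N * (1 + X ^ (N + 1)) := by
  have h := one_sub_X_pow_mul_inv (N + 1) (by simp)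
  rw [overProd, Finset.prod_range_succ, ← overProd]
  linear_combination (overProd N * (1 + X ^ (N + 1))) * h

open PowerSeries in
lemma overProd_succ (N : ℕ) :
    overProd (N + 1) = overProd N + (overProd N + overProd (N + 1)) * X ^ (N + 1) := by
  linear_combination overProd_succ_mul N

open PowerSeries in
lemma coeff_overProd_succ_of_le {N n : ℕ} (h : n ≤ N) :
    coeff n (overProd (N + 1)) = coeff n (overProd N) := by
  rw [overProd_succ, map_add, coeff_mul_X_pow', if_neg (by omega), add_zero]

open PowerSeries in
lemma coeff_overProd_succ_add (N n : ℕ) :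
    coeff (n + (N + 1)) (overProd (N + 1)) =
      coeff (n + (N + 1)) (overProd N) + (coeff n (overProd N) + coeff n (overProd (N + 1))) := by
  rw [overProd_succ, map_add, coeff_mul_X_pow, map_add, ← overProd_succ]

open PowerSeries in
lemma coeff_overProd_nonneg (N n : ℕ) : 0 ≤ coeff n (overProd N) := by
  induction N generalizing n with
  | zero =>
    rw [overProd_zero, coeff_one]
    split_ifs <;> norm_num
  | succ N ih =>
    induction n using Nat.strong_induction_on with
    | _ n ihn =>
      rcases Nat.lt_or_ge N n with h | h
      · obtain ⟨m, rfl⟩ := Nat.exists_eq_add_of_le' (Nat.succ_le_of_lt h)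
        rw [coeff_overProd_succ_add]
        have := ih m
        have := ih (m + (N + 1))
        have := ihn m (by omega)
        positivity
      · rw [coeff_overProd_succ_of_le h]
        exact ih n

open PowerSeries in
lemma coeff_overProd_mono (n : ℕ) : Monotone fun N => coeff n (overProd N) := by
  refine monotone_nat_of_le_succ fun N => ?_
  rcases Nat.lt_or_ge N n with h | h
  · obtain ⟨m, rfl⟩ := Nat.exists_eq_add_of_le' (Nat.succ_le_of_lt h)
    rw [coeff_overProd_succ_add]
    have := coeff_overProd_nonneg N m
    have := coeff_overProd_nonneg (N + 1) m
    linarith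
  · exact (coeff_overProd_succ_of_le h).ge

open PowerSeries in
lemma coeff_overProd_of_le {n N : ℕ} (h : n ≤ N) :
    coeff n (overProd N) = coeff n (overProd n) := by
  induction N, h using Nat.le_induction with
  | base => rfl
  | succ N hN ih => rw [coeff_overProd_succ_of_le hN, ih]

open PowerSeries PowerSeries.WithPiTopology Filter Topology in
lemma pbar_eq_coeff_overProd (n : ℕ) : (pbar n : ℝ) = coeff n (overProd n) := by
  have h1 := Nat.Partition.hasProd_powerSeriesMk_card_countRestricted ℝ (m := 2) (by norm_num)
  have h2 := Nat.Partition.hasProd_powerSeriesMk_card_restricted ℝ (fun _ => True)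
  have h3 := (h1.mul h2).tendsto_prod_nat
  have hterm (i : ℕ) : ((∑ j ∈ Finset.range 2, X ^ ((i + 1) * j)) *
      (if True then ∑' j : ℕ, X ^ ((i + 1) * j) else 1) : ℝ⟦X⟧) =
      (1 + X ^ (i + 1)) * (1 - X ^ (i + 1))⁻¹ := by
    congr 1
    · simp [Finset.sum_range_succ]
    · rw [if_pos trivial]
      simp_rw [pow_mul]
      rw [PowerSeries.eq_inv_iff_mul_eq_one (by simp)]
      exact tsum_pow_mul_one_sub_of_constantCoeff_eq_zero (by simp)
  simp_rw [hterm] at h3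
  have h4 := ((continuous_coeff ℝ n).tendsto _).comp h3
  have h5 : Tendsto (fun N => coeff n (overProd N)) atTop (𝓝 (coeff n (overProd n))) :=
    tendsto_const_nhds.congr' <| by
      filter_upwards [eventually_ge_atTop n] with N hN
      exact (coeff_overProd_of_le hN).symm
  rw [← tendsto_nhds_unique h4 h5, coeff_mul, pbar, Finset.Nat.sum_antidiagonal_eq_sum_range_succ_mk]
  push_cast
  refine Finset.sum_congr rfl fun k _ => ?_
  simp only [coeff_mk, Nat.Partition.countRestricted_two]
  congr 2
  simp [Nat.Partition.restricted]

open PowerSeries in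
lemma pbar_eq_coeff {n N : ℕ} (h : n ≤ N) : (pbar n : ℝ) = coeff n (overProd N) := by
  rw [pbar_eq_coeff_overProd, coeff_overProd_of_le h]

/-- The coefficients of `θ₄`: `θ₄(q) = ∑ thetaCoeff n q^n`. -/
noncomputable def thetaCoeff (n : ℕ) : ℝ :=
  if n = 0 then 1 else if IsSquare n then 2 * (-1) ^ n else 0

open PowerSeries in
/-- Shanks' finite form of Gauss' product formula for `θ₄`. -/
lemma overProd_mul_partial_theta (n : ℕ) :
    overProd n * (1 + 2 * ∑ k ∈ Finset.range n, (-1) ^ (k + 1) * X ^ (k + 1) ^ 2) =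
      ∑ s ∈ Finset.range (n + 1),
        (-1) ^ s * overProd s * X ^ (s * (n + 1)) * (2 * (1 + X ^ s)⁻¹) := by
  have hV (s : ℕ) : (1 + X ^ s : ℝ⟦X⟧) * (1 + X ^ s)⁻¹ = 1 := by
    refine PowerSeries.mul_inv_cancel _ ?_
    rcases eq_or_ne s 0 with rfl | hs
    · simp only [pow_zero, map_add, map_one]
      norm_num
    · simp [hs]
  have htel (n m : ℕ) : ∑ s ∈ Finset.range (m + 1), (-1) ^ s * overProd s *
      X ^ (s * (n + 1)) * (2 * (1 + X ^ s)⁻¹) * ((1 + X ^ (n + 1)) - (1 - X ^ (n + 1)) * X ^ s) =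
      2 * (-1) ^ m * overProd m * X ^ ((m + 1) * (n + 1)) := by
    induction m with
    | zero =>
      have := hV 0
      simp only [pow_zero] at this
      simp [overProd_zero]
      linear_combination (2 * X ^ (n + 1)) * this
    | succ m ih =>
      rw [Finset.sum_range_succ, ih]
      have h1 := hV (m + 1)
      have h2 := overProd_succ_mul m
      generalize (1 + X ^ (m + 1) : ℝ⟦X⟧)⁻¹ = V at *
      have e1 : (X : ℝ⟦X⟧) ^ ((m + 1 + 1) * (n + 1)) = X ^ ((m + 1) * (n + 1)) * X ^ (n + 1) := by
        rw [← pow_add]; congr 1; ring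
      rw [e1]
      generalize (X : ℝ⟦X⟧) ^ ((m + 1) * (n + 1)) = z at *
      generalize (X : ℝ⟦X⟧) ^ (n + 1) = y at *
      generalize (X : ℝ⟦X⟧) ^ (m + 1) = x at *
      linear_combination (2 * (-1) ^ (m + 1) * z * V) * h2 +
        (2 * (-1) ^ (m + 1) * z * (overProd m + y * overProd (m + 1))) * h1
  induction n with
  | zero =>
    have := hV 0
    simp only [pow_zero] at this
    simp [overProd_zero]
    linear_combination -this
  | succ n ih =>
    have hne : (1 - X ^ (n + 1) : ℝ⟦X⟧) ≠ 0 := fun h => by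
      have := one_sub_X_pow_mul_inv (n + 1) (by simp)
      rw [h, zero_mul] at this
      exact zero_ne_one this
    refine mul_left_cancel₀ hne ?_
    have hD := htel n n
    have hsplit : ∑ s ∈ Finset.range (n + 1), (-1) ^ s * overProd s *
        X ^ (s * (n + 1)) * (2 * (1 + X ^ s)⁻¹) * ((1 + X ^ (n + 1)) - (1 - X ^ (n + 1)) * X ^ s) =
        (1 + X ^ (n + 1)) * (∑ s ∈ Finset.range (n + 1), (-1) ^ s * overProd s *
          X ^ (s * (n + 1)) * (2 * (1 + X ^ s)⁻¹)) -
        (1 - X ^ (n + 1)) * (∑ s ∈ Finset.range (n + 1), (-1) ^ s * overProd s *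
          X ^ (s * (n + 1 + 1)) * (2 * (1 + X ^ s)⁻¹)) := by
      rw [Finset.mul_sum, Finset.mul_sum, ← Finset.sum_sub_distrib]
      refine Finset.sum_congr rfl fun s _ => ?_
      rw [show s * (n + 1 + 1) = s * (n + 1) + s by ring, pow_add]
      ring
    rw [hsplit] at hD
    rw [Finset.sum_range_succ _ (n + 1), Finset.sum_range_succ _ n]
    have h1 := hV (n + 1)
    have h2 := overProd_succ_mul n
    have e1 : (X : ℝ⟦X⟧) ^ ((n + 1) * (n + 1 + 1)) = X ^ ((n + 1) ^ 2) * X ^ (n + 1) := by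
      rw [← pow_add]; congr 1; ring
    have e2 : (X : ℝ⟦X⟧) ^ ((n + 1) * (n + 1)) = X ^ ((n + 1) ^ 2) := by
      congr 1; ring
    rw [e2] at hD
    rw [e1]
    generalize (X : ℝ⟦X⟧) ^ ((n + 1) ^ 2) = z at *
    generalize (1 + X ^ (n + 1) : ℝ⟦X⟧)⁻¹ = V at *
    generalize (X : ℝ⟦X⟧) ^ (n + 1) = y at *
    generalize (∑ k ∈ Finset.range n, (-1) ^ (k + 1) * X ^ (k + 1) ^ 2 : ℝ⟦X⟧) = t at *
    linear_combination hD + (1 + y) * ih + (1 + 2 * (t + (-1) ^ (n + 1) * z)) * h2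
      - (2 * (-1) ^ (n + 1) * z * y * V) * h2 - (2 * (-1) ^ (n + 1) * z * y * overProd n) * h1

open PowerSeries in
lemma coeff_partial_theta {m n : ℕ} (h : m ≤ n) :
    coeff m (1 + 2 * ∑ k ∈ Finset.range n, (-1) ^ (k + 1) * X ^ (k + 1) ^ 2 : ℝ⟦X⟧) =
      thetaCoeff m := by
  have e : (2 * ∑ k ∈ Finset.range n, (-1) ^ (k + 1) * X ^ (k + 1) ^ 2 : ℝ⟦X⟧) =
      ∑ k ∈ Finset.range n, C (2 * (-1) ^ (k + 1)) * X ^ (k + 1) ^ 2 := by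
    rw [Finset.mul_sum]
    refine Finset.sum_congr rfl fun k _ => ?_
    simp only [map_mul, map_pow, map_neg, map_one, map_ofNat]
    ring
  rw [e, map_add, map_sum, coeff_one, thetaCoeff]
  simp_rw [coeff_C_mul, coeff_X_pow]
  rcases eq_or_ne m 0 with rfl | hm
  · rw [if_pos rfl, if_pos rfl, Finset.sum_eq_zero, add_zero]
    intro k _
    rw [if_neg (by positivity), mul_zero]
  · rw [if_neg hm, if_neg hm, zero_add]
    split_ifs with hs
    · obtain ⟨r, rfl⟩ := hs
      have hr : r ≠ 0 := by rintro rfl; simp at hm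
      rw [Finset.sum_eq_single (r - 1)]
      · rw [Nat.sub_add_cancel (by omega), if_pos (by ring), mul_one, pow_mul]
        rcases Nat.even_or_odd r with h' | h'
        · simp [h'.neg_one_pow]
        · simp [h'.neg_one_pow]
      · intro b _ hb
        rw [if_neg, mul_zero]
        intro h2
        have : r = b + 1 := by nlinarith [Nat.pow_left_injective two_ne_zero (show r ^ 2 = (b+1)^2 by linarith)]
        omega
      · intro hr'
        rw [Finset.mem_range] at hr'
        have := Nat.le_mul_self r
        omega
    · refine Finset.sum_eq_zero fun k _ => ?_
      rw [if_neg, mul_zero]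
      rintro rfl
      exact hs ⟨k + 1, by ring⟩

open PowerSeries in
/-- The generating function of `pbar` is the reciprocal of `θ₄`. -/
lemma sum_pbar_mul_thetaCoeff (n : ℕ) :
    ∑ ij ∈ Finset.HasAntidiagonal.antidiagonal n, (pbar ij.1 : ℝ) * thetaCoeff ij.2 = if n = 0 then 1 else 0 := by
  have h := congrArg (coeff n) (overProd_mul_partial_theta n)
  rw [coeff_mul] at h
  have hl : ∀ ij ∈ Finset.HasAntidiagonal.antidiagonal n, (pbar ij.1 : ℝ) * thetaCoeff ij.2 =
      coeff ij.1 (overProd n) *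
        coeff ij.2 (1 + 2 * ∑ k ∈ Finset.range n, (-1) ^ (k + 1) * X ^ (k + 1) ^ 2 : ℝ⟦X⟧) := by
    intro ij hij
    rw [Finset.HasAntidiagonal.mem_antidiagonal] at hij
    rw [coeff_partial_theta (by omega), pbar_eq_coeff (N := n) (by omega)]
  rw [Finset.sum_congr rfl hl, h, Finset.sum_range_succ', map_add, map_sum, Finset.sum_eq_zero]
  · have : (2 * (1 + 1)⁻¹ : ℝ⟦X⟧) = 1 := by
      have := PowerSeries.mul_inv_cancel (1 + 1 : ℝ⟦X⟧)
        (by simp only [map_add, map_one]; norm_num)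
      linear_combination this
    simp [overProd_zero, this, coeff_one]
  · intro k _
    rw [show (k + 1) * (n + 1) = k * (n + 1) + (n + 1) by ring, pow_add _ (k * (n + 1))]
    have e (a b c d : ℝ⟦X⟧) : a * b * (c * X ^ (n + 1)) * d = (a * b * c * d) * X ^ (n + 1) := by
      ring
    rw [e, coeff_mul_X_pow', if_neg (by omega)]

/-- The real power series `f` converges absolutely at `q : ℂ`, with sum `a`. -/
def PowerSeries.AbsSumsTo (f : PowerSeries ℝ) (q a : ℂ) : Prop :=
  (Summable fun n => ‖((PowerSeries.coeff n f : ℝ) : ℂ) * q ^ n‖) ∧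
    ∑' n, ((PowerSeries.coeff n f : ℝ) : ℂ) * q ^ n = a

open PowerSeries in
lemma PowerSeries.AbsSumsTo.mul {f g : ℝ⟦X⟧} {q a b : ℂ} (hf : f.AbsSumsTo q a)
    (hg : g.AbsSumsTo q b) : (f * g).AbsSumsTo q (a * b) := by
  have h (n : ℕ) : ((coeff n (f * g) : ℝ) : ℂ) * q ^ n =
      ∑ kl ∈ Finset.HasAntidiagonal.antidiagonal n,
        (((coeff kl.1 f : ℝ) : ℂ) * q ^ kl.1) * (((coeff kl.2 g : ℝ) : ℂ) * q ^ kl.2) := by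
    rw [coeff_mul, Complex.ofReal_sum, Finset.sum_mul]
    refine Finset.sum_congr rfl fun kl hkl => ?_
    rw [← Finset.HasAntidiagonal.mem_antidiagonal.mp hkl, pow_add, Complex.ofReal_mul]
    ring
  obtain ⟨hf, rfl⟩ := hf
  obtain ⟨hg, rfl⟩ := hg
  rw [PowerSeries.AbsSumsTo]
  simp only [h]
  set F : ℕ → ℂ := fun n => ((coeff n f : ℝ) : ℂ) * q ^ n
  set G : ℕ → ℂ := fun n => ((coeff n g : ℝ) : ℂ) * q ^ n
  exact ⟨summable_norm_sum_mul_antidiagonal_of_summable_norm (f := F) (g := G) hf hg,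
    (tsum_mul_tsum_eq_tsum_sum_antidiagonal_of_summable_norm (f := F) (g := G) hf hg).symm⟩

open PowerSeries in
lemma PowerSeries.AbsSumsTo.one (q : ℂ) : (1 : ℝ⟦X⟧).AbsSumsTo q 1 := by
  have h : ∀ n ∉ ({0} : Finset ℕ), ((coeff n (1 : ℝ⟦X⟧) : ℝ) : ℂ) * q ^ n = 0 := by
    intro n hn
    rw [Finset.mem_singleton] at hn
    simp [coeff_one, hn]
  refine ⟨summable_of_ne_finset_zero (s := {0}) fun n hn => by rw [h n hn, norm_zero], ?_⟩
  rw [tsum_eq_sum h]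
  simp

open PowerSeries in
lemma PowerSeries.AbsSumsTo.one_add_mul_X_pow (c : ℝ) {k : ℕ} (hk : k ≠ 0) (q : ℂ) :
    (1 + C c * X ^ k : ℝ⟦X⟧).AbsSumsTo q (1 + c * q ^ k) := by
  have h : ∀ n ∉ ({0, k} : Finset ℕ),
      ((coeff n (1 + C c * X ^ k : ℝ⟦X⟧) : ℝ) : ℂ) * q ^ n = 0 := by
    intro n hn
    simp only [Finset.mem_insert, Finset.mem_singleton, not_or] at hn
    simp [coeff_one, hn, coeff_X_pow]
  refine ⟨summable_of_ne_finset_zero (s := {0, k}) fun n hn => by rw [h n hn, norm_zero], ?_⟩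
  rw [tsum_eq_sum h, Finset.sum_pair hk.symm]
  rw [map_add, map_add, coeff_C_mul, coeff_C_mul, coeff_X_pow, coeff_X_pow, coeff_one, coeff_one,
    if_neg hk, if_neg hk.symm]
  simp

open PowerSeries in
lemma coeff_one_sub_X_pow_inv_mem {k : ℕ} (hk : k ≠ 0) (n : ℕ) :
    0 ≤ coeff n (1 - X ^ k : ℝ⟦X⟧)⁻¹ ∧ coeff n (1 - X ^ k : ℝ⟦X⟧)⁻¹ ≤ 1 := by
  have h : (1 - X ^ k : ℝ⟦X⟧)⁻¹ = 1 + (1 - X ^ k)⁻¹ * X ^ k := by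
    linear_combination one_sub_X_pow_mul_inv k hk
  induction n using Nat.strong_induction_on with
  | _ n ih =>
    rw [h, map_add, coeff_mul_X_pow', coeff_one]
    rcases eq_or_ne n 0 with rfl | hn
    · simp [hk]
    · rw [if_neg hn, zero_add]
      split_ifs
      · exact ih _ (by omega)
      · norm_num

open PowerSeries in
lemma PowerSeries.AbsSumsTo.inv_one_sub_X_pow {k : ℕ} (hk : k ≠ 0) {q : ℂ} (hq : ‖q‖ < 1) :
    ((1 - X ^ k)⁻¹ : ℝ⟦X⟧).AbsSumsTo q (1 - q ^ k)⁻¹ := by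
  have hs : Summable fun n => ‖((coeff n ((1 - X ^ k)⁻¹ : ℝ⟦X⟧) : ℝ) : ℂ) * q ^ n‖ := by
    refine Summable.of_nonneg_of_le (fun _ => norm_nonneg _) (fun n => ?_)
      (summable_geometric_of_lt_one (norm_nonneg q) hq)
    have := coeff_one_sub_X_pow_inv_mem hk n
    rw [norm_mul, norm_pow, Complex.norm_real, Real.norm_of_nonneg this.1]
    exact mul_le_of_le_one_left (by positivity) this.2
  have h1 : (1 - X ^ k : ℝ⟦X⟧).AbsSumsTo q (1 - q ^ k) := by
    have := PowerSeries.AbsSumsTo.one_add_mul_X_pow (-1) hk q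
    simpa [sub_eq_add_neg] using this
  have h2 := h1.mul ⟨hs, rfl⟩
  rw [one_sub_X_pow_mul_inv k hk] at h2
  exact ⟨hs, eq_inv_of_mul_eq_one_right (h2.2.symm.trans (PowerSeries.AbsSumsTo.one q).2)⟩

open PowerSeries in
lemma overProd_absSumsTo (N : ℕ) {q : ℂ} (hq : ‖q‖ < 1) :
    (overProd N).AbsSumsTo q
      (∏ i ∈ Finset.range N, ((1 + q ^ (i + 1)) * (1 - q ^ (i + 1))⁻¹)) := by
  induction N with
  | zero => simpa [overProd_zero] using PowerSeries.AbsSumsTo.one q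
  | succ N ih =>
    rw [Finset.prod_range_succ, overProd, Finset.prod_range_succ, ← overProd]
    refine ih.mul (PowerSeries.AbsSumsTo.mul ?_ (.inv_one_sub_X_pow (by simp) hq))
    simpa using PowerSeries.AbsSumsTo.one_add_mul_X_pow 1 (Nat.succ_ne_zero N) q

open PowerSeries in
lemma summable_pbar_mul_pow {r : ℝ} (h0 : 0 ≤ r) (h1 : r < 1) :
    Summable fun n => (pbar n : ℝ) * r ^ n := by
  have hnorm : ‖(r : ℂ)‖ < 1 := by rwa [Complex.norm_real, Real.norm_of_nonneg h0]
  refine summable_of_sum_range_le (c := Real.exp (2 / (1 - r) * (1 - r)⁻¹))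
    (fun n => by positivity) fun M => ?_
  have hM := overProd_absSumsTo M hnorm
  have hM1 : Summable fun n => coeff n (overProd M) * r ^ n := by
    refine hM.1.congr fun n => ?_
    rw [norm_mul, norm_pow, Complex.norm_real, Complex.norm_real, Real.norm_of_nonneg h0,
      Real.norm_of_nonneg (coeff_overProd_nonneg _ _)]
  have hM2 : ∑' n, coeff n (overProd M) * r ^ n =
      ∏ i ∈ Finset.range M, ((1 + r ^ (i + 1)) * (1 - r ^ (i + 1))⁻¹) := by
    exact_mod_cast hM.2
  have hfac (i : ℕ) : (1 + r ^ (i + 1)) * (1 - r ^ (i + 1))⁻¹ ≤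
      Real.exp (2 / (1 - r) * r ^ (i + 1)) := by
    have hx : r ^ (i + 1) ≤ r := by
      simpa using pow_le_pow_of_le_one h0 h1.le (Nat.succ_le_succ (Nat.zero_le i))
    have hx0 : 0 ≤ r ^ (i + 1) := by positivity
    generalize r ^ (i + 1) = x at *
    have : (1 + x) * (1 - x)⁻¹ ≤ 2 / (1 - r) * x + 1 := by
      rw [← div_eq_mul_inv, div_le_iff₀ (by linarith)]
      have : 2 ≤ 2 / (1 - r) * (1 - x) := by
        rw [div_mul_eq_mul_div, le_div_iff₀ (by linarith)]
        linarith
      nlinarith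
    exact this.trans (Real.add_one_le_exp _)
  calc ∑ n ∈ Finset.range M, (pbar n : ℝ) * r ^ n
      = ∑ n ∈ Finset.range M, coeff n (overProd M) * r ^ n :=
        Finset.sum_congr rfl fun n hn => by rw [pbar_eq_coeff (Finset.mem_range.mp hn).le]
    _ ≤ ∑' n, coeff n (overProd M) * r ^ n :=
        hM1.sum_le_tsum _ fun n _ => mul_nonneg (coeff_overProd_nonneg _ _) (by positivity)
    _ = ∏ i ∈ Finset.range M, ((1 + r ^ (i + 1)) * (1 - r ^ (i + 1))⁻¹) := hM2
    _ ≤ ∏ i ∈ Finset.range M, Real.exp (2 / (1 - r) * r ^ (i + 1)) := by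
        refine Finset.prod_le_prod (fun i _ => ?_) fun i _ => hfac i
        have : r ^ (i + 1) < 1 := pow_lt_one₀ h0 h1 (by simp)
        have : 0 < 1 - r ^ (i + 1) := by linarith
        positivity
    _ = Real.exp (∑ i ∈ Finset.range M, 2 / (1 - r) * r ^ (i + 1)) := (Real.exp_sum _ _).symm
    _ ≤ _ := by
        rw [← Finset.mul_sum]
        have : 0 < 1 - r := by linarith
        have h2 : ∑ i ∈ Finset.range M, r ^ (i + 1) ≤ (1 - r)⁻¹ := by
          rw [← tsum_geometric_of_lt_one h0 h1]
          refine (Finset.sum_le_sum fun i _ => ?_).trans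
            ((summable_geometric_of_lt_one h0 h1).sum_le_tsum (Finset.range M)
              fun i _ => by positivity)
          exact pow_le_pow_of_le_one h0 h1.le (Nat.le_succ i)
        gcongr

/-- The generating function of `pbar`. -/
noncomputable def pbarGen (q : ℂ) : ℂ := ∑' n, (pbar n : ℂ) * q ^ n

lemma summable_norm_pbar_mul_pow {q : ℂ} (hq : ‖q‖ < 1) :
    Summable fun n => ‖(pbar n : ℂ) * q ^ n‖ := by
  simpa using summable_pbar_mul_pow (norm_nonneg q) hq

open PowerSeries Filter Topology in
lemma tendsto_prod_pbarGen {q : ℂ} (hq : ‖q‖ < 1) :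
    Tendsto (fun N => ∏ i ∈ Finset.range N, ((1 + q ^ (i + 1)) * (1 - q ^ (i + 1))⁻¹)) atTop
      (𝓝 (pbarGen q)) := by
  simp_rw [← fun N => (overProd_absSumsTo N hq).2]
  refine tendsto_tsum_of_dominated_convergence (summable_norm_pbar_mul_pow hq) (fun n => ?_)
    (Eventually.of_forall fun N n => ?_)
  · refine tendsto_const_nhds.congr' ?_
    filter_upwards [eventually_ge_atTop n] with N hN
    rw [← pbar_eq_coeff hN, Complex.ofReal_natCast]
  · rw [norm_mul, norm_mul, Complex.norm_real, Complex.norm_natCast,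
      Real.norm_of_nonneg (coeff_overProd_nonneg _ _)]
    gcongr
    rw [pbar_eq_coeff (le_max_left n N)]
    exact coeff_overProd_mono n (le_max_right n N)

lemma log_norm_one_add_sub_log_norm_one_sub_le {w : ℂ} (hw : ‖w‖ < 1) :
    Real.log ‖1 + w‖ - Real.log ‖1 - w‖ ≤
      Real.log (1 + ‖w‖) - Real.log (1 - ‖w‖) - 2 * (‖w‖ - w.re) := by
  have key (z : ℂ) (hz : ‖z‖ < 1) : HasSum (fun n : ℕ => ((-1) ^ (n + 1) + 1) / n * (z ^ n).re)
      (Real.log ‖1 + z‖ - Real.log ‖1 - z‖) := by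
    have h := Complex.hasSum_re
      ((Complex.hasSum_taylorSeries_log hz).add (Complex.hasSum_taylorSeries_neg_log hz))
    rw [Complex.add_re, Complex.neg_re, Complex.log_re, Complex.log_re, ← sub_eq_add_neg] at h
    refine h.congr_fun fun n => ?_
    have : ((-1) ^ (n + 1) * z ^ n / n + z ^ n / n : ℂ) =
        (((((-1) ^ (n + 1) + 1) / n : ℝ)) : ℂ) * z ^ n := by
      push_cast; ring
    rw [this, Complex.re_ofReal_mul]
  have hw' : ‖((‖w‖ : ℝ) : ℂ)‖ < 1 := by simpa using hw
  have h := (key _ hw').sub (key _ hw)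
  have h1 := le_hasSum h 1 ?_
  · have e1 : ‖(1 : ℂ) + (‖w‖ : ℝ)‖ = 1 + ‖w‖ := by
      rw [← Complex.ofReal_one, ← Complex.ofReal_add, Complex.norm_real,
        Real.norm_of_nonneg (by positivity)]
    have e2 : ‖(1 : ℂ) - (‖w‖ : ℝ)‖ = 1 - ‖w‖ := by
      rw [← Complex.ofReal_one, ← Complex.ofReal_sub, Complex.norm_real,
        Real.norm_of_nonneg (by linarith)]
    rw [e1, e2] at h1
    norm_num at h1
    linarith
  · intro n _
    rw [← mul_sub, ← Complex.ofReal_pow, Complex.ofReal_re, ← norm_pow]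
    refine mul_nonneg (div_nonneg ?_ (by positivity)) (sub_nonneg.mpr (Complex.re_le_norm _))
    rcases neg_one_pow_eq_or ℝ (n + 1) with h | h <;> rw [h] <;> norm_num

open Filter Topology in
/-- A bound for the generating function away from the positive real axis. -/
lemma norm_pbarGen_le {q : ℂ} (hq : ‖q‖ < 1) :
    ‖pbarGen q‖ ≤ ‖pbarGen (‖q‖ : ℝ)‖ *
      Real.exp (-(2 * (‖q‖ / (1 - ‖q‖) - (q / (1 - q)).re))) := by
  have hq' : ‖((‖q‖ : ℝ) : ℂ)‖ < 1 := by simpa using hq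
  have h1 := (tendsto_prod_pbarGen hq).norm
  have h2 := (tendsto_prod_pbarGen hq').norm
  have h3 : HasSum (fun i : ℕ => ‖q‖ ^ (i + 1)) (‖q‖ / (1 - ‖q‖)) := by
    simpa [pow_succ', div_eq_mul_inv] using
      (hasSum_geometric_of_lt_one (norm_nonneg q) hq).mul_left ‖q‖
  have h4 : HasSum (fun i : ℕ => q ^ (i + 1)) (q / (1 - q)) := by
    simpa [pow_succ', div_eq_mul_inv] using (hasSum_geometric_of_norm_lt_one hq).mul_left q
  have h5 := ((h3.sub (Complex.hasSum_re h4)).mul_left 2).tendsto_sum_nat.neg.rexp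
  refine le_of_tendsto_of_tendsto' h1 (h2.mul h5) fun N => ?_
  rw [← Finset.sum_neg_distrib, Real.exp_sum, norm_prod, norm_prod, ← Finset.prod_mul_distrib]
  refine Finset.prod_le_prod (fun _ _ => norm_nonneg _) fun i _ => ?_
  have hw : ‖q ^ (i + 1)‖ < 1 := by
    rw [norm_pow]; exact pow_lt_one₀ (norm_nonneg _) hq (by simp)
  rw [← Complex.ofReal_pow, ← norm_pow]
  generalize q ^ (i + 1) = w at hw
  have h := log_norm_one_add_sub_log_norm_one_sub_le hw
  have n1 : 0 < ‖1 + w‖ := norm_pos_iff.mpr fun h0 => by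
    rw [add_eq_zero_iff_neg_eq] at h0
    rw [← h0] at hw
    simp at hw
  have n2 : 0 < ‖1 - w‖ := norm_pos_iff.mpr fun h0 => by
    rw [sub_eq_zero] at h0
    rw [← h0] at hw
    simp at hw
  have e1 : ‖(1 : ℂ) + (‖w‖ : ℝ)‖ = 1 + ‖w‖ := by
    rw [← Complex.ofReal_one, ← Complex.ofReal_add, Complex.norm_real,
      Real.norm_of_nonneg (by positivity)]
  have e2 : ‖(1 : ℂ) - (‖w‖ : ℝ)‖ = 1 - ‖w‖ := by
    rw [← Complex.ofReal_one, ← Complex.ofReal_sub, Complex.norm_real,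
      Real.norm_of_nonneg (by linarith)]
  rw [norm_mul, norm_mul, norm_inv, norm_inv, e1, e2]
  have p1 : 0 < 1 + ‖w‖ := by positivity
  have p2 : 0 < 1 - ‖w‖ := by linarith
  rw [← Real.log_div n1.ne' n2.ne', ← Real.log_div p1.ne' p2.ne'] at h
  have := Real.exp_le_exp.mpr h
  rw [Real.exp_sub, Real.exp_log (by positivity), Real.exp_log (by positivity)] at this
  simpa only [div_eq_mul_inv, Real.exp_neg] using this

lemma hasSum_neg_one_pow_mul_sq {q : ℂ} (hq : ‖q‖ < 1) :
    Summable fun n : ℕ => (-1) ^ (n + 1) * q ^ ((n + 1) ^ 2) := by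
  refine Summable.of_norm_bounded (summable_geometric_of_lt_one (norm_nonneg q) hq) fun n => ?_
  rw [norm_mul, norm_pow, norm_pow, norm_neg, norm_one, one_pow, one_mul]
  exact pow_le_pow_of_le_one (norm_nonneg q) hq.le (by nlinarith)

lemma hasSum_thetaCoeff {q : ℂ} (hq : ‖q‖ < 1) :
    HasSum (fun n => (thetaCoeff n : ℂ) * q ^ n)
      (1 + 2 * ∑' n : ℕ, (-1) ^ (n + 1) * q ^ ((n + 1) ^ 2)) := by
  have h1 := (hasSum_neg_one_pow_mul_sq hq).hasSum.mul_left 2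
  have hinj : Function.Injective fun n : ℕ => (n + 1) ^ 2 := fun a b h => by
    have := Nat.pow_left_injective two_ne_zero h
    simpa using this
  have h2 : HasSum (fun m => if m = 0 then 0 else (thetaCoeff m : ℂ) * q ^ m)
      (2 * ∑' n : ℕ, (-1) ^ (n + 1) * q ^ ((n + 1) ^ 2)) := by
    refine (hinj.hasSum_iff fun m hm => ?_).mp (h1.congr_fun fun n => ?_)
    · split_ifs with h0
      · rfl
      · rw [thetaCoeff, if_neg h0, if_neg]
        · simp
        · rintro ⟨r, rfl⟩
          refine hm ⟨r - 1, ?_⟩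
          have : r ≠ 0 := by rintro rfl; simp at h0
          simp only
          rw [Nat.sub_add_cancel (by omega)]
          ring
    · simp only [Function.comp]
      have : (n + 1) ^ 2 ≠ 0 := by positivity
      rw [if_neg this, thetaCoeff, if_neg this, if_pos ⟨n + 1, by ring⟩]
      have : ((-1 : ℂ)) ^ ((n + 1) ^ 2) = (-1) ^ (n + 1) := by
        rw [pow_two, pow_mul]
        rcases Nat.even_or_odd (n + 1) with h' | h' <;> simp [h'.neg_one_pow]
      push_cast
      rw [this]
      ring
  refine ((hasSum_ite_eq 0 (1 : ℂ)).add h2).congr_fun fun n => ?_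
  split_ifs with h
  · simp [h, thetaCoeff]
  · simp

lemma summable_norm_thetaCoeff {q : ℂ} (hq : ‖q‖ < 1) :
    Summable fun n => ‖(thetaCoeff n : ℂ) * q ^ n‖ := by
  refine Summable.of_nonneg_of_le (fun _ => norm_nonneg _) (fun n => ?_)
    ((summable_geometric_of_lt_one (norm_nonneg q) hq).mul_left 2)
  rw [norm_mul, norm_pow, Complex.norm_real]
  gcongr
  rw [thetaCoeff]
  split_ifs <;> simp

lemma pbarGen_mul_theta {q : ℂ} (hq : ‖q‖ < 1) :
    pbarGen q * (1 + 2 * ∑' n : ℕ, (-1) ^ (n + 1) * q ^ ((n + 1) ^ 2)) = 1 := by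
  rw [← (hasSum_thetaCoeff hq).tsum_eq, pbarGen,
    tsum_mul_tsum_eq_tsum_sum_antidiagonal_of_summable_norm (summable_norm_pbar_mul_pow hq)
      (summable_norm_thetaCoeff hq)]
  have h (n : ℕ) : ∑ kl ∈ Finset.HasAntidiagonal.antidiagonal n,
      ((pbar kl.1 : ℂ) * q ^ kl.1) * ((thetaCoeff kl.2 : ℂ) * q ^ kl.2) =
      if n = 0 then 1 else 0 := by
    have h2 : ∑ kl ∈ Finset.HasAntidiagonal.antidiagonal n,
        ((pbar kl.1 : ℂ) * q ^ kl.1) * ((thetaCoeff kl.2 : ℂ) * q ^ kl.2) =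
        ((∑ kl ∈ Finset.HasAntidiagonal.antidiagonal n,
          (pbar kl.1 : ℝ) * thetaCoeff kl.2 : ℝ) : ℂ) * q ^ n := by
      rw [Complex.ofReal_sum, Finset.sum_mul]
      refine Finset.sum_congr rfl fun kl hkl => ?_
      rw [← Finset.HasAntidiagonal.mem_antidiagonal.mp hkl, pow_add]
      push_cast
      ring
    rw [h2, sum_pbar_mul_thetaCoeff]
    split_ifs with h0
    · simp [h0]
    · simp
  simp_rw [h]
  simp

lemma norm_cexp_neg_lt_one {s : ℂ} (hs : 0 < s.re) : ‖Complex.exp (-s)‖ < 1 := by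
  rw [Complex.norm_exp, Complex.neg_re]
  exact Real.exp_lt_one_iff.mpr (by linarith)

open Complex in
lemma theta_eq_jacobiTheta₂ {s : ℂ} (hs : 0 < s.re) :
    1 + 2 * ∑' n : ℕ, (-1) ^ (n + 1) * Complex.exp (-s) ^ ((n + 1) ^ 2) =
      jacobiTheta₂ (1 / 2) (I * s / π) := by
  have hτ : 0 < (I * s / π).im := by
    rw [Complex.div_ofReal_im]
    simpa using div_pos hs Real.pi_pos
  have hπ : (π : ℂ) ≠ 0 := by exact_mod_cast Real.pi_ne_zero
  have h1 := (hasSum_neg_one_pow_mul_sq (norm_cexp_neg_lt_one hs)).hasSum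
  have ht (n : ℕ) : Complex.exp (2 * π * I * n * (1 / 2) + π * I * n ^ 2 * (I * s / π)) =
      (-1) ^ n * Complex.exp (-s) ^ (n ^ 2) := by
    rw [← Complex.exp_pi_mul_I, ← Complex.exp_nat_mul, ← Complex.exp_nat_mul, ← Complex.exp_add]
    congr 1
    push_cast
    field_simp
    linear_combination (n ^ 2 * s) * Complex.I_sq
  have h2 : HasSum (fun n : ℕ => jacobiTheta₂_term (n : ℤ) (1 / 2) (I * s / π))
      (1 + ∑' n : ℕ, (-1) ^ (n + 1) * Complex.exp (-s) ^ ((n + 1) ^ 2)) := by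
    have h3 : HasSum (fun n : ℕ => (-1) ^ n * Complex.exp (-s) ^ (n ^ 2))
        (1 + ∑' n : ℕ, (-1) ^ (n + 1) * Complex.exp (-s) ^ ((n + 1) ^ 2)) := by
      rw [add_comm]
      simpa using (hasSum_nat_add_iff (f := fun n : ℕ => (-1) ^ n * Complex.exp (-s) ^ (n ^ 2))
        1).mp h1
    refine h3.congr_fun fun n => ?_
    rw [jacobiTheta₂_term, ← ht]
    norm_cast
  have h4 : HasSum (fun n : ℕ => jacobiTheta₂_term (-(n + 1 : ℤ)) (1 / 2) (I * s / π))
      (∑' n : ℕ, (-1) ^ (n + 1) * Complex.exp (-s) ^ ((n + 1) ^ 2)) := by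
    refine h1.congr_fun fun n => ?_
    rw [jacobiTheta₂_term, ← ht (n + 1)]
    have : Complex.exp (-(2 * π * I * (n + 1 : ℕ))) = 1 := by
      rw [Complex.exp_neg, Complex.exp_eq_one_iff.mpr ⟨(n + 1 : ℕ), by push_cast; ring⟩, inv_one]
    refine Eq.trans ?_ ((congrArg (_ * ·) this).trans (mul_one _))
    rw [← Complex.exp_add]
    congr 1
    push_cast
    ring
  have h5 := (HasSum.of_nat_of_neg_add_one
    (f := fun n : ℤ => jacobiTheta₂_term n (1 / 2) (I * s / π)) h2 h4).unique (hasSum_jacobiTheta₂_term (1 / 2) hτ)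
  rw [← h5]
  ring

/-- The tail `∑_{n ≥ 1} e^{-4 n (n + 1) w}` in the transformed theta function. -/
noncomputable def thetaTail (w : ℂ) : ℂ := ∑' n : ℕ, Complex.exp (-(4 * w * ((n + 1) * (n + 2))))

lemma norm_thetaTail_term_le {w : ℂ} (hw : 0 < w.re) (n : ℕ) :
    ‖Complex.exp (-(4 * w * ((n + 1) * (n + 2))))‖ ≤
      Real.exp (-(8 * w.re)) * Real.exp (-(8 * w.re)) ^ n := by
  rw [Complex.norm_exp, ← Real.exp_nat_mul, ← Real.exp_add, Real.exp_le_exp]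
  have : (-(4 * w * ((n + 1) * (n + 2)))).re = -(4 * w.re * ((n + 1) * (n + 2))) := by
    have : -(4 * w * ((n + 1) * (n + 2))) = ((-(4 * ((n + 1) * (n + 2))) : ℝ) : ℂ) * w := by
      push_cast; ring
    rw [this, Complex.re_ofReal_mul]; ring
  rw [this]
  have : (0 : ℝ) ≤ n := n.cast_nonneg
  nlinarith [mul_nonneg hw.le this, mul_nonneg (mul_nonneg hw.le this) this]

lemma summable_thetaTail {w : ℂ} (hw : 0 < w.re) :
    Summable fun n : ℕ => Complex.exp (-(4 * w * ((n + 1) * (n + 2)))) := by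
  refine Summable.of_norm_bounded ?_ (norm_thetaTail_term_le hw)
  exact (summable_geometric_of_lt_one (Real.exp_pos _).le
    (Real.exp_lt_one_iff.mpr (by linarith))).mul_left _

lemma norm_thetaTail_le {w : ℂ} (hw : 1 ≤ w.re) :
    ‖thetaTail w‖ ≤ 2 * Real.exp (-(8 * w.re)) := by
  have h0 : 0 < w.re := by linarith
  have h1 : Real.exp (-(8 * w.re)) ≤ 1 / 2 := by
    rw [Real.exp_neg, inv_eq_one_div]
    refine one_div_le_one_div_of_le (by norm_num) ?_
    linarith [Real.add_one_le_exp (8 * w.re)]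
  have hlt : Real.exp (-(8 * w.re)) < 1 := by linarith
  refine (tsum_of_norm_bounded ((hasSum_geometric_of_lt_one (Real.exp_pos _).le hlt).mul_left _)
    (norm_thetaTail_term_le h0)).trans ?_
  rw [mul_comm]
  gcongr
  rw [inv_eq_one_div, div_le_iff₀ (by linarith)]
  linarith

lemma thetaTail_ofReal (x : ℝ) : ∃ d : ℝ, 0 ≤ d ∧ thetaTail (x : ℂ) = d := by
  refine ⟨∑' n : ℕ, Real.exp (-(4 * x * ((n + 1) * (n + 2)))),
    tsum_nonneg fun n => (Real.exp_pos _).le, ?_⟩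
  rw [thetaTail, Complex.ofReal_tsum]
  push_cast
  rfl

open Complex in
lemma theta_transform {s : ℂ} (hs : 0 < s.re) :
    (s / π) ^ (1 / 2 : ℂ) * jacobiTheta₂ (1 / 2) (I * s / π) =
      Complex.exp (-(π ^ 2 / (4 * s))) * (2 * (1 + thetaTail (π ^ 2 / (4 * s)))) := by
  have hπ : (π : ℂ) ≠ 0 := by exact_mod_cast Real.pi_ne_zero
  have hs0 : s ≠ 0 := by rintro rfl; simp at hs
  have hw : 0 < (π ^ 2 / (4 * s) : ℂ).re := by
    have : (π ^ 2 / (4 * s) : ℂ) = ((π ^ 2 / 4 : ℝ) : ℂ) * s⁻¹ := by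
      push_cast; field_simp
    rw [this, Complex.re_ofReal_mul, Complex.inv_re]
    have := Complex.normSq_pos.mpr hs0
    positivity
  have hτ' : 0 < (-1 / (I * s / π)).im := by
    have : (-1 / (I * s / π) : ℂ) = I * (((4 / π : ℝ) : ℂ) * (π ^ 2 / (4 * s))) := by
      push_cast; field_simp; linear_combination (-1) * Complex.I_sq
    rw [this, Complex.I_mul_im, Complex.re_ofReal_mul]
    positivity
  have hpow : (s / π) ^ (1 / 2 : ℂ) ≠ 0 := by
    rw [Complex.cpow_ne_zero_iff]
    left
    exact div_ne_zero hs0 hπ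
  have e1 : -I * (I * s / π) = s / π := by
    linear_combination (-s / π) * Complex.I_sq
  have e2 : (-π * I * (1 / 2) ^ 2 / (I * s / π) : ℂ) = -(π ^ 2 / (4 * s)) := by
    field_simp
    ring
  rw [jacobiTheta₂_functional_equation, e1, e2]
  have ht : jacobiTheta₂ (1 / 2 / (I * s / π)) (-1 / (I * s / π)) =
      2 * (1 + thetaTail (π ^ 2 / (4 * s))) := by
    have hsum := (summable_thetaTail hw).hasSum
    rw [← thetaTail] at hsum
    have hterm (n : ℤ) : jacobiTheta₂_term n (1 / 2 / (I * s / π)) (-1 / (I * s / π)) =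
        Complex.exp (4 * (π ^ 2 / (4 * s)) * (n - n ^ 2)) := by
      rw [jacobiTheta₂_term]
      congr 1
      field_simp
      ring
    have h2 : HasSum (fun n : ℕ => jacobiTheta₂_term (n : ℤ) (1 / 2 / (I * s / π))
        (-1 / (I * s / π))) (thetaTail (π ^ 2 / (4 * s)) + 2) := by
      have := (hasSum_nat_add_iff (f := fun n : ℕ =>
        Complex.exp (4 * (π ^ 2 / (4 * s)) * (n - n ^ 2))) 2
        (g := thetaTail (π ^ 2 / (4 * s)))).mp ?_
      · simp only [Finset.sum_range_succ, Finset.sum_range_zero] at this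
        norm_num at this
        refine this.congr_fun fun n => ?_
        rw [hterm]
        push_cast
        rfl
      · refine hsum.congr_fun fun n => ?_
        congr 1
        push_cast
        ring
    have h3 : HasSum (fun n : ℕ => jacobiTheta₂_term (-(n + 1 : ℤ)) (1 / 2 / (I * s / π))
        (-1 / (I * s / π))) (thetaTail (π ^ 2 / (4 * s))) := by
      refine hsum.congr_fun fun n => ?_
      rw [hterm]
      congr 1
      push_cast
      ring
    rw [← (HasSum.of_nat_of_neg_add_one (f := fun n : ℤ => jacobiTheta₂_term n
      (1 / 2 / (I * s / π)) (-1 / (I * s / π))) h2 h3).unique (hasSum_jacobiTheta₂_term _ hτ')]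
    ring
  rw [ht]
  field_simp

lemma pbarGen_exp_neg {s : ℂ} (hs : 0 < s.re) :
    pbarGen (Complex.exp (-s)) * (2 * (1 + thetaTail (π ^ 2 / (4 * s)))) =
      (s / π) ^ (1 / 2 : ℂ) * Complex.exp (π ^ 2 / (4 * s)) := by
  have h1 := pbarGen_mul_theta (norm_cexp_neg_lt_one hs)
  rw [theta_eq_jacobiTheta₂ hs] at h1
  have h2 := theta_transform hs
  have h3 : Complex.exp (-(π ^ 2 / (4 * s))) * Complex.exp (π ^ 2 / (4 * s)) = 1 := by
    rw [← Complex.exp_add, neg_add_cancel, Complex.exp_zero]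
  linear_combination (-(pbarGen (Complex.exp (-s)) * 2 * (1 + thetaTail (π ^ 2 / (4 * s))))) * h3
    - (pbarGen (Complex.exp (-s)) * Complex.exp (π ^ 2 / (4 * s))) * h2
    + (s / π) ^ (1 / 2 : ℂ) * Complex.exp (π ^ 2 / (4 * s)) * h1

open MeasureTheory Set Filter Topology in
lemma integrableOn_rpow_mul_cexp {s : ℂ} (hs : 0 < s.re) {a : ℝ} (ha : -1 < a) :
    IntegrableOn (fun t : ℝ => ((t ^ a : ℝ) : ℂ) * Complex.exp (-(s * t))) (Ioi 0) := by
  refine Integrable.mono' (g := fun t : ℝ => t ^ a * rexp (-s.re * t ^ (1 : ℝ)))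
    (integrableOn_rpow_mul_exp_neg_mul_rpow ha one_pos hs) ?_ ?_
  · refine ContinuousOn.aestronglyMeasurable (fun t ht => ContinuousAt.continuousWithinAt ?_)
      measurableSet_Ioi
    refine (Complex.continuous_ofReal.continuousAt.comp
      (continuousAt_id.rpow_const (Or.inl (ne_of_gt ht)))).mul (by fun_prop)
  · refine (ae_restrict_mem measurableSet_Ioi).mono fun t ht => ?_
    rw [norm_mul, Complex.norm_real, Complex.norm_exp, Real.norm_of_nonneg
      (rpow_nonneg (le_of_lt ht) _), rpow_one]
    simp

open MeasureTheory Set Filter Topology in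
lemma integral_rpow_neg_half_mul_cexp {s : ℂ} (hs : 0 < s.re) :
    ∫ t in Ioi (0 : ℝ), ((t ^ (-(1 / 2) : ℝ) : ℝ) : ℂ) * Complex.exp (-(s * t)) =
      (π / s) ^ (1 / 2 : ℂ) := by
  rw [← integral_comp_rpow_Ioi_of_pos two_pos]
  have h : ∫ x in Ioi (0 : ℝ), ((2 : ℝ) * x ^ ((2 : ℝ) - 1)) •
      ((((x ^ (2 : ℝ)) ^ (-(1 / 2) : ℝ) : ℝ) : ℂ) * Complex.exp (-(s * (x ^ (2 : ℝ) : ℝ)))) =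
      ∫ x in Ioi (0 : ℝ), 2 * Complex.exp (-s * x ^ 2) := by
    refine setIntegral_congr_fun measurableSet_Ioi fun x hx => ?_
    have hx : 0 < x := hx
    rw [← rpow_mul hx.le, show (2 : ℝ) * -(1 / 2) = -1 by norm_num, rpow_neg_one,
      show (2 : ℝ) - 1 = 1 by norm_num, rpow_one, rpow_two, Complex.real_smul]
    have : (x : ℂ) ≠ 0 := by exact_mod_cast hx.ne'
    push_cast
    field_simp
  rw [h, integral_const_mul, integral_gaussian_complex_Ioi hs]
  ring

open MeasureTheory Set Filter Topology in
lemma tendsto_rpow_mul_cexp_atTop {s : ℂ} (hs : 0 < s.re) (a : ℝ) :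
    Tendsto (fun t : ℝ => ((t ^ a : ℝ) : ℂ) * Complex.exp (-(s * t))) atTop (𝓝 0) := by
  rw [tendsto_zero_iff_norm_tendsto_zero]
  refine (tendsto_rpow_mul_exp_neg_mul_atTop_nhds_zero a s.re hs).congr' ?_
  filter_upwards [eventually_gt_atTop 0] with t ht
  rw [norm_mul, Complex.norm_real, Complex.norm_exp, Real.norm_of_nonneg (rpow_nonneg ht.le _)]
  simp

open MeasureTheory Set Filter Topology in
lemma integral_rpow_succ_mul_cexp {s : ℂ} (hs : 0 < s.re) {a : ℝ} (ha : -1 < a) :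
    ∫ t in Ioi (0 : ℝ), ((t ^ (a + 1) : ℝ) : ℂ) * Complex.exp (-(s * t)) =
      (a + 1) / s * ∫ t in Ioi (0 : ℝ), ((t ^ a : ℝ) : ℂ) * Complex.exp (-(s * t)) := by
  have hs0 : s ≠ 0 := by rintro rfl; simp at hs
  have hi := integrableOn_rpow_mul_cexp hs ha
  have hi' := integrableOn_rpow_mul_cexp hs (show -1 < a + 1 by linarith)
  have hderiv : ∀ t ∈ Ioi (0 : ℝ),
      HasDerivAt (fun t : ℝ => ((t ^ (a + 1) : ℝ) : ℂ) * Complex.exp (-(s * t)))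
        ((a + 1) * (((t ^ a : ℝ) : ℂ) * Complex.exp (-(s * t))) -
          s * (((t ^ (a + 1) : ℝ) : ℂ) * Complex.exp (-(s * t)))) t := by
    intro t ht
    have h1 := (Real.hasDerivAt_rpow_const (x := t) (p := a + 1) (Or.inl (ne_of_gt ht))).ofReal_comp
    have h2 : HasDerivAt (fun t : ℝ => Complex.exp (-(s * t))) (Complex.exp (-(s * t)) * -(s * 1)) t :=
      (((hasDerivAt_id t).ofReal_comp.const_mul s).neg).cexp
    refine (h1.mul h2).congr_deriv ?_
    rw [add_sub_cancel_right]
    push_cast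
    ring
  have hc : ContinuousWithinAt (fun t : ℝ => ((t ^ (a + 1) : ℝ) : ℂ) * Complex.exp (-(s * t)))
      (Ici 0) 0 := by
    refine ContinuousAt.continuousWithinAt ((Complex.continuous_ofReal.continuousAt.comp
      (continuousAt_id.rpow_const (Or.inr (by linarith)))).mul (by fun_prop))
  have h := integral_Ioi_of_hasDerivAt_of_tendsto hc hderiv ((hi.const_mul _).sub (hi'.const_mul _))
    (tendsto_rpow_mul_cexp_atTop hs _)
  rw [integral_sub (hi.const_mul _) (hi'.const_mul _), integral_const_mul, integral_const_mul,
    zero_rpow (by linarith)] at h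
  simp only [Complex.ofReal_zero, zero_mul, sub_zero] at h
  rw [div_mul_eq_mul_div, eq_div_iff hs0]
  linear_combination -h

open MeasureTheory Set in
lemma integral_rpow_nat_sub_half_mul_cexp {s : ℂ} (hs : 0 < s.re) (m : ℕ) :
    ∫ t in Ioi (0 : ℝ), ((t ^ ((m : ℝ) - 1 / 2) : ℝ) : ℂ) * Complex.exp (-(s * t)) =
      (π / s) ^ (1 / 2 : ℂ) * ((2 * m).factorial / (4 ^ m * m.factorial * s ^ m)) := by
  have hs0 : s ≠ 0 := by rintro rfl; simp at hs
  induction m with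
  | zero =>
    have := integral_rpow_neg_half_mul_cexp hs
    norm_num at this ⊢
    exact this
  | succ m ih =>
    have h := integral_rpow_succ_mul_cexp hs (a := (m : ℝ) - 1 / 2)
      (by linarith [m.cast_nonneg (α := ℝ)])
    rw [show (m : ℝ) - 1 / 2 + 1 = ((m + 1 : ℕ) : ℝ) - 1 / 2 by push_cast; ring, ih] at h
    rw [h, show 2 * (m + 1) = 2 * m + 1 + 1 by ring, Nat.factorial_succ, Nat.factorial_succ,
      Nat.factorial_succ]
    have : (m.factorial : ℂ) ≠ 0 := by exact_mod_cast m.factorial_ne_zero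
    have : (m + 1 : ℂ) ≠ 0 := by exact_mod_cast m.succ_ne_zero
    push_cast
    field_simp
    ring

/-- Coefficients of the inverse Laplace transform of the main term. -/
noncomputable def lapCoeff (k : ℕ) : ℝ := (2 * k + 3) * π ^ (2 * k + 4) / (2 * k + 4).factorial

/-- The inverse Laplace transform of `4 * π` times the main term. -/
noncomputable def lapFun (t : ℝ) : ℝ := ∑' k : ℕ, lapCoeff k * t ^ (((k + 1 : ℕ) : ℝ) - 1 / 2)

/-- The main term of the generating function near `q = 1`, where `q = e^{-s}`. -/
noncomputable def mainTerm (s : ℂ) : ℂ :=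
  1 / 2 * (s / π) ^ (1 / 2 : ℂ) *
    (Complex.exp (π ^ 2 / (4 * s)) - 1 - π ^ 2 / (4 * s))

lemma lapCoeff_nonneg (k : ℕ) : 0 ≤ lapCoeff k := by
  rw [lapCoeff]; have := pi_pos; positivity

lemma hasSum_lapFun {t : ℝ} (ht : 0 < t) :
    HasSum (fun k : ℕ => lapCoeff k * t ^ (((k + 1 : ℕ) : ℝ) - 1 / 2))
      (t⁻¹ * (√t)⁻¹ * (π * √t * sinh (π * √t) - cosh (π * √t) + 1 - (π * √t) ^ 2 / 2)) := by
  set u := π * √t with hu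
  have hst : 0 < √t := sqrt_pos.mpr ht
  have h1 : HasSum (fun n : ℕ => u * (u ^ (2 * n + 1) / (2 * n + 1).factorial) -
      u ^ (2 * (n + 1)) / (2 * (n + 1)).factorial) (u * sinh u - (cosh u - 1)) := by
    refine ((hasSum_sinh u).mul_left u).sub ?_
    have := (hasSum_nat_add_iff' (f := fun n : ℕ => u ^ (2 * n) / (2 * n).factorial) 1).mpr
      (hasSum_cosh u)
    simpa using this
  have h2 := ((hasSum_nat_add_iff' 1).mpr h1).mul_left (t⁻¹ * (√t)⁻¹)
  have h3 : t⁻¹ * (√t)⁻¹ * (u * sinh u - cosh u + 1 - u ^ 2 / 2) = t⁻¹ * (√t)⁻¹ *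
      (u * sinh u - (cosh u - 1) - ∑ i ∈ Finset.range 1, (u * (u ^ (2 * i + 1) /
        (2 * i + 1).factorial) - u ^ (2 * (i + 1)) / (2 * (i + 1)).factorial)) := by
    simp
    left
    ring
  rw [h3]
  refine h2.congr_fun fun k => ?_
  rw [lapCoeff, rpow_sub ht, rpow_natCast, ← sqrt_eq_rpow, hu,
    show 2 * (k + 1 + 1) = 2 * (k + 1) + 1 + 1 by ring, Nat.factorial_succ (2 * (k + 1) + 1),
    show (2 * k + 4).factorial = (2 * (k + 1) + 1 + 1).factorial by ring_nf,
    Nat.factorial_succ (2 * (k + 1) + 1), mul_pow, mul_pow]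
  have h4 : √t ^ (2 * (k + 1) + 1) = t ^ (k + 1) * √t := by
    rw [pow_succ, pow_mul, sq_sqrt ht.le]
  have h5 : √t ^ (2 * (k + 1) + 1 + 1) = t ^ (k + 2) := by
    rw [show 2 * (k + 1) + 1 + 1 = 2 * (k + 2) by ring, pow_mul, sq_sqrt ht.le]
  rw [h4, h5]
  have h6 : √t * √t = t := mul_self_sqrt ht.le
  have : ((2 * (k + 1) + 1).factorial : ℝ) ≠ 0 := by exact_mod_cast Nat.factorial_ne_zero _
  have h7 : π * √t * (π ^ (2 * (k + 1) + 1) * (t ^ (k + 1) * √t) / (2 * (k + 1) + 1).factorial) =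
    π ^ (2 * k + 4) * t ^ (k + 2) / (2 * (k + 1) + 1).factorial := by
    rw [show π * √t * (π ^ (2 * (k + 1) + 1) * (t ^ (k + 1) * √t) / (2 * (k + 1) + 1).factorial) =
      π * (π ^ (2 * (k + 1) + 1) * (t ^ (k + 1) * (√t * √t)) / (2 * (k + 1) + 1).factorial) by ring,
      h6]
    ring
  rw [h7]
  push_cast
  field_simp
  ring

open MeasureTheory Set in
/-- The Laplace transform of `lapFun`. -/
lemma integral_lapFun {s : ℂ} (hs : 0 < s.re) :
    ∫ t in Ioi (0 : ℝ), (lapFun t : ℂ) * Complex.exp (-(s * t)) = 4 * π * mainTerm s := by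
  have hs0 : s ≠ 0 := by rintro rfl; simp at hs
  have hπ : (π : ℂ) ≠ 0 := by exact_mod_cast Real.pi_ne_zero
  set w : ℂ := π ^ 2 / (4 * s) with hw
  have hterm {z : ℂ} (hz : 0 < z.re) (k : ℕ) :
      ∫ t in Ioi (0 : ℝ), (((lapCoeff k * t ^ (((k + 1 : ℕ) : ℝ) - 1 / 2) : ℝ)) : ℂ) *
        Complex.exp (-(z * t)) =
      2 * z * (π / z) ^ (1 / 2 : ℂ) * ((π ^ 2 / (4 * z)) ^ (k + 2) / (k + 2).factorial) := by
    have hz0 : z ≠ 0 := by rintro rfl; simp at hz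
    simp_rw [Complex.ofReal_mul, mul_assoc]
    rw [integral_const_mul, integral_rpow_nat_sub_half_mul_cexp hz, lapCoeff,
      show 2 * k + 4 = 2 * (k + 1) + 1 + 1 by ring, Nat.factorial_succ, Nat.factorial_succ,
      Nat.factorial_succ (k + 1), div_pow, mul_pow, ← pow_mul]
    have : ((2 * (k + 1)).factorial : ℂ) ≠ 0 := by exact_mod_cast Nat.factorial_ne_zero _
    have : ((k + 1).factorial : ℂ) ≠ 0 := by exact_mod_cast Nat.factorial_ne_zero _
    have : (2 * (k + 1) + 1 : ℂ) ≠ 0 := by exact_mod_cast Nat.succ_ne_zero (2 * (k + 1))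
    have : (2 * (k + 1) + 1 + 1 : ℂ) ≠ 0 := by exact_mod_cast Nat.succ_ne_zero (2 * (k + 1) + 1)
    have : (k + 1 + 1 : ℂ) ≠ 0 := by exact_mod_cast Nat.succ_ne_zero (k + 1)
    push_cast
    field_simp
    ring
  have hnorm (k : ℕ) : ∫ t in Ioi (0 : ℝ),
      ‖(((lapCoeff k * t ^ (((k + 1 : ℕ) : ℝ) - 1 / 2) : ℝ)) : ℂ) * Complex.exp (-(s * t))‖ =
      ‖2 * (s.re : ℂ) * (π / (s.re : ℂ)) ^ (1 / 2 : ℂ) *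
        ((π ^ 2 / (4 * (s.re : ℂ))) ^ (k + 2) / (k + 2).factorial)‖ := by
    rw [← hterm (z := (s.re : ℂ)) (by simpa using hs)]
    have h1 : ∀ t ∈ Ioi (0 : ℝ), (((lapCoeff k * t ^ (((k + 1 : ℕ) : ℝ) - 1 / 2) : ℝ)) : ℂ) *
        Complex.exp (-((s.re : ℂ) * t)) =
        ((‖(((lapCoeff k * t ^ (((k + 1 : ℕ) : ℝ) - 1 / 2) : ℝ)) : ℂ) *
          Complex.exp (-(s * t))‖ : ℝ) : ℂ) := by
      intro t ht
      rw [norm_mul, Complex.norm_real, Complex.norm_exp, Real.norm_of_nonneg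
        (mul_nonneg (lapCoeff_nonneg k) (rpow_nonneg (le_of_lt ht) _))]
      simp
    rw [setIntegral_congr_fun measurableSet_Ioi h1, integral_complex_ofReal, Complex.norm_real,
      Real.norm_of_nonneg (integral_nonneg fun _ => norm_nonneg _)]
  have hexp (x : ℂ) : HasSum (fun k : ℕ => x ^ (k + 2) / (k + 2).factorial)
      (Complex.exp x - 1 - x) := by
    have := (hasSum_nat_add_iff' (f := fun n : ℕ => x ^ n / n.factorial) 2).mpr
      (by simpa only [Complex.exp_eq_exp_ℂ] using NormedSpace.expSeries_div_hasSum_exp (𝔸 := ℂ) x)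
    simpa [Finset.sum_range_succ, sub_sub, Complex.exp_eq_exp_ℂ] using this
  have h := hasSum_integral_of_summable_integral_norm (μ := volume.restrict (Ioi (0 : ℝ)))
    (F := fun (k : ℕ) (t : ℝ) => (((lapCoeff k * t ^ (((k + 1 : ℕ) : ℝ) - 1 / 2) : ℝ)) : ℂ) *
      Complex.exp (-(s * t))) (fun k => ?_) ?_
  · have h2 : ∫ t in Ioi (0 : ℝ), (lapFun t : ℂ) * Complex.exp (-(s * t)) =
        ∫ t in Ioi (0 : ℝ), ∑' k : ℕ, (((lapCoeff k * t ^ (((k + 1 : ℕ) : ℝ) - 1 / 2) : ℝ)) : ℂ) *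
          Complex.exp (-(s * t)) := by
      refine setIntegral_congr_fun measurableSet_Ioi fun t ht => ?_
      rw [lapFun, Complex.ofReal_tsum, tsum_mul_right]
    rw [h2]
    simp_rw [hterm hs] at h
    rw [h.unique ((hexp w).mul_left _), mainTerm, ← hw]
    have harg : (s / π).arg ≠ π := by
      have : 0 < (s / π).re := by rw [Complex.div_ofReal_re]; exact div_pos hs pi_pos
      exact fun h => absurd (Complex.arg_eq_pi_iff.mp h).1 (by linarith)
    have h4 : (s / π) ^ (1 / 2 : ℂ) * (s / π) ^ (1 / 2 : ℂ) = s / π := by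
      rw [← Complex.cpow_add _ _ (div_ne_zero hs0 hπ)]
      norm_num
    have h5 : (s / π) ^ (1 / 2 : ℂ) ≠ 0 := by
      rw [Complex.cpow_ne_zero_iff]
      exact Or.inl (div_ne_zero hs0 hπ)
    rw [show (π / s : ℂ) = (s / π)⁻¹ by field_simp, Complex.inv_cpow _ _ harg]
    have h6 : 2 * s = 2 * π * ((s / π) ^ (1 / 2 : ℂ) * (s / π) ^ (1 / 2 : ℂ)) := by
      rw [h4]; field_simp
    rw [h6]
    generalize (s / π) ^ (1 / 2 : ℂ) = z at h5
    field_simp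
    ring
  · simp_rw [Complex.ofReal_mul, mul_assoc]
    refine (integrableOn_rpow_mul_cexp hs ?_).const_mul _
    push_cast
    linarith [k.cast_nonneg (α := ℝ)]
  · simp_rw [hnorm]
    exact ((hexp _).mul_left _).summable.norm

lemma lapFun_eq {t : ℝ} (ht : 0 < t) :
    lapFun t = t⁻¹ * (√t)⁻¹ *
      (π * √t * sinh (π * √t) - cosh (π * √t) + 1 - (π * √t) ^ 2 / 2) :=
  (hasSum_lapFun ht).tsum_eq

open Set Filter in
lemma continuousAt_lapFun {t : ℝ} (ht : 0 < t) : ContinuousAt lapFun t := by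
  have h : (fun t : ℝ => t⁻¹ * (√t)⁻¹ *
      (π * √t * sinh (π * √t) - cosh (π * √t) + 1 - (π * √t) ^ 2 / 2)) =ᶠ[nhds t] lapFun := by
    filter_upwards [lt_mem_nhds ht] with x hx using (lapFun_eq hx).symm
  refine ContinuousAt.congr ?_ h
  have h0 : t ≠ 0 := ht.ne'
  have h1 : √t ≠ 0 := (sqrt_pos.mpr ht).ne'
  fun_prop (disch := assumption)

/-- The line `re s = c` parametrized by frequency. -/
noncomputable def vertLine (c ξ : ℝ) : ℂ := c + 2 * π * ξ * Complex.I

@[simp] lemma vertLine_re (c ξ : ℝ) : (vertLine c ξ).re = c := by simp [vertLine]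

@[simp] lemma vertLine_im (c ξ : ℝ) : (vertLine c ξ).im = 2 * π * ξ := by simp [vertLine]

lemma norm_mainTerm_le {s : ℂ} (hs : 0 < s.re) :
    ‖mainTerm s‖ ≤ 4 * ‖s‖ ^ (-(3 / 2) : ℝ) * rexp (π ^ 2 / (4 * ‖s‖)) := by
  have hs0 : s ≠ 0 := by rintro rfl; simp at hs
  have hn : 0 < ‖s‖ := norm_pos_iff.mpr hs0
  have hw : ‖(π ^ 2 / (4 * s) : ℂ)‖ = π ^ 2 / (4 * ‖s‖) := by
    simp [abs_of_pos pi_pos]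
  have h1 := Complex.norm_exp_sub_sum_le_norm_mul_exp (π ^ 2 / (4 * s)) 2
  rw [hw] at h1
  have h2 : ‖(s / π) ^ (1 / 2 : ℂ)‖ = (‖s‖ / π) ^ (1 / 2 : ℝ) := by
    rw [show (1 / 2 : ℂ) = ((1 / 2 : ℝ) : ℂ) by push_cast; rfl, Complex.norm_cpow_real]
    simp [abs_of_pos pi_pos]
  have h3 : (‖s‖ / π) ^ (1 / 2 : ℝ) ≤ ‖s‖ ^ (1 / 2 : ℝ) :=
    rpow_le_rpow (by positivity) (div_le_self hn.le (by linarith [pi_gt_three])) (by norm_num)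
  have h4 : ‖s‖ ^ (1 / 2 : ℝ) * (π ^ 2 / (4 * ‖s‖)) ^ 2 =
      π ^ 4 / 16 * ‖s‖ ^ (-(3 / 2) : ℝ) := by
    rw [show (-(3 / 2) : ℝ) = 1 / 2 - (2 : ℕ) by norm_num, rpow_sub hn, rpow_natCast]
    field_simp
    ring
  have h5 : π ^ 4 / 16 ≤ 8 := by
    have := pi_lt_d2
    have : π ^ 4 ≤ 3.15 ^ 4 := by gcongr
    linarith
  rw [mainTerm, norm_mul, norm_mul, h2]
  have h6 : ‖Complex.exp (π ^ 2 / (4 * s)) - 1 - π ^ 2 / (4 * s)‖ ≤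
      (π ^ 2 / (4 * ‖s‖)) ^ 2 * rexp (π ^ 2 / (4 * ‖s‖)) := by
    simpa [Finset.sum_range_succ, sub_sub] using h1
  calc _ ≤ ‖(1 / 2 : ℂ)‖ * ‖s‖ ^ (1 / 2 : ℝ) *
        ((π ^ 2 / (4 * ‖s‖)) ^ 2 * rexp (π ^ 2 / (4 * ‖s‖))) := by gcongr
    _ = 1 / 2 * (‖s‖ ^ (1 / 2 : ℝ) * (π ^ 2 / (4 * ‖s‖)) ^ 2) * rexp (π ^ 2 / (4 * ‖s‖)) := by
        norm_num; ring
    _ = 1 / 2 * (π ^ 4 / 16 * ‖s‖ ^ (-(3 / 2) : ℝ)) * rexp (π ^ 2 / (4 * ‖s‖)) := by rw [h4]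
    _ ≤ 1 / 2 * (8 * ‖s‖ ^ (-(3 / 2) : ℝ)) * rexp (π ^ 2 / (4 * ‖s‖)) := by gcongr
    _ = _ := by ring

lemma continuous_mainTerm_vertLine {c : ℝ} (hc : 0 < c) :
    Continuous fun ξ => mainTerm (vertLine c ξ) := by
  have h0 (ξ : ℝ) : vertLine c ξ ≠ 0 := fun h => by
    have := congrArg Complex.re h
    simp at this
    linarith
  have hcont : Continuous (vertLine c) := by unfold vertLine; fun_prop
  have h1 : Continuous fun ξ => (vertLine c ξ / π) ^ (1 / 2 : ℂ) := by
    refine Continuous.cpow (by fun_prop) continuous_const fun ξ => Or.inl ?_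
    rw [Complex.div_ofReal_re, vertLine_re]
    exact div_pos hc pi_pos
  have h2 : Continuous fun ξ => (π ^ 2 / (4 * vertLine c ξ) : ℂ) :=
    continuous_const.div (by fun_prop) fun ξ => mul_ne_zero (by norm_num) (h0 ξ)
  unfold mainTerm
  fun_prop

open MeasureTheory in
lemma integrable_mainTerm_vertLine {c : ℝ} (hc : 0 < c) :
    Integrable fun ξ => mainTerm (vertLine c ξ) := by
  set m := min c 1 with hm
  have hm0 : 0 < m := lt_min hc one_pos
  have h1 : Integrable fun x : ℝ => (1 + ‖x‖ ^ 2) ^ (-(3 / 2) / 2 : ℝ) :=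
    integrable_rpow_neg_one_add_norm_sq (by norm_num)
  refine (h1.const_mul (4 * m ^ (-(3 / 2) : ℝ) * rexp (π ^ 2 / (4 * c)))).mono'
    (continuous_mainTerm_vertLine hc).aestronglyMeasurable (Filter.Eventually.of_forall fun ξ => ?_)
  have hcn : c ≤ ‖vertLine c ξ‖ := by
    simpa using Complex.re_le_norm (vertLine c ξ)
  have hn : m * (1 + ‖ξ‖ ^ 2) ^ (1 / 2 : ℝ) ≤ ‖vertLine c ξ‖ := by
    rw [← sqrt_eq_rpow, Complex.norm_def, Complex.normSq_apply, vertLine_re, vertLine_im,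
      ← sqrt_sq hm0.le, ← sqrt_mul (sq_nonneg m), Real.norm_eq_abs, sq_abs]
    refine sqrt_le_sqrt ?_
    have h2 : m ^ 2 ≤ c * c := by
      rw [← pow_two]; exact pow_le_pow_left₀ hm0.le (min_le_left _ _) 2
    have h3 : m ^ 2 ≤ 1 := pow_le_one₀ hm0.le (min_le_right _ _)
    have h4 : m ^ 2 * ξ ^ 2 ≤ 1 * ξ ^ 2 := by gcongr
    have h5 : 1 ≤ π ^ 2 := one_le_pow₀ (by linarith [pi_gt_three])
    nlinarith [mul_nonneg (sub_nonneg.mpr h5) (sq_nonneg ξ)]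
  refine (norm_mainTerm_le (by simpa using hc)).trans ?_
  have h6 : ‖vertLine c ξ‖ ^ (-(3 / 2) : ℝ) ≤
      m ^ (-(3 / 2) : ℝ) * (1 + ‖ξ‖ ^ 2) ^ (-(3 / 2) / 2 : ℝ) := by
    refine (rpow_le_rpow_of_nonpos (by positivity) hn (by norm_num)).trans_eq ?_
    rw [mul_rpow hm0.le (by positivity), ← rpow_mul (by positivity)]
    norm_num
  calc _ ≤ 4 * (m ^ (-(3 / 2) : ℝ) * (1 + ‖ξ‖ ^ 2) ^ (-(3 / 2) / 2 : ℝ)) *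
        rexp (π ^ 2 / (4 * c)) := by gcongr
    _ = _ := by ring

open MeasureTheory Set in
lemma integrableOn_lapFun {c : ℝ} (hc : 0 < c) :
    IntegrableOn (fun t : ℝ => (lapFun t : ℂ) * Complex.exp (-(c * t))) (Ioi 0) := by
  refine Integrable.of_integral_ne_zero ?_
  rw [integral_lapFun (by simpa using hc)]
  have hπ : (π : ℂ) ≠ 0 := by exact_mod_cast Real.pi_ne_zero
  have hc0 : (c : ℂ) ≠ 0 := by exact_mod_cast hc.ne'
  refine mul_ne_zero (mul_ne_zero (by norm_num) hπ) (mul_ne_zero (mul_ne_zero (by norm_num) ?_) ?_)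
  · rw [Complex.cpow_ne_zero_iff]
    exact Or.inl (div_ne_zero hc0 hπ)
  · have h : Complex.exp (π ^ 2 / (4 * c)) - 1 - π ^ 2 / (4 * c) =
        ((rexp (π ^ 2 / (4 * c)) - 1 - π ^ 2 / (4 * c) : ℝ) : ℂ) := by push_cast; rfl
    rw [h]
    have h2 : 0 < π ^ 2 / (4 * c) := by have := pi_pos; positivity
    have := add_one_lt_exp h2.ne'
    have h3 : rexp (π ^ 2 / (4 * c)) - 1 - π ^ 2 / (4 * c) ≠ 0 := by
      refine ne_of_gt ?_
      linarith
    exact_mod_cast h3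

open MeasureTheory Set in
/-- Laplace inversion for the main term. -/
lemma lapFun_inversion {c t : ℝ} (hc : 0 < c) (ht : 0 < t) :
    ∫ ξ : ℝ, mainTerm (vertLine c ξ) * Complex.exp (2 * π * t * ξ * Complex.I) =
      (lapFun t / (4 * π) * rexp (-(c * t)) : ℝ) := by
  have hπ : (π : ℂ) ≠ 0 := by exact_mod_cast Real.pi_ne_zero
  set f : ℝ → ℂ := (Ioi (0 : ℝ)).indicator
    (fun t : ℝ => (lapFun t : ℂ) * Complex.exp (-(c * t))) with hf
  have hfi : Integrable f := (integrable_indicator_iff measurableSet_Ioi).mpr (integrableOn_lapFun hc)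
  have hF (ξ : ℝ) : FourierTransform.fourier f ξ = 4 * π * mainTerm (vertLine c ξ) := by
    rw [Real.fourier_real_eq_integral_exp_smul, ← integral_lapFun (by simpa using hc),
      ← integral_indicator measurableSet_Ioi]
    refine integral_congr_ae (Filter.Eventually.of_forall fun v => ?_)
    simp only [hf, indicator]
    split_ifs
    · rw [smul_eq_mul, mul_left_comm, ← Complex.exp_add, vertLine]
      congr 2
      push_cast
      ring
    · simp
  have hF' : FourierTransform.fourier f = fun ξ => 4 * π * mainTerm (vertLine c ξ) := funext hF
  have hcont : ContinuousAt f t := by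
    have h : (fun t : ℝ => (lapFun t : ℂ) * Complex.exp (-(c * t))) =ᶠ[nhds t] f := by
      filter_upwards [lt_mem_nhds ht] with x hx
      simp [hf, hx]
    refine ContinuousAt.congr ?_ h
    exact (Complex.continuous_ofReal.continuousAt.comp (continuousAt_lapFun ht)).mul (by fun_prop)
  have h := hfi.fourierInv_fourier_eq (hF' ▸ (integrable_mainTerm_vertLine hc).const_mul _) hcont
  rw [Real.fourierInv_eq', hF'] at h
  have h2 : ∫ v : ℝ, Complex.exp (((2 * π * inner ℝ v t : ℝ) : ℂ) * Complex.I) •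
      (4 * π * mainTerm (vertLine c v)) = 4 * π * ∫ ξ : ℝ, mainTerm (vertLine c ξ) *
        Complex.exp (2 * π * t * ξ * Complex.I) := by
    rw [← integral_const_mul]
    refine integral_congr_ae (Filter.Eventually.of_forall fun v => ?_)
    simp only [smul_eq_mul]
    rw [mul_comm, mul_assoc]
    congr 3
    simp
    ring
  rw [h2] at h
  have h3 : f t = lapFun t * Complex.exp (-(c * t)) := by simp [hf, ht]
  rw [h3] at h
  push_cast
  rw [div_mul_eq_mul_div, eq_div_iff (mul_ne_zero (by norm_num) hπ)]
  linear_combination h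

lemma integral_cexp_two_pi_int (k : ℤ) :
    ∫ ξ in (-(1 / 2) : ℝ)..(1 / 2), Complex.exp (2 * π * k * Complex.I * ξ) =
      if k = 0 then 1 else 0 := by
  split_ifs with h
  · subst h
    norm_num
  · have hπ : (π : ℂ) ≠ 0 := by exact_mod_cast Real.pi_ne_zero
    have hk : (k : ℂ) ≠ 0 := by exact_mod_cast h
    have h0 : (2 * π * k * Complex.I : ℂ) ≠ 0 :=
      mul_ne_zero (mul_ne_zero (mul_ne_zero two_ne_zero hπ) hk) Complex.I_ne_zero
    rw [integral_exp_mul_complex h0, div_eq_zero_iff]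
    left
    rw [sub_eq_zero, Complex.exp_eq_exp_iff_exists_int]
    exact ⟨k, by push_cast; ring⟩

lemma norm_cexp_neg_vertLine (c ξ : ℝ) : ‖Complex.exp (-vertLine c ξ)‖ = rexp (-c) := by
  rw [Complex.norm_exp, Complex.neg_re, vertLine_re]

lemma continuous_pbarGen_vertLine {c : ℝ} (hc : 0 < c) :
    Continuous fun ξ => pbarGen (Complex.exp (-vertLine c ξ)) := by
  have h1 : ‖(rexp (-c) : ℂ)‖ < 1 := by
    rw [Complex.norm_real, Real.norm_of_nonneg (exp_pos _).le]
    exact Real.exp_lt_one_iff.mpr (by linarith)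
  refine continuous_tsum (fun n => ?_) (summable_norm_pbar_mul_pow h1) fun n ξ => ?_
  · unfold vertLine; fun_prop
  · rw [norm_mul, norm_mul, norm_pow, norm_pow, norm_cexp_neg_vertLine, Complex.norm_real,
      Real.norm_of_nonneg (exp_pos _).le]

open MeasureTheory Set in
/-- Cauchy's formula for the coefficients of the generating function. -/
lemma integral_pbarGen_vertLine {c : ℝ} (hc : 0 < c) (n : ℕ) :
    ∫ ξ in Ioc (-(1 / 2) : ℝ) (1 / 2), pbarGen (Complex.exp (-vertLine c ξ)) *
      Complex.exp (2 * π * n * ξ * Complex.I) = (pbar n * rexp (-(c * n)) : ℝ) := by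
  have hterm (m : ℕ) (ξ : ℝ) : (pbar m : ℂ) * Complex.exp (-vertLine c ξ) ^ m *
      Complex.exp (2 * π * n * ξ * Complex.I) =
      (pbar m * rexp (-(c * m)) : ℝ) *
        Complex.exp (2 * π * ((n - m : ℤ) : ℂ) * Complex.I * ξ) := by
    push_cast
    rw [← Complex.exp_nat_mul, mul_assoc, mul_assoc (pbar m : ℂ), ← Complex.exp_add,
      ← Complex.exp_add, vertLine]
    congr 2
    ring
  have hval (m : ℕ) : ∫ ξ in Ioc (-(1 / 2) : ℝ) (1 / 2),
      (pbar m : ℂ) * Complex.exp (-vertLine c ξ) ^ m * Complex.exp (2 * π * n * ξ * Complex.I) =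
      if m = n then ((pbar n * rexp (-(c * n)) : ℝ) : ℂ) else 0 := by
    simp_rw [hterm]
    rw [integral_const_mul, ← intervalIntegral.integral_of_le (by norm_num),
      integral_cexp_two_pi_int]
    by_cases hm : m = n
    · simp [hm]
    · rw [if_neg (by omega), if_neg hm, mul_zero]
  have h1 : ‖(rexp (-c) : ℂ)‖ < 1 := by
    rw [Complex.norm_real, Real.norm_of_nonneg (exp_pos _).le]
    exact Real.exp_lt_one_iff.mpr (by linarith)
  have hnorm (m : ℕ) (ξ : ℝ) : ‖(pbar m : ℂ) * Complex.exp (-vertLine c ξ) ^ m *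
      Complex.exp (2 * π * n * ξ * Complex.I)‖ = ‖(pbar m : ℂ) * (rexp (-c) : ℂ) ^ m‖ := by
    rw [norm_mul, norm_mul, norm_mul, norm_pow, norm_pow, norm_cexp_neg_vertLine,
      Complex.norm_real, Real.norm_of_nonneg (exp_pos _).le, Complex.norm_exp]
    simp
  have h := hasSum_integral_of_summable_integral_norm
    (μ := volume.restrict (Ioc (-(1 / 2) : ℝ) (1 / 2)))
    (F := fun (m : ℕ) (ξ : ℝ) => (pbar m : ℂ) * Complex.exp (-vertLine c ξ) ^ m *
      Complex.exp (2 * π * n * ξ * Complex.I)) (fun m => ?_) ?_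
  · simp_rw [hval] at h
    refine Eq.trans ?_ (h.unique (hasSum_ite_eq n _))
    refine integral_congr_ae (Filter.Eventually.of_forall fun ξ => ?_)
    simp only
    rw [pbarGen, tsum_mul_right]
  · refine (Continuous.integrableOn_Icc ?_).mono_set Ioc_subset_Icc_self
    unfold vertLine
    fun_prop
  · simp_rw [hnorm]
    refine ((summable_norm_pbar_mul_pow h1).congr fun m => ?_)
    simp
    norm_num

open MeasureTheory Set in
lemma norm_integral_mainTerm_compl_le {c : ℝ} (hc : 0 < c) (n : ℕ) :
    ‖∫ ξ in (Ioc (-(1 / 2) : ℝ) (1 / 2))ᶜ, mainTerm (vertLine c ξ) *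
      Complex.exp (2 * π * n * ξ * Complex.I)‖ ≤ 12 := by
  set g : ℝ → ℝ := (Ioi (1 / 4 : ℝ)).indicator fun x => x ^ (-(3 / 2) : ℝ) with hg
  have hgi : ∫ ξ : ℝ, g |ξ| = 8 := by
    rw [integral_comp_abs, hg, setIntegral_indicator measurableSet_Ioi,
      Ioi_inter_Ioi, max_eq_right (by norm_num),
      integral_Ioi_rpow_of_lt (by norm_num) (by norm_num)]
    have : (1 / 4 : ℝ) ^ (-(3 / 2) + 1 : ℝ) = 2 := by
      rw [show (1 / 4 : ℝ) = 2 ^ (-2 : ℝ) by rw [rpow_neg (by norm_num), rpow_two]; norm_num,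
        ← rpow_mul (by norm_num)]
      norm_num
    rw [this]
    norm_num
  have hgint : Integrable fun ξ : ℝ => g |ξ| := by
    refine Integrable.of_integral_ne_zero ?_
    rw [hgi]
    norm_num
  have hbound (ξ : ℝ) : ‖(Ioc (-(1 / 2) : ℝ) (1 / 2))ᶜ.indicator (fun ξ => mainTerm (vertLine c ξ) *
      Complex.exp (2 * π * n * ξ * Complex.I)) ξ‖ ≤ 3 / 2 * g |ξ| := by
    by_cases hξ : ξ ∈ (Ioc (-(1 / 2) : ℝ) (1 / 2))ᶜ
    · have h1 : 1 / 2 ≤ |ξ| := by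
        rw [le_abs]
        by_contra! h
        exact hξ ⟨by linarith, h.1.le⟩
      have h2 : 4 * |ξ| ≤ ‖vertLine c ξ‖ := by
        refine le_trans ?_ (Complex.abs_im_le_norm _)
        rw [vertLine_im, abs_mul, abs_of_pos two_pi_pos]
        nlinarith [pi_gt_three]
      have h3 : π ≤ ‖vertLine c ξ‖ := by
        refine le_trans ?_ (Complex.abs_im_le_norm _)
        rw [vertLine_im, abs_mul, abs_of_pos two_pi_pos]
        nlinarith [pi_gt_three]
      have h0 : 0 < |ξ| := by linarith
      have h4 : ‖vertLine c ξ‖ ^ (-(3 / 2) : ℝ) ≤ 1 / 8 * |ξ| ^ (-(3 / 2) : ℝ) := by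
        refine (rpow_le_rpow_of_nonpos (by positivity) h2 (by norm_num)).trans_eq ?_
        rw [mul_rpow (by norm_num) h0.le, show (4 : ℝ) = 2 ^ (2 : ℝ) by norm_num,
          ← rpow_mul (by norm_num), show (2 : ℝ) * -(3 / 2) = -(3 : ℕ) by norm_num,
          rpow_neg (by norm_num), rpow_natCast]
        norm_num
      have h5 : rexp (π ^ 2 / (4 * ‖vertLine c ξ‖)) ≤ 3 := by
        refine le_trans ?_ exp_one_lt_three.le
        rw [exp_le_exp, div_le_one (by linarith [pi_pos])]
        nlinarith [pi_lt_four, pi_pos]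
      rw [indicator_of_mem hξ, norm_mul, hg, indicator_of_mem (by
        simp only [mem_Ioi]; linarith)]
      have h6 : ‖Complex.exp (2 * π * n * ξ * Complex.I)‖ = 1 := by
        rw [Complex.norm_exp]; simp
      rw [h6, mul_one]
      refine (norm_mainTerm_le (by simpa using hc)).trans ?_
      calc _ ≤ 4 * (1 / 8 * |ξ| ^ (-(3 / 2) : ℝ)) * 3 := by gcongr
        _ = _ := by ring
    · rw [indicator_of_notMem hξ, norm_zero, hg]
      exact mul_nonneg (by norm_num) (indicator_nonneg (fun x hx => rpow_nonneg
        (le_trans (by norm_num) (le_of_lt hx)) _) _)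
  rw [← integral_indicator measurableSet_Ioc.compl]
  refine (norm_integral_le_of_norm_le (hgint.const_mul (3 / 2))
    (Filter.Eventually.of_forall hbound)).trans ?_
  rw [integral_const_mul, hgi]
  norm_num

lemma norm_sq_eq (s : ℂ) : ‖s‖ ^ 2 = s.re ^ 2 + s.im ^ 2 := by
  rw [Complex.sq_norm, Complex.normSq_apply]; ring

lemma re_pi_sq_div (s : ℂ) : (π ^ 2 / (4 * s) : ℂ).re = π ^ 2 / 4 * (s.re / ‖s‖ ^ 2) := by
  have : (π ^ 2 / (4 * s) : ℂ) = ((π ^ 2 / 4 : ℝ) : ℂ) * s⁻¹ := by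
    push_cast
    rw [div_mul_eq_div_div, div_eq_mul_inv _ s]
  rw [this, Complex.re_ofReal_mul, Complex.inv_re, Complex.normSq_eq_norm_sq]

lemma norm_cpow_half (s : ℂ) : ‖(s / π) ^ (1 / 2 : ℂ)‖ = √(‖s‖ / π) := by
  rw [show (1 / 2 : ℂ) = ((1 / 2 : ℝ) : ℂ) by push_cast; rfl, Complex.norm_cpow_real, sqrt_eq_rpow]
  simp [abs_of_pos pi_pos]

lemma norm_pi_sq_div (s : ℂ) : ‖(π ^ 2 / (4 * s) : ℂ)‖ = π ^ 2 / (4 * ‖s‖) := by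
  simp [abs_of_pos pi_pos]

/-- Upper bound for the generating function on the positive real axis. -/
lemma norm_pbarGen_ofReal_le {c : ℝ} (hc : 0 < c) :
    ‖pbarGen (rexp (-c) : ℝ)‖ ≤ 1 / 2 * √(c / π) * rexp (π ^ 2 / (4 * c)) := by
  obtain ⟨d, hd, hdw⟩ := thetaTail_ofReal (π ^ 2 / (4 * c))
  have h := pbarGen_exp_neg (s := c) (by simpa using hc)
  have h1 : thetaTail (π ^ 2 / (4 * c)) = d := by rw [← hdw]; push_cast; rfl
  rw [h1, show Complex.exp (-(c : ℂ)) = ((rexp (-c) : ℝ) : ℂ) by push_cast; rfl] at h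
  have h2 := congrArg norm h
  have h3 : ‖(2 * (1 + d) : ℂ)‖ = 2 * (1 + d) := by
    rw [show (2 * (1 + d) : ℂ) = ((2 * (1 + d) : ℝ) : ℂ) by push_cast; rfl, Complex.norm_real,
      Real.norm_of_nonneg (by linarith)]
  have h4 : ‖Complex.exp (π ^ 2 / (4 * c))‖ = rexp (π ^ 2 / (4 * c)) := by
    rw [show Complex.exp (π ^ 2 / (4 * c)) = ((rexp (π ^ 2 / (4 * c)) : ℝ) : ℂ) by push_cast; rfl,
      Complex.norm_real, Real.norm_of_nonneg (exp_pos _).le]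
  rw [norm_mul, h3, norm_mul, norm_cpow_half, Complex.norm_real, Real.norm_of_nonneg hc.le,
    h4] at h2
  nlinarith [mul_nonneg (norm_nonneg (pbarGen ((rexp (-c) : ℝ) : ℂ))) hd]

/-- Approximation of the generating function by the main term near `q = 1`. -/
lemma norm_pbarGen_sub_mainTerm_le {s : ℂ} (hs : 0 < s.re) (hs1 : s.re ≤ 1 / 20)
    (him : s.im ^ 2 ≤ s.re) :
    ‖pbarGen (Complex.exp (-s)) - mainTerm s‖ ≤ 2 / s.re := by
  have hπ3 := pi_gt_three
  have hπ4 := pi_lt_d2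
  have hs0 : s ≠ 0 := by rintro rfl; simp at hs
  have hn : 0 < ‖s‖ := norm_pos_iff.mpr hs0
  have hcn : s.re ≤ ‖s‖ := Complex.re_le_norm s
  have hn2 : ‖s‖ ^ 2 ≤ 21 / 20 * s.re := by rw [norm_sq_eq]; nlinarith
  have h := pbarGen_exp_neg hs
  have hwre : 1 ≤ (π ^ 2 / (4 * s) : ℂ).re := by
    rw [re_pi_sq_div]
    have : 20 / 21 ≤ s.re / ‖s‖ ^ 2 := by rw [le_div_iff₀ (by positivity)]; linarith
    nlinarith
  have hwn : ‖(π ^ 2 / (4 * s) : ℂ)‖ ≤ 5 / 2 / s.re := by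
    rw [norm_pi_sq_div, div_le_div_iff₀ (by positivity) hs]
    have : π ^ 2 ≤ 10 := by nlinarith
    nlinarith
  have hz : ‖(s / π) ^ (1 / 2 : ℂ)‖ ≤ 1 := by
    rw [norm_cpow_half, sqrt_le_left (by norm_num), div_le_iff₀ pi_pos]
    nlinarith
  have hδ := norm_thetaTail_le hwre
  have he : ‖Complex.exp (π ^ 2 / (4 * s))‖ = rexp (π ^ 2 / (4 * s) : ℂ).re := Complex.norm_exp _
  set w : ℂ := π ^ 2 / (4 * s) with hw
  set δ := thetaTail w with hδdef
  set z : ℂ := (s / π) ^ (1 / 2 : ℂ) with hzdef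
  have h8 : rexp (-(8 * w.re)) ≤ 1 / 8 := by
    rw [exp_neg, inv_eq_one_div]
    refine one_div_le_one_div_of_le (by norm_num) ?_
    linarith [add_one_le_exp (8 * w.re)]
  have hδ1 : ‖δ‖ ≤ 1 / 2 := by linarith
  have hδ2 : 1 / 2 ≤ ‖1 + δ‖ := by
    have := norm_sub_norm_le (1 : ℂ) (-δ)
    rw [sub_neg_eq_add, norm_neg, norm_one] at this
    linarith
  have hδ0 : 1 + δ ≠ 0 := norm_pos_iff.mp (by linarith)
  have heδ : ‖Complex.exp w * δ‖ ≤ 1 / 4 := by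
    rw [norm_mul, he]
    calc rexp w.re * ‖δ‖ ≤ rexp w.re * (2 * rexp (-(8 * w.re))) := by gcongr
      _ = 2 * rexp (-(7 * w.re)) := by rw [mul_left_comm, ← exp_add]; ring_nf
      _ ≤ 2 * (1 / 8) := by
        gcongr
        rw [exp_neg, inv_eq_one_div]
        refine one_div_le_one_div_of_le (by norm_num) ?_
        linarith [add_one_le_exp (7 * w.re)]
      _ = 1 / 4 := by norm_num
  have hP : pbarGen (Complex.exp (-s)) = z * Complex.exp w / (2 * (1 + δ)) := by
    rw [eq_div_iff (mul_ne_zero two_ne_zero hδ0), h]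
  have hdiff : pbarGen (Complex.exp (-s)) - mainTerm s =
      1 / 2 * z * (1 + w - Complex.exp w * δ / (1 + δ)) := by
    rw [hP, mainTerm, ← hw, ← hzdef]
    field_simp
    ring
  have hq : ‖Complex.exp w * δ / (1 + δ)‖ ≤ 1 / 2 := by
    rw [norm_div, div_le_iff₀ (by linarith)]
    linarith
  have hsum : ‖1 + w - Complex.exp w * δ / (1 + δ)‖ ≤ 1 + 5 / 2 / s.re + 1 / 2 := by
    refine (norm_sub_le _ _).trans (add_le_add ((norm_add_le _ _).trans ?_) hq)
    rw [norm_one]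
    linarith
  have h20 : 20 ≤ 1 / s.re := by rw [le_div_iff₀ hs]; linarith
  rw [hdiff, norm_mul, norm_mul]
  calc _ ≤ ‖(1 / 2 : ℂ)‖ * 1 * (1 + 5 / 2 / s.re + 1 / 2) := by gcongr
    _ = 3 / 4 + 5 / 4 * (1 / s.re) := by norm_num; ring
    _ ≤ 2 * (1 / s.re) := by linarith
    _ = 2 / s.re := by ring

lemma norm_mainTerm_le_of_far {s : ℂ} (hs : 0 < s.re) (hs1 : s.re ≤ 1 / 20)
    (him : s.re ≤ s.im ^ 2) (him' : |s.im| ≤ π) : ‖mainTerm s‖ ≤ 4 / s.re := by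
  have hπ3 := pi_gt_three
  have hπ4 := pi_lt_d2
  have hs0 : s ≠ 0 := by rintro rfl; simp at hs
  have hn : 0 < ‖s‖ := norm_pos_iff.mpr hs0
  have hcn : s.re ≤ ‖s‖ := Complex.re_le_norm s
  have hn2 : s.re ≤ ‖s‖ ^ 2 := by rw [norm_sq_eq]; nlinarith
  have hn3 : ‖s‖ ≤ 4 * π := by
    refine (Complex.norm_le_abs_re_add_abs_im s).trans ?_
    rw [abs_of_pos hs]
    linarith
  have hwn : ‖(π ^ 2 / (4 * s) : ℂ)‖ ≤ 5 / 2 / s.re := by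
    rw [norm_pi_sq_div, div_le_div_iff₀ (by positivity) hs]
    have : π ^ 2 ≤ 10 := by nlinarith
    nlinarith
  have hz : ‖(s / π) ^ (1 / 2 : ℂ)‖ ≤ 2 := by
    rw [norm_cpow_half, sqrt_le_left (by norm_num), div_le_iff₀ pi_pos]
    linarith
  have he : ‖Complex.exp (π ^ 2 / (4 * s))‖ ≤ 12.5 := by
    rw [Complex.norm_exp, re_pi_sq_div]
    have h1 : s.re / ‖s‖ ^ 2 ≤ 1 := by rw [div_le_one (by positivity)]; exact hn2
    have h2 : π ^ 2 / 4 * (s.re / ‖s‖ ^ 2) ≤ 5 / 2 := by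
      have : 0 ≤ s.re / ‖s‖ ^ 2 := by positivity
      nlinarith
    refine (exp_le_exp.mpr h2).trans ?_
    have h3 : rexp (5 / 2) ^ 2 = rexp 1 ^ 5 := by
      rw [← exp_nat_mul, ← exp_nat_mul]; norm_num
    have h4 : rexp 1 ^ 5 ≤ 2.719 ^ 5 := by
      gcongr; linarith [exp_one_lt_d9]
    refine le_of_sq_le_sq ?_ (by norm_num)
    rw [h3]
    refine h4.trans (by norm_num)
  have hsum : ‖Complex.exp (π ^ 2 / (4 * s)) - 1 - π ^ 2 / (4 * s)‖ ≤ 12.5 + 1 + 5 / 2 / s.re := by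
    refine (norm_sub_le _ _).trans (add_le_add ((norm_sub_le _ _).trans ?_) hwn)
    rw [norm_one]
    linarith
  have h20 : 20 ≤ 1 / s.re := by rw [le_div_iff₀ hs]; linarith
  rw [mainTerm, norm_mul, norm_mul]
  calc _ ≤ ‖(1 / 2 : ℂ)‖ * 2 * (12.5 + 1 + 5 / 2 / s.re) := by gcongr
    _ = 13.5 + 5 / 2 * (1 / s.re) := by norm_num; ring
    _ ≤ 4 * (1 / s.re) := by linarith
    _ = 4 / s.re := by ring

lemma two_mul_div_one_sub_sub_re {q : ℂ} (hq : ‖q‖ < 1) :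
    2 * (‖q‖ / (1 - ‖q‖) - (q / (1 - q)).re) =
      2 / (1 - ‖q‖) - 1 - (1 - ‖q‖ ^ 2) / ‖1 - q‖ ^ 2 := by
  have h1 : 1 - ‖q‖ ≠ 0 := by linarith
  have h2 : 1 - q ≠ 0 := by
    intro h
    rw [← sub_eq_zero.mp h, norm_one] at hq
    exact lt_irrefl _ hq
  have h3 : ‖1 - q‖ ^ 2 ≠ 0 := by positivity
  have h4 : (q / (1 - q)).re = (q.re - ‖q‖ ^ 2) / ‖1 - q‖ ^ 2 := by
    rw [Complex.div_re, Complex.normSq_eq_norm_sq, norm_sq_eq q]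
    simp
    ring
  rw [h4]
  have h5 : ‖1 - q‖ ^ 2 = 1 - 2 * q.re + ‖q‖ ^ 2 := by
    rw [norm_sq_eq, norm_sq_eq]; simp; ring
  rw [h5] at h3 ⊢
  field_simp
  ring

/-- Bound for the generating function away from `q = 1`. -/
lemma norm_pbarGen_le_of_far {s : ℂ} (hs : 0 < s.re) (hs1 : s.re ≤ 1 / 20)
    (him : s.re ≤ s.im ^ 2) (him' : |s.im| ≤ π) :
    ‖pbarGen (Complex.exp (-s))‖ ≤ 50 * rexp ((π ^ 2 / 4 - 2) / s.re) := by
  have hπ3 := pi_gt_three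
  have hπ4 := pi_lt_d2
  set c := s.re with hc
  have hqn : ‖Complex.exp (-s)‖ = rexp (-c) := by rw [Complex.norm_exp, Complex.neg_re]
  have hq1 := norm_cexp_neg_lt_one hs
  have h := norm_pbarGen_le hq1
  rw [two_mul_div_one_sub_sub_re hq1, hqn] at h
  set r := rexp (-c) with hr
  have hr0 : 0 < r := exp_pos _
  have hrc : 1 - c ≤ r := by linarith [add_one_le_exp (-c)]
  have hr1 : r < 1 := hqn ▸ hq1
  have h1 : 2 / c ≤ 2 / (1 - r) := div_le_div_of_nonneg_left (by norm_num) (by linarith) (by linarith)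
  have h2 : 4 * r * c / π ^ 2 ≤ ‖1 - Complex.exp (-s)‖ ^ 2 := by
    have hre : (Complex.exp (-s)).re = r * cos s.im := by
      rw [Complex.exp_re]; simp [hr, hc]
    have h5 : ‖1 - Complex.exp (-s)‖ ^ 2 = 1 - 2 * (Complex.exp (-s)).re +
        ‖Complex.exp (-s)‖ ^ 2 := by
      rw [norm_sq_eq, norm_sq_eq]; simp; ring
    rw [h5, hqn, hre]
    have hcos := cos_le_one_sub_mul_cos_sq him'
    have h6 : 2 / π ^ 2 * c ≤ 1 - cos s.im := by
      have : 2 / π ^ 2 * c ≤ 2 / π ^ 2 * s.im ^ 2 := by gcongr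
      linarith
    have h7 : 4 * r * c / π ^ 2 = 2 * r * (2 / π ^ 2 * c) := by ring
    rw [h7]
    nlinarith [sq_nonneg (1 - r), mul_le_mul_of_nonneg_left h6 (by linarith : 0 ≤ 2 * r)]
  have h3 : (1 - r ^ 2) / ‖1 - Complex.exp (-s)‖ ^ 2 ≤ 5.3 := by
    rw [div_le_iff₀ (lt_of_lt_of_le (by positivity) h2)]
    have h4 : 1 - r ^ 2 ≤ 2 * c := by nlinarith
    have h5 : 4 * r * c / π ^ 2 * 5.3 ≥ 2 * c := by
      rw [ge_iff_le, div_mul_eq_mul_div, le_div_iff₀ (by positivity)]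
      have : π ^ 2 ≤ 3.15 ^ 2 := by gcongr
      nlinarith
    nlinarith
  have hsq : √(c / π) ≤ 1 / 6 := by
    rw [sqrt_le_left (by norm_num), div_le_iff₀ pi_pos]
    nlinarith
  have he : rexp 6.3 ≤ 600 := by
    have h3 : rexp 6.3 ^ 10 = rexp 1 ^ 63 := by
      rw [← exp_nat_mul, ← exp_nat_mul]; norm_num
    have h4 : rexp 1 ^ 63 ≤ 2.719 ^ 63 := by
      gcongr; linarith [exp_one_lt_d9]
    refine le_of_pow_le_pow_left₀ (n := 10) (by norm_num) (by norm_num) ?_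
    rw [h3]
    exact h4.trans (by norm_num)
  calc _ ≤ ‖pbarGen (r : ℂ)‖ *
        rexp (-(2 / (1 - r) - 1 - (1 - r ^ 2) / ‖1 - Complex.exp (-s)‖ ^ 2)) := h
    _ ≤ (1 / 2 * (1 / 6) * rexp (π ^ 2 / (4 * c))) * rexp (6.3 - 2 / c) := by
        gcongr
        · refine (norm_pbarGen_ofReal_le hs).trans ?_
          gcongr
        · linarith
    _ = 1 / 12 * rexp 6.3 * rexp ((π ^ 2 / 4 - 2) / c) := by
        have : rexp (π ^ 2 / (4 * c)) * rexp (6.3 - 2 / c) =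
            rexp 6.3 * rexp ((π ^ 2 / 4 - 2) / c) := by
          rw [← exp_add, ← exp_add]
          congr 1
          field_simp
          ring
        linear_combination 1 / 12 * this
    _ ≤ 1 / 12 * 600 * rexp ((π ^ 2 / 4 - 2) / c) := by gcongr
    _ = _ := by norm_num

open MeasureTheory Set in
/-- The circle-method estimate for overpartitions. -/
lemma abs_pbar_sub_lapFun_le {c : ℝ} (hc : 0 < c) (hc1 : c ≤ 1 / 20) {n : ℕ} (hn : n ≠ 0) :
    |(pbar n : ℝ) - lapFun n / (4 * π)| ≤ 75 * rexp (c * n + (π ^ 2 / 4 - 2) / c) := by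
  have hπ3 := pi_gt_d2
  have hn0 : (0 : ℝ) < n := by exact_mod_cast Nat.pos_of_ne_zero hn
  set E := rexp ((π ^ 2 / 4 - 2) / c) with hE
  have hE1 : 0.4 * (1 / c) + 1 ≤ E := by
    refine le_trans ?_ (add_one_le_exp _)
    rw [div_eq_mul_one_div (π ^ 2 / 4 - 2)]
    have : 0 < 1 / c := by positivity
    have : 0.4 ≤ π ^ 2 / 4 - 2 := by nlinarith
    gcongr
  have h1 := integral_pbarGen_vertLine hc n
  have h2 := lapFun_inversion hc hn0
  have hen (ξ : ℝ) : ‖Complex.exp (2 * π * n * ξ * Complex.I)‖ = 1 := by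
    rw [Complex.norm_exp]; simp
  have hint : Integrable fun ξ : ℝ => mainTerm (vertLine c ξ) *
      Complex.exp (2 * π * n * ξ * Complex.I) := by
    refine (integrable_mainTerm_vertLine hc).mono ?_ (Filter.Eventually.of_forall fun ξ => ?_)
    · exact ((continuous_mainTerm_vertLine hc).mul (by fun_prop)).aestronglyMeasurable
    · rw [norm_mul, hen, mul_one]
  have hint2 : IntegrableOn (fun ξ : ℝ => pbarGen (Complex.exp (-vertLine c ξ)) *
      Complex.exp (2 * π * n * ξ * Complex.I)) (Ioc (-(1 / 2)) (1 / 2)) :=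
    (((continuous_pbarGen_vertLine hc).mul (by fun_prop)).integrableOn_Icc).mono_set
      Ioc_subset_Icc_self
  have h3 := integral_add_compl (measurableSet_Ioc (a := (-(1 / 2) : ℝ)) (b := 1 / 2)) hint
  have h2' : ∫ ξ : ℝ, mainTerm (vertLine c ξ) * Complex.exp (2 * π * n * ξ * Complex.I) =
      (lapFun n / (4 * π) * rexp (-(c * n)) : ℝ) := by
    rw [← h2]; push_cast; rfl
  have h4 : ((((pbar n : ℝ) - lapFun n / (4 * π)) * rexp (-(c * n)) : ℝ) : ℂ) =
      (∫ ξ in Ioc (-(1 / 2) : ℝ) (1 / 2), (pbarGen (Complex.exp (-vertLine c ξ)) -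
        mainTerm (vertLine c ξ)) * Complex.exp (2 * π * n * ξ * Complex.I)) -
      ∫ ξ in (Ioc (-(1 / 2) : ℝ) (1 / 2))ᶜ, mainTerm (vertLine c ξ) *
        Complex.exp (2 * π * n * ξ * Complex.I) := by
    simp_rw [sub_mul]
    rw [integral_sub hint2 hint.integrableOn, h1, sub_sub, h3, h2', ← Complex.ofReal_sub]
  have h5 : ‖∫ ξ in Ioc (-(1 / 2) : ℝ) (1 / 2), (pbarGen (Complex.exp (-vertLine c ξ)) -
      mainTerm (vertLine c ξ)) * Complex.exp (2 * π * n * ξ * Complex.I)‖ ≤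
      (50 * E + 4 * (1 / c)) * volume.real (Ioc (-(1 / 2) : ℝ) (1 / 2)) := by
    refine norm_setIntegral_le_of_norm_le_const measure_Ioc_lt_top fun ξ hξ => ?_
    rw [norm_mul, hen, mul_one]
    have hre : 0 < (vertLine c ξ).re := by simpa using hc
    have hre1 : (vertLine c ξ).re ≤ 1 / 20 := by simpa using hc1
    have hc2 : 0 < 1 / c := by positivity
    have hE0 : 0 < E := exp_pos _
    rcases le_total ((vertLine c ξ).im ^ 2) (vertLine c ξ).re with him | him
    · refine (norm_pbarGen_sub_mainTerm_le hre hre1 him).trans ?_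
      rw [vertLine_re, div_eq_mul_one_div]
      linarith
    · have him' : |(vertLine c ξ).im| ≤ π := by
        rw [vertLine_im, abs_mul, abs_of_pos two_pi_pos]
        have : |ξ| ≤ 1 / 2 := abs_le.mpr ⟨hξ.1.le, hξ.2⟩
        nlinarith [pi_pos]
      refine (norm_sub_le _ _).trans (add_le_add
        ((norm_pbarGen_le_of_far hre hre1 him him').trans_eq ?_)
        ((norm_mainTerm_le_of_far hre hre1 him him').trans_eq ?_))
      · rw [vertLine_re]
      · rw [vertLine_re]; ring
  have hvol : volume.real (Ioc (-(1 / 2) : ℝ) (1 / 2)) = 1 := by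
    simp [Measure.real]; norm_num
  rw [hvol, mul_one] at h5
  have h6 := congrArg norm h4
  rw [Complex.norm_real, norm_mul, Real.norm_eq_abs, Real.norm_of_nonneg (exp_pos _).le] at h6
  have h7 : |(pbar n : ℝ) - lapFun n / (4 * π)| * rexp (-(c * n)) ≤ 75 * E := by
    rw [h6]
    refine (norm_sub_le _ _).trans ?_
    have h8 := norm_integral_mainTerm_compl_le hc n
    have : 0 < 1 / c := by positivity
    linarith
  rw [exp_neg, ← div_eq_mul_inv, div_le_iff₀ (exp_pos _)] at h7
  rw [exp_add]
  linarith

lemma pow_mul_exp_neg_le {y : ℝ} (hy : 158 / 5 ≤ y) : 608 * y ^ 10 * rexp (-(4 / π * y)) ≤ 4 := by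
  have hπ : 1.273 ≤ 4 / π := by
    rw [le_div_iff₀ pi_pos]; linarith [pi_lt_d4]
  have h1 : y ≤ (158 / 5) * rexp (5 / 158 * y - 1) := by
    linarith [add_one_le_exp (5 / 158 * y - 1)]
  have h2 : y ^ 10 ≤ (158 / 5) ^ 10 * rexp (10 * (5 / 158 * y - 1)) := by
    calc y ^ 10 ≤ ((158 / 5) * rexp (5 / 158 * y - 1)) ^ 10 := by gcongr
      _ = _ := by rw [mul_pow, ← exp_nat_mul]; norm_num
  have h3 : rexp (10 * (5 / 158 * y - 1)) * rexp (-(4 / π * y)) ≤ rexp (-40) := by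
    rw [← exp_add, exp_le_exp]
    have : 1.273 * y ≤ 4 / π * y := by gcongr
    linarith
  have h4 : rexp (-40) ≤ (2.718 ^ 40)⁻¹ := by
    rw [exp_neg, show (40 : ℝ) = (40 : ℕ) * 1 by norm_num, exp_nat_mul]
    gcongr
    linarith [exp_one_gt_d9]
  calc 608 * y ^ 10 * rexp (-(4 / π * y))
      ≤ 608 * ((158 / 5) ^ 10 * rexp (10 * (5 / 158 * y - 1))) * rexp (-(4 / π * y)) := by gcongr
    _ = 608 * (158 / 5) ^ 10 * (rexp (10 * (5 / 158 * y - 1)) * rexp (-(4 / π * y))) := by ring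
    _ ≤ 608 * (158 / 5) ^ 10 * (2.718 ^ 40)⁻¹ := by gcongr; exact h3.trans h4
    _ ≤ 4 := by norm_num

lemma lapFun_div_four_pi {y : ℝ} (hy : 0 < y) :
    lapFun (y ^ 2) / (4 * π) = rexp (π * y) / (8 * y ^ 2) * (1 - 1 / (π * y)) +
      (1 - (π * y) ^ 2 / 2 - (π * y + 1) * rexp (-(π * y)) / 2) / (4 * π * y ^ 3) := by
  have hπ := pi_pos
  rw [lapFun_eq (by positivity), sqrt_sq hy.le, sinh_eq, cosh_eq]
  field_simp
  ring

/-- Asymptotic expansion of the overpartition function with an explicit error term. -/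
lemma pbar_asymptotic {n : ℕ} (hn : 1000 ≤ n) : ∃ δ : ℝ, |δ| ≤ 4 / (n : ℝ) ^ 4 ∧
    (pbar n : ℝ) = rexp (π * √n) / (8 * n) * (1 - 1 / (π * √n) + δ) := by
  have hn' : (1000 : ℝ) ≤ n := by exact_mod_cast hn
  obtain ⟨y, hy⟩ : ∃ y, y = √(n : ℝ) := ⟨_, rfl⟩
  have hy2 : (n : ℝ) = y ^ 2 := by rw [hy, sq_sqrt (by linarith)]
  have hy1 : 158 / 5 ≤ y := by
    rw [hy]; exact le_sqrt_of_sq_le (by norm_num; linarith)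
  have hy0 : 0 < y := by linarith
  have hπ3 := pi_gt_three
  have hπ4 := pi_lt_four
  have hb := abs_pbar_sub_lapFun_le (c := π / (2 * y)) (by positivity)
    (by rw [div_le_iff₀ (by positivity)]; linarith [pi_lt_d2]) (n := n) (by omega)
  rw [hy2, lapFun_div_four_pi hy0] at hb
  rw [← hy, hy2]
  set E := rexp (π * y) with hE
  have hE0 : 0 < E := exp_pos _
  have he : rexp (π / (2 * y) * y ^ 2 + (π ^ 2 / 4 - 2) / (π / (2 * y))) =
      E * rexp (-(4 / π * y)) := by
    rw [hE, ← exp_add]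
    congr 1
    field_simp
    ring
  rw [he] at hb
  set t := (1 - (π * y) ^ 2 / 2 - (π * y + 1) * rexp (-(π * y)) / 2) / (4 * π * y ^ 3) with ht
  have hEt : E * rexp (-(4 / π * y)) ≥ 1 := by
    rw [hE, ← exp_add]
    refine one_le_exp ?_
    have : 4 / π ≤ π := by rw [div_le_iff₀ pi_pos]; nlinarith
    nlinarith
  have htb : |t| ≤ 1 := by
    have h1 : (π * y + 1) * rexp (-(π * y)) ≤ 1 := by
      rw [exp_neg, ← div_eq_mul_inv, div_le_one (exp_pos _)]
      exact add_one_le_exp _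
    have h0 : 0 ≤ (π * y + 1) * rexp (-(π * y)) := by positivity
    have h2 : 9 ≤ π * y := by nlinarith
    have h3 : (π * y) ^ 2 ≤ 4 * π * y ^ 3 := by
      have : π * y ^ 2 * π ≤ π * y ^ 2 * (4 * y) := by gcongr; linarith
      nlinarith
    rw [ht, abs_div, abs_of_pos (by positivity : 0 < 4 * π * y ^ 3), div_le_one (by positivity)]
    rw [abs_le]
    constructor <;> nlinarith
  refine ⟨8 * y ^ 2 / E * (pbar n - E / (8 * y ^ 2) * (1 - 1 / (π * y))), ?_, ?_⟩
  · have h5 : |(pbar n : ℝ) - E / (8 * y ^ 2) * (1 - 1 / (π * y))| ≤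
        76 * (E * rexp (-(4 / π * y))) := by
      rw [abs_le] at *
      constructor <;> linarith [hb.1, hb.2, htb.1, htb.2]
    rw [abs_mul, abs_of_pos (by positivity : 0 < 8 * y ^ 2 / E), le_div_iff₀ (by positivity)]
    calc _ ≤ 8 * y ^ 2 / E * (76 * (E * rexp (-(4 / π * y)))) * (y ^ 2) ^ 4 := by gcongr
      _ = 608 * y ^ 10 * rexp (-(4 / π * y)) := by field_simp; norm_num
      _ ≤ 4 := pow_mul_exp_neg_le hy1
  · field_simp
    ring

lemma abs_mul_le_mul {a b A B : ℝ} (ha : |a| ≤ A) (hb : |b| ≤ B) : |a * b| ≤ A * B := by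
  rw [abs_mul]
  exact mul_le_mul ha hb (abs_nonneg _) ((abs_nonneg _).trans ha)

lemma exists_eq_add_mul {f p K z : ℝ} (hz : 0 < z) (h : |f - p| ≤ K * z) :
    ∃ e, |e| ≤ K ∧ f = p + e * z := by
  refine ⟨(f - p) / z, ?_, by field_simp; ring⟩
  rwa [abs_div, abs_of_pos hz, div_le_iff₀ hz]

lemma sqrt_one_add_expansion {t : ℝ} (ht : 0 < t) (ht1 : t ≤ 1 / 900) :
    ∃ e, |e| ≤ 1 / 30 ∧
      √(1 + t) = 1 + t / 2 - t ^ 2 / 8 + t ^ 3 / 16 - 5 * t ^ 4 / 128 + e * t ^ 5 := by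
  refine exists_eq_add_mul (by positivity) ?_
  set p := 1 + t / 2 - t ^ 2 / 8 + t ^ 3 / 16 - 5 * t ^ 4 / 128 with hp
  have h5 : 0 < t ^ 5 := by positivity
  have h2 : t ^ 2 ≤ 1 := pow_le_one₀ ht.le (by linarith)
  have h3 : t ^ 3 ≤ 1 := pow_le_one₀ ht.le (by linarith)
  have h3' : 0 < t ^ 3 := by positivity
  have h4 : t ^ 4 ≤ t := by
    calc t ^ 4 = t ^ 3 * t := by ring
      _ ≤ 1 * t := by gcongr
      _ = t := one_mul t
  have h2' : t ^ 2 ≤ t := by nlinarith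
  have hp1 : 1 ≤ p := by rw [hp]; linarith
  have hp2 : p ^ 2 = 1 + t - t ^ 5 * (7 / 128 - 7 * t / 512 + 5 * t ^ 2 / 1024 -
      25 * t ^ 3 / 16384) := by rw [hp]; ring
  have hlow : p ≤ √(1 + t) := by
    refine le_sqrt_of_sq_le ?_
    rw [hp2]
    have : 0 ≤ t ^ 5 * (7 / 128 - 7 * t / 512 + 5 * t ^ 2 / 1024 - 25 * t ^ 3 / 16384) :=
      mul_nonneg h5.le (by nlinarith)
    linarith
  have hup : √(1 + t) ≤ p + 1 / 30 * t ^ 5 := by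
    rw [sqrt_le_left (by positivity)]
    have h6 : t ^ 5 * (7 / 128 - 7 * t / 512 + 5 * t ^ 2 / 1024 - 25 * t ^ 3 / 16384) ≤
        t ^ 5 * (1 / 15) := by
      gcongr
      nlinarith
    nlinarith
  rw [abs_le]
  constructor <;> linarith

lemma inv_sqrt_one_add_expansion {t : ℝ} (ht : 0 < t) (ht1 : t ≤ 1 / 900) :
    ∃ e, |e| ≤ 1 / 3 ∧
      (√(1 + t))⁻¹ = 1 - t / 2 + 3 * t ^ 2 / 8 - 5 * t ^ 3 / 16 + e * t ^ 4 := by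
  refine exists_eq_add_mul (by positivity) ?_
  set v := 1 - t / 2 + 3 * t ^ 2 / 8 - 5 * t ^ 3 / 16 with hv
  have h4 : 0 < t ^ 4 := by positivity
  have h2 : t ^ 2 ≤ t := by nlinarith
  have h2' : 0 < t ^ 2 := by positivity
  have h3 : t ^ 3 ≤ t := by
    calc t ^ 3 = t ^ 2 * t := by ring
      _ ≤ 1 * t := by gcongr; linarith
      _ = t := one_mul t
  have h3' : 0 < t ^ 3 := by positivity
  have hv1 : 0.9 ≤ v := by rw [hv]; linarith
  have hv2 : v ^ 2 * (1 + t) = 1 - t ^ 4 * (35 / 64 - 14 * t / 64 + 35 * t ^ 2 / 256 -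
      25 * t ^ 3 / 256) := by rw [hv]; ring
  have hlow : v ≤ (√(1 + t))⁻¹ := by
    rw [← sqrt_inv]
    refine le_sqrt_of_sq_le ?_
    rw [inv_eq_one_div, le_div_iff₀ (by linarith), hv2]
    have : 0 ≤ t ^ 4 * (35 / 64 - 14 * t / 64 + 35 * t ^ 2 / 256 - 25 * t ^ 3 / 256) :=
      mul_nonneg h4.le (by linarith)
    linarith
  have hup : (√(1 + t))⁻¹ ≤ v + 1 / 3 * t ^ 4 := by
    rw [← sqrt_inv, sqrt_le_left (by positivity), inv_eq_one_div, div_le_iff₀ (by linarith)]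
    have h6 : t ^ 4 * (35 / 64 - 14 * t / 64 + 35 * t ^ 2 / 256 - 25 * t ^ 3 / 256) ≤
        t ^ 4 * (35 / 64) := by
      gcongr
      linarith
    have h7 : (v + 1 / 3 * t ^ 4) ^ 2 * (1 + t) ≥ v ^ 2 * (1 + t) + 2 / 3 * v * t ^ 4 := by
      have : (v + 1 / 3 * t ^ 4) ^ 2 * (1 + t) = v ^ 2 * (1 + t) + 2 / 3 * v * t ^ 4 +
        (2 / 3 * v * t ^ 4 * t + 1 / 9 * (t ^ 4) ^ 2 * (1 + t)) := by ring
      rw [this]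
      have : 0 ≤ 2 / 3 * v * t ^ 4 * t + 1 / 9 * (t ^ 4) ^ 2 * (1 + t) := by positivity
      linarith
    nlinarith
  rw [abs_le]
  constructor <;> linarith

lemma log_one_add_sq_expansion {x : ℝ} (hx : 0 < x) (hx1 : x ≤ 1 / 31) :
    ∃ e, |e| ≤ 1.1 ∧ log (1 + x ^ 2) = x ^ 2 - x ^ 4 / 2 + x ^ 6 / 3 + e * x ^ 8 := by
  refine exists_eq_add_mul (by positivity) ?_
  have h2 : x ^ 2 ≤ 1 / 31 := by nlinarith
  have h0 : 0 < x ^ 2 := by positivity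
  have hab : |-(x ^ 2)| = x ^ 2 := by rw [abs_neg, abs_of_pos h0]
  have h := abs_log_sub_add_sum_range_le (x := -(x ^ 2)) (by rw [hab]; linarith) 3
  rw [hab, sub_neg_eq_add] at h
  simp only [Finset.sum_range_succ, Finset.sum_range_zero] at h
  calc _ = _ := by congr 1; push_cast; ring
    _ ≤ _ := h
    _ ≤ 1.1 * x ^ 8 := by
      rw [div_le_iff₀ (by linarith)]
      have : (0 : ℝ) < x ^ 8 := by positivity
      nlinarith

lemma log_one_add_expansion {h : ℝ} (h0 : 0 < h) (h1 : h ≤ 1 / 31) :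
    ∃ e, |e| ≤ 1.1 ∧ log (1 + h) = h - h ^ 2 / 2 + e * h ^ 3 := by
  refine exists_eq_add_mul (by positivity) ?_
  have hab : |-h| = h := by rw [abs_neg, abs_of_pos h0]
  have h2 := abs_log_sub_add_sum_range_le (x := -h) (by rw [hab]; linarith) 2
  rw [hab, sub_neg_eq_add] at h2
  simp only [Finset.sum_range_succ, Finset.sum_range_zero] at h2
  calc _ = _ := by congr 1; push_cast; ring
    _ ≤ _ := h2
    _ ≤ 1.1 * h ^ 3 := by
      rw [div_le_iff₀ (by linarith)]
      have : (0 : ℝ) < h ^ 3 := by positivity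
      nlinarith

lemma log_one_add_ratio_expansion {x β w : ℝ} (hx : 0 < x) (hx1 : x ≤ 1 / 31) (hβ : 0 < β)
    (hβ1 : β ≤ 1 / 3) {e : ℝ} (he : |e| ≤ 1 / 3)
    (hw : w = 1 - x ^ 2 / 2 + 3 * x ^ 4 / 8 - 5 * x ^ 6 / 16 + e * x ^ 8) :
    ∃ e', |e'| ≤ 0.5 ∧ log ((1 - β * x * w) / (1 - β * x)) =
      β / 2 * x ^ 3 + β ^ 2 / 2 * x ^ 4 + (β ^ 3 / 2 - 3 * β / 8) * x ^ 5 +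
      (β ^ 4 / 2 - β ^ 2 / 2) * x ^ 6 + (β ^ 5 / 2 - 5 * β ^ 3 / 8 + 5 * β / 16) * x ^ 7 +
      e' * x ^ 8 := by
  have hb : β * x ≤ 1 / 93 := by nlinarith
  have hb0 : 0 < β * x := by positivity
  obtain ⟨g, hg⟩ : ∃ g, g = (1 - β * x)⁻¹ := ⟨_, rfl⟩
  have hg1 : g * (1 - β * x) = 1 := by rw [hg]; exact inv_mul_cancel₀ (by linarith)
  have hg0 : 0 < g := by rw [hg]; exact inv_pos.mpr (by linarith)
  have hgu : g ≤ 1.1 := by nlinarith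
  have hga : |g| ≤ 1.1 := by rw [abs_of_pos hg0]; exact hgu
  have hxa : |x| ≤ 1 / 31 := by rw [abs_of_pos hx]; exact hx1
  have hβa : |β| ≤ 1 / 3 := by rw [abs_of_pos hβ]; exact hβ1
  have hex := abs_mul_le_mul he hxa
  have hx2 : x ^ 2 ≤ 1 / 900 := by nlinarith
  have hx20 : 0 < x ^ 2 := by positivity
  have hβ2 : β ^ 2 ≤ 1 / 9 := by nlinarith
  have hβ20 : 0 < β ^ 2 := by positivity
  have hx4 : |x ^ 4| ≤ 1 / 900 := by
    rw [abs_of_pos (by positivity)]; nlinarith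
  have hex4 := abs_mul_le_mul he hx4
  obtain ⟨k, hk⟩ : ∃ k, k = (1 / 2 - 3 * x ^ 2 / 8 + 5 * x ^ 4 / 16 - e * x ^ 4 * x ^ 2) * g :=
    ⟨_, rfl⟩
  obtain ⟨m, hm⟩ : ∃ m, m = (β ^ 2 / 2 - 3 / 8 + 5 * x ^ 2 / 16 - e * x ^ 4) * g := ⟨_, rfl⟩
  have hkm : k = 1 / 2 + β * x / 2 + x ^ 2 * m := by
    rw [hk, hm]; linear_combination (1 / 2 + β * x / 2) * hg1
  have hmb : |m| ≤ 0.5 := by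
    rw [hm]
    refine (abs_mul_le_mul (A := 0.42) ?_ hga).trans (by norm_num)
    obtain ⟨h1, h2⟩ := abs_le.mp hex4
    rw [abs_le]
    constructor <;> linarith only [h1, h2, hβ2, hβ20, hx2, hx20]
  have hxm : |x ^ 2 * m| ≤ 1 / 900 * 0.5 :=
    abs_mul_le_mul (by rw [abs_of_pos hx20]; exact hx2) hmb
  have hk0 : 0.49 ≤ k := by rw [hkm]; linarith [(abs_le.mp hxm).1]
  have hk1 : k ≤ 0.51 := by rw [hkm]; linarith [(abs_le.mp hxm).2]
  have hratio : (1 - β * x * w) / (1 - β * x) = 1 + β * x ^ 3 * k := by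
    rw [div_eq_mul_inv, ← hg, hk, hw]
    linear_combination hg1
  have hbx3 : β * x ^ 3 ≤ 1 / 31 := by
    have : β * x ^ 3 = (β * x) * x ^ 2 := by ring
    rw [this]; nlinarith
  have hh0 : 0 < β * x ^ 3 * k := by positivity
  obtain ⟨e5, he5, hlog⟩ := log_one_add_expansion hh0 (by nlinarith [pow_pos hx 3])
  refine ⟨β * (β ^ 5 / 2 - 3 * β ^ 3 / 8 + 5 * β / 16 - e * x) * g -
    β ^ 2 / 2 * (β ^ 2 / 4 + m * (1 + β * x) + (x ^ 2 * m) * m) + e5 * (β ^ 3 * k ^ 3) * x,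
    ?_, ?_⟩
  · have hβ3 : β ^ 3 ≤ 1 / 27 := by
      calc β ^ 3 ≤ (1 / 3) ^ 3 := by gcongr
        _ = _ := by norm_num
    have hβ30 : 0 < β ^ 3 := by positivity
    have hβ5 : β ^ 5 ≤ 1 / 243 := by
      calc β ^ 5 ≤ (1 / 3) ^ 5 := by gcongr
        _ = _ := by norm_num
    have hβ50 : 0 < β ^ 5 := by positivity
    have hk3 : k ^ 3 ≤ 1 := pow_le_one₀ (by linarith) (by linarith)
    have hk30 : 0 < k ^ 3 := pow_pos (by linarith) 3
    have q1 : |β * (β ^ 5 / 2 - 3 * β ^ 3 / 8 + 5 * β / 16 - e * x) * g| ≤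
        1 / 3 * 0.2 * 1.1 := by
      refine abs_mul_le_mul (abs_mul_le_mul hβa ?_) hga
      obtain ⟨h1, h2⟩ := abs_le.mp hex
      rw [abs_le]
      constructor <;> linarith only [h1, h2, hβ5, hβ50, hβ3, hβ30, hβ, hβ1]
    have q2 : |β ^ 2 / 2 * (β ^ 2 / 4 + m * (1 + β * x) + (x ^ 2 * m) * m)| ≤ 1 / 18 * 1 := by
      refine abs_mul_le_mul (by rw [abs_of_pos (by positivity)]; linarith) ?_
      have r1 : |m * (1 + β * x)| ≤ 0.5 * 1.1 :=
        abs_mul_le_mul hmb (by rw [abs_of_pos (by linarith)]; linarith)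
      have r2 := abs_mul_le_mul hxm hmb
      rw [abs_le] at r1 r2 ⊢
      constructor <;> linarith only [r1.1, r1.2, r2.1, r2.2, hβ2, hβ20]
    have q3 : |e5 * (β ^ 3 * k ^ 3) * x| ≤ 1.1 * (1 / 27 * 1) * (1 / 31) :=
      abs_mul_le_mul (abs_mul_le_mul he5 (abs_mul_le_mul (by rw [abs_of_pos hβ30]; exact hβ3)
        (by rw [abs_of_pos hk30]; exact hk3))) hxa
    rw [abs_le] at q1 q2 q3 ⊢
    constructor <;> linarith only [q1.1, q1.2, q2.1, q2.2, q3.1, q3.2]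
  · rw [hratio, hlog]
    have hlin : β * x ^ 3 * k = β * x ^ 3 * ((1 + β * x + (β * x) ^ 2 + (β * x) ^ 3 +
        (β * x) ^ 4) / 2 - 3 / 8 * x ^ 2 * (1 + β * x + (β * x) ^ 2) + 5 / 16 * x ^ 4) +
        x ^ 8 * (β * (β ^ 5 / 2 - 3 * β ^ 3 / 8 + 5 * β / 16 - e * x) * g) := by
      rw [hk]
      linear_combination β * x ^ 3 * (1 / 2 * (1 + β * x + (β * x) ^ 2 + (β * x) ^ 3 +
        (β * x) ^ 4) - 3 / 8 * x ^ 2 * (1 + β * x + (β * x) ^ 2) + 5 / 16 * x ^ 4) * hg1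
    have hsq : (β * x ^ 3 * k) ^ 2 = β ^ 2 * x ^ 6 * (1 / 4 + β * x / 2) +
        x ^ 8 * (β ^ 2 * (β ^ 2 / 4 + m * (1 + β * x) + (x ^ 2 * m) * m)) := by
      rw [hkm]; ring
    rw [hsq]
    linear_combination hlin

lemma log_add_expansion {A δ z : ℝ} (hz : 0 < z) (hA : 0.98 ≤ A) (hδ : |δ| ≤ 4 * z)
    (hz1 : z ≤ 1 / 1000) : ∃ e, |e| ≤ 5 ∧ log (A + δ) = log A + e * z := by
  refine exists_eq_add_mul hz ?_
  obtain ⟨h1, h2⟩ := abs_le.mp hδ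
  have hAδ : 0.9 ≤ A + δ := by linarith
  rw [abs_le]
  constructor
  · have h := log_le_sub_one_of_pos (x := A / (A + δ)) (by positivity)
    rw [log_div (by positivity) (by positivity)] at h
    have : A / (A + δ) - 1 ≤ 5 * z := by
      rw [sub_le_iff_le_add, div_le_iff₀ (by linarith)]
      nlinarith
    linarith
  · have h := log_le_sub_one_of_pos (x := (A + δ) / A) (by positivity)
    rw [log_div (by positivity) (by positivity)] at h
    have : (A + δ) / A - 1 ≤ 5 * z := by
      rw [sub_le_iff_le_add, div_le_iff₀ (by linarith)]
      nlinarith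
    linarith

set_option maxHeartbeats 1000000 in
/-- Expansion of `log (pbar (n + 1) / pbar n)` in powers of `x = 1 / √n`. -/
lemma log_pbar_ratio_expansion {n : ℕ} (hn : 1000 ≤ n) {x β : ℝ} (hx : x = (√(n : ℝ))⁻¹)
    (hβ : β = π⁻¹) : ∃ e, |e| ≤ 14 ∧ log ((pbar (n + 1) : ℝ) / pbar n) =
      π / 2 * x - x ^ 2 + (β / 2 - π / 8) * x ^ 3 + (1 / 2 + β ^ 2 / 2) * x ^ 4 +
      (π / 16 + β ^ 3 / 2 - 3 * β / 8) * x ^ 5 + (β ^ 4 / 2 - β ^ 2 / 2 - 1 / 3) * x ^ 6 +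
      (β ^ 5 / 2 - 5 * β ^ 3 / 8 + 5 * β / 16 - 5 * π / 128) * x ^ 7 + e * x ^ 8 := by
  have hπ3 := pi_gt_three
  have hπ4 := pi_lt_four
  have hn' : (1000 : ℝ) ≤ n := by exact_mod_cast hn
  have hs : 31 ≤ √(n : ℝ) := le_sqrt_of_sq_le (by linarith)
  have hx0 : 0 < x := by rw [hx]; positivity
  have hx1 : x ≤ 1 / 31 := by
    rw [hx, inv_eq_one_div]; exact one_div_le_one_div_of_le (by norm_num) hs
  have hβ0 : 0 < β := by rw [hβ]; positivity
  have hβ1 : β ≤ 1 / 3 := by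
    rw [hβ, inv_eq_one_div]; exact one_div_le_one_div_of_le (by norm_num) hπ3.le
  have hxn : x ^ 2 * n = 1 := by
    rw [hx, inv_pow, sq_sqrt (by linarith)]; exact inv_mul_cancel₀ (by linarith)
  have hn2 : (n : ℝ) = (x ^ 2)⁻¹ := eq_inv_of_mul_eq_one_right hxn
  have hx2 : x ^ 2 ≤ 1 / 900 := by nlinarith
  have hx20 : 0 < x ^ 2 := by positivity
  have hx8 : 0 < x ^ 8 := by positivity
  have hx81 : x ^ 8 ≤ 1 / 1000 := by
    calc x ^ 8 ≤ (1 / 31) ^ 8 := by gcongr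
      _ ≤ _ := by norm_num
  obtain ⟨δ, hδ, hp⟩ := pbar_asymptotic hn
  obtain ⟨δ', hδ', hp'⟩ := pbar_asymptotic (n := n + 1) (by omega)
  obtain ⟨e₁, he₁, hr⟩ := sqrt_one_add_expansion hx20 hx2
  obtain ⟨e₂, he₂, hw⟩ := inv_sqrt_one_add_expansion hx20 hx2
  obtain ⟨e₃, he₃, hl⟩ := log_one_add_sq_expansion hx0 hx1
  set r := √(1 + x ^ 2) with hrdef
  have hr0 : 0 < r := sqrt_pos.mpr (by linarith)
  have hw1 : r⁻¹ ≤ 1 := by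
    apply inv_le_one_of_one_le₀
    exact le_sqrt_of_sq_le (by linarith)
  have hw0 : 0 < r⁻¹ := inv_pos.mpr hr0
  obtain ⟨e₄, he₄, hh⟩ := log_one_add_ratio_expansion hx0 hx1 hβ0 hβ1 he₂ (w := r⁻¹)
    (by rw [hw]; ring)
  have hbx : β * x ≤ 1 / 93 := by nlinarith
  have hbx0 : 0 < β * x := by positivity
  have hbxw : β * x * r⁻¹ ≤ 1 / 93 := by nlinarith
  have h4n : 4 / (n : ℝ) ^ 4 = 4 * x ^ 8 := by
    rw [hn2]; field_simp
  have hδ1 : |δ| ≤ 4 * x ^ 8 := hδ.trans_eq h4n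
  have hδ'1 : |δ'| ≤ 4 * x ^ 8 := by
    refine hδ'.trans (le_trans ?_ h4n.le)
    push_cast
    gcongr
    linarith
  obtain ⟨e₅, he₅, h5⟩ := log_add_expansion hx8 (A := 1 - β * x) (by linarith) hδ1 hx81
  obtain ⟨e₆, he₆, h6⟩ := log_add_expansion hx8 (A := 1 - β * x * r⁻¹) (by linarith) hδ'1 hx81
  have hsn : √(n : ℝ) = x⁻¹ := by rw [hx, inv_inv]
  have hsn' : √((n : ℝ) + 1) = r * x⁻¹ := by
    rw [hrdef, ← sqrt_sq (inv_pos.mpr hx0).le, ← sqrt_mul (by positivity)]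
    congr 1
    rw [hn2]; field_simp
  have hu : 1 / (π * √(n : ℝ)) = β * x := by rw [hsn, hβ]; field_simp
  have hu' : 1 / (π * √((n : ℝ) + 1)) = β * x * r⁻¹ := by rw [hsn', hβ]; field_simp
  push_cast at hp'
  rw [hu] at hp
  rw [hu'] at hp'
  have hA : 0 < 1 - β * x + δ := by
    have := (abs_le.mp hδ1).1; linarith
  have hA' : 0 < 1 - β * x * r⁻¹ + δ' := by
    have := (abs_le.mp hδ'1).1; linarith
  have hP : log (pbar n) = π * x⁻¹ - log (8 * n) + log (1 - β * x + δ) := by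
    rw [hp, log_mul (by positivity) hA.ne', log_div (by positivity) (by positivity), log_exp, hsn]
  have hP' : log (pbar (n + 1)) = π * (r * x⁻¹) - log (8 * (n + 1)) +
      log (1 - β * x * r⁻¹ + δ') := by
    rw [hp', log_mul (by positivity) hA'.ne', log_div (by positivity) (by positivity), log_exp,
      hsn']
  have hpos : (pbar n : ℝ) ≠ 0 := by rw [hp]; positivity
  have hpos' : (pbar (n + 1) : ℝ) ≠ 0 := by rw [hp']; positivity
  have h8 : log (8 * (n + 1)) = log (8 * n) + log (1 + x ^ 2) := by
    rw [← log_mul (by positivity) (by positivity)]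
    congr 1
    linear_combination -8 * hxn
  rw [log_div (by linarith) (by linarith)] at hh
  have hrx : π * (r * x⁻¹) - π * x⁻¹ = π * (x / 2 - x ^ 3 / 8 + x ^ 5 / 16 - 5 * x ^ 7 / 128) +
      (π * e₁ * x) * x ^ 8 := by
    rw [hr]; field_simp; ring
  refine ⟨π * e₁ * x - e₃ + e₄ + e₆ - e₅, ?_, ?_⟩
  · have h1 : |π * e₁ * x| ≤ 4 * (1 / 30) * (1 / 31) :=
      abs_mul_le_mul (abs_mul_le_mul (by rw [abs_of_pos pi_pos]; linarith) he₁)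
        (by rw [abs_of_pos hx0]; exact hx1)
    rw [abs_le] at h1 he₃ he₄ he₅ he₆ ⊢
    constructor <;> linarith only [h1.1, h1.2, he₃.1, he₃.2, he₄.1, he₄.2, he₅.1, he₅.2, he₆.1,
      he₆.2]
  · rw [log_div hpos' hpos, hP, hP', h8, h5, h6, hl]
    linear_combination hrx + hh

/-- Division of a power series by `1 + x ^ 2`. -/
lemma div_one_add_sq_expansion {x l₁ l₂ l₃ l₄ l₅ l₆ l₇ e : ℝ} (hx : 0 < x) (hx1 : x ≤ 1 / 31)
    (he : |e| ≤ 14) (h8 : |l₆ - l₄ + l₂| ≤ 2) (h9 : |l₇ - l₅ + l₃ - l₁| ≤ 2) :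
    ∃ e', |e'| ≤ 17 ∧
      (l₁ * x + l₂ * x ^ 2 + l₃ * x ^ 3 + l₄ * x ^ 4 + l₅ * x ^ 5 + l₆ * x ^ 6 + l₇ * x ^ 7 +
        e * x ^ 8) * (x ^ 2 / (1 + x ^ 2)) =
      x ^ 3 * (l₁ + l₂ * x + (l₃ - l₁) * x ^ 2 + (l₄ - l₂) * x ^ 3 + (l₅ - l₃ + l₁) * x ^ 4 +
        (l₆ - l₄ + l₂) * x ^ 5 + (l₇ - l₅ + l₃ - l₁) * x ^ 6 + e' * x ^ 7) := by
  refine ⟨(e - (l₆ - l₄ + l₂) - (l₇ - l₅ + l₃ - l₁) * x) / (1 + x ^ 2), ?_, ?_⟩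
  · have h := abs_mul_le_mul (B := 1 / 31) h9 (by rw [abs_of_pos hx]; exact hx1)
    have hx2 : 0 < x ^ 2 := by positivity
    rw [abs_div, abs_of_pos (by positivity : 0 < 1 + x ^ 2), div_le_iff₀ (by positivity)]
    refine le_trans ?_ (by linarith : (17 : ℝ) ≤ 17 * (1 + x ^ 2))
    rw [abs_le] at *
    constructor <;> linarith [h.1, h.2, he.1, he.2, h8.1, h8.2]
  · field_simp
    ring

lemma exp_expansion {x a b c d f g h e : ℝ} (hx : 0 < x) (hx1 : x ≤ 1 / 31)
    (ha : |a| ≤ 2) (hb : |b| ≤ 2) (hc : |c| ≤ 2) (hd : |d| ≤ 2) (hf : |f| ≤ 2) (hg : |g| ≤ 2)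
    (hh : |h| ≤ 2) (he : |e| ≤ 17) :
    ∃ e', |e'| ≤ 50 ∧
      rexp (x ^ 3 * (a + b * x + c * x ^ 2 + d * x ^ 3 + f * x ^ 4 + g * x ^ 5 + h * x ^ 6 +
        e * x ^ 7)) =
      1 + a * x ^ 3 + b * x ^ 4 + c * x ^ 5 + (d + a ^ 2 / 2) * x ^ 6 + (f + a * b) * x ^ 7 +
        (g + (2 * a * c + b ^ 2) / 2) * x ^ 8 + (h + a * d + b * c + a ^ 3 / 6) * x ^ 9 +
        e' * x ^ 10 := by
  have hxa : |x| ≤ 1 / 31 := by rw [abs_of_pos hx]; exact hx1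
  have step {u v : ℝ} {V : ℝ} (hu : |u| ≤ 2) (hv : |v| ≤ V) : |u + x * v| ≤ 2 + 1 / 31 * V :=
    (abs_add_le _ _).trans (add_le_add hu (abs_mul_le_mul hxa hv))
  obtain ⟨z9, h9⟩ : ∃ z, z = h + x * e := ⟨_, rfl⟩
  obtain ⟨z8, h8⟩ : ∃ z, z = g + x * z9 := ⟨_, rfl⟩
  obtain ⟨z7, h7⟩ : ∃ z, z = f + x * z8 := ⟨_, rfl⟩
  obtain ⟨z6, h6⟩ : ∃ z, z = d + x * z7 := ⟨_, rfl⟩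
  obtain ⟨z5, h5⟩ : ∃ z, z = c + x * z6 := ⟨_, rfl⟩
  obtain ⟨z4, h4⟩ : ∃ z, z = b + x * z5 := ⟨_, rfl⟩
  obtain ⟨z, hz⟩ : ∃ z, z = a + x * z4 := ⟨_, rfl⟩
  have b9 : |z9| ≤ 3 := by rw [h9]; exact (step hh he).trans (by norm_num)
  have b8 : |z8| ≤ 2.1 := by rw [h8]; exact (step hg b9).trans (by norm_num)
  have b7 : |z7| ≤ 2.1 := by rw [h7]; exact (step hf b8).trans (by norm_num)
  have b6 : |z6| ≤ 2.1 := by rw [h6]; exact (step hd b7).trans (by norm_num)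
  have b5 : |z5| ≤ 2.1 := by rw [h5]; exact (step hc b6).trans (by norm_num)
  have b4 : |z4| ≤ 2.1 := by rw [h4]; exact (step hb b5).trans (by norm_num)
  have bz : |z| ≤ 2.1 := by rw [hz]; exact (step ha b4).trans (by norm_num)
  have hzz : a + b * x + c * x ^ 2 + d * x ^ 3 + f * x ^ 4 + g * x ^ 5 + h * x ^ 6 +
      e * x ^ 7 = z := by rw [hz, h4, h5, h6, h7, h8, h9]; ring
  rw [hzz]
  obtain ⟨y, hy⟩ : ∃ y, y = x ^ 3 * z := ⟨_, rfl⟩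
  have hx30 : 0 < x ^ 3 := by positivity
  have hx3 : x ^ 3 ≤ 1 / 1000 := by
    calc x ^ 3 ≤ (1 / 31) ^ 3 := by gcongr
      _ ≤ _ := by norm_num
  have hyb : |y| ≤ 1 / 1000 * 2.1 := by
    rw [hy]; exact abs_mul_le_mul (by rw [abs_of_pos hx30]; exact hx3) bz
  have hexp := exp_bound (x := y) (by linarith) (n := 4) (by norm_num)
  have hfact : ((4 : ℕ).succ : ℝ) / ((4 : ℕ).factorial * (4 : ℕ)) = 5 / 96 := by
    norm_num [Nat.factorial]
  rw [hfact] at hexp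
  simp only [Finset.sum_range_succ, Finset.sum_range_zero] at hexp
  have hy4 : |y| ^ 4 * (5 / 96) ≤ 2 * x ^ 10 := by
    have : |y| ≤ x ^ 3 * 2.1 := by
      rw [hy]; exact abs_mul_le_mul (by rw [abs_of_pos hx30]) bz
    have hx2 : x ^ 2 ≤ 1 := pow_le_one₀ hx.le (by linarith)
    calc |y| ^ 4 * (5 / 96) ≤ (x ^ 3 * 2.1) ^ 4 * (5 / 96) := by gcongr
      _ = 2.1 ^ 4 * (5 / 96) * x ^ 10 * x ^ 2 := by ring
      _ ≤ 2.1 ^ 4 * (5 / 96) * x ^ 10 * 1 := by gcongr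
      _ ≤ 2 * x ^ 10 := by
        have : 0 < x ^ 10 := by positivity
        linarith
  obtain ⟨e₁, he₁, hE⟩ := exists_eq_add_mul (by positivity : 0 < x ^ 10) (hexp.trans hy4)
  rw [← hy, hE]
  norm_num [Nat.factorial]
  refine ⟨e₁ + e + (2 * (a * z7) + 2 * (b * z6) + z5 * z5) / 2 +
    z4 * (z * z + z * a + a * a) / 6, ?_, ?_⟩
  · have q1 := abs_mul_le_mul ha b7
    have q2 := abs_mul_le_mul hb b6
    have q3 := abs_mul_le_mul b5 b5
    have q4 : |z4 * (z * z + z * a + a * a)| ≤ 2.1 * (2.1 * 2.1 + 2.1 * 2 + 2 * 2) :=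
      abs_mul_le_mul b4 ((abs_add_le _ _).trans (add_le_add ((abs_add_le _ _).trans (add_le_add
        (abs_mul_le_mul bz bz) (abs_mul_le_mul bz ha))) (abs_mul_le_mul ha ha)))
    rw [abs_le] at q1 q2 q3 q4 he he₁ ⊢
    constructor <;> linarith only [q1.1, q1.2, q2.1, q2.2, q3.1, q3.2, q4.1, q4.2, he.1, he.2,
      he₁.1, he₁.2]
  · have hz2 : z ^ 2 = a ^ 2 + 2 * a * b * x + (2 * a * c + b ^ 2) * x ^ 2 +
        (2 * a * d + 2 * b * c) * x ^ 3 +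
        (2 * (a * z7) + 2 * (b * z6) + z5 * z5) * x ^ 4 := by
      have e4 : z4 = b + c * x + x ^ 2 * z6 := by rw [h4, h5]; ring
      have e3 : z = a + b * x + x ^ 2 * c + x ^ 3 * d + x ^ 4 * z7 := by
        rw [hz, h4, h5, h6]; ring
      rw [h5, h6, e3]
      ring
    have hz3 : z ^ 3 = a ^ 3 + x * (z4 * (z * z + z * a + a * a)) := by
      have : x * z4 = z - a := by rw [hz]; ring
      rw [← mul_assoc, this]; ring
    have hz1 : z = a + b * x + c * x ^ 2 + d * x ^ 3 + f * x ^ 4 + g * x ^ 5 + h * x ^ 6 +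
      e * x ^ 7 := hzz.symm
    rw [hy]
    linear_combination x ^ 3 * hz1 + x ^ 6 / 2 * hz2 + x ^ 9 / 6 * hz3

lemma sPlus_eq {n : ℕ} (hn : n ≠ 0) {x β : ℝ} (hx : x = (√(n : ℝ))⁻¹) (hβ : β = π⁻¹) :
    sPlus n = 1 + π / 2 * x ^ 3 - x ^ 4 + (β / 2 - π * 5 / 8) * x ^ 5 +
      (β ^ 2 / 2 + 3 / 2 + π ^ 2 / 8) * x ^ 6 + (β ^ 3 / 2 - 7 * β / 8 + 3 * π / 16) * x ^ 7 +
      (β ^ 4 / 2 - β ^ 2 - 13 / 12 - 5 * π ^ 2 / 16) * x ^ 8 +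
      (β ^ 5 / 2 - 9 * β ^ 3 / 8 + 15 * β / 16 + 83 * π / 128 + π ^ 3 / 48) * x ^ 9 := by
  have hn0 : (0 : ℝ) < n := by exact_mod_cast Nat.pos_of_ne_zero hn
  have key (k : ℕ) : (n : ℝ) ^ ((k : ℝ) / 2) = (x ^ k)⁻¹ := by
    rw [hx, inv_pow, inv_inv, sqrt_eq_rpow, ← rpow_natCast, ← rpow_mul hn0.le]
    congr 1
    ring
  have h3 := key 3
  have h4 := key 4
  have h5 := key 5
  have h6 := key 6
  have h7 := key 7
  have h8 := key 8
  have h9 := key 9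
  norm_num at h3 h4 h5 h6 h7 h8 h9
  have hn4 : (n : ℝ) ^ (2 : ℝ) = (x ^ 4)⁻¹ := by rw [← h4]; norm_num
  have hn6 : (n : ℝ) ^ (3 : ℝ) = (x ^ 6)⁻¹ := by rw [← h6]; norm_num
  have hn8 : (n : ℝ) ^ (4 : ℝ) = (x ^ 8)⁻¹ := by rw [← h8]; norm_num
  rw [sPlus, h3, hn4, h5, hn6, h7, hn8, h9, hβ]
  simp only [div_inv_eq_mul]
  field_simp
  ring

lemma abs_le_two_of_mem {a : ℝ} (h1 : -2 ≤ a) (h2 : a ≤ 2) : |a| ≤ 2 := abs_le.mpr ⟨h1, h2⟩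

lemma abs_rpow_sub_sPlus_le {n : ℕ} (hn : 1000 ≤ n) :
    |((pbar (n + 1) : ℝ) / (pbar n : ℝ)) ^ (((n : ℝ) + 1)⁻¹) - sPlus n| ≤ 50 / (n : ℝ) ^ 5 := by
  have hn' : (1000 : ℝ) ≤ n := by exact_mod_cast hn
  obtain ⟨x, hx⟩ : ∃ x, x = (√(n : ℝ))⁻¹ := ⟨_, rfl⟩
  obtain ⟨β, hβ⟩ : ∃ β, β = π⁻¹ := ⟨_, rfl⟩
  have hs : 31 ≤ √(n : ℝ) := le_sqrt_of_sq_le (by linarith)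
  have hx0 : 0 < x := by rw [hx]; positivity
  have hx1 : x ≤ 1 / 31 := by
    rw [hx, inv_eq_one_div]; exact one_div_le_one_div_of_le (by norm_num) hs
  have hxn : x ^ 2 * n = 1 := by
    rw [hx, inv_pow, sq_sqrt (by linarith)]; exact inv_mul_cancel₀ (by linarith)
  have hn2 : (n : ℝ) = (x ^ 2)⁻¹ := eq_inv_of_mul_eq_one_right hxn
  have hπ3 := pi_gt_d2
  have hπ4 := pi_lt_d2
  have hβ0 : 0.3 ≤ β := by
    rw [hβ, inv_eq_one_div, le_div_iff₀ pi_pos]; linarith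
  have hβ1 : β ≤ 0.32 := by
    rw [hβ, inv_eq_one_div, div_le_iff₀ pi_pos]; linarith
  have hβ2 : β ^ 2 ≤ 0.103 := by nlinarith
  have hβ20 : 0.09 ≤ β ^ 2 := by nlinarith
  have hβ3 : β ^ 3 ≤ 0.034 := by nlinarith
  have hβ30 : 0 ≤ β ^ 3 := by positivity
  have hβ4 : β ^ 4 ≤ 0.011 := by nlinarith
  have hβ40 : 0 ≤ β ^ 4 := by positivity
  have hβ5 : β ^ 5 ≤ 0.004 := by nlinarith
  have hβ50 : 0 ≤ β ^ 5 := by positivity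
  have hpos (m : ℕ) (hm : 1000 ≤ m) : (0 : ℝ) < pbar m := by
    obtain ⟨δ, hδ, hp⟩ := pbar_asymptotic hm
    have hm' : (1000 : ℝ) ≤ m := by exact_mod_cast hm
    have h4 : 4 / (m : ℝ) ^ 4 ≤ 1 / 4 := by
      rw [div_le_div_iff₀ (by positivity) (by norm_num)]
      nlinarith [pow_le_pow_left₀ (by norm_num) hm' 4]
    have h5 : 1 / (π * √m) ≤ 1 / 4 := by
      apply one_div_le_one_div_of_le (by norm_num)
      nlinarith [show 31 ≤ √(m : ℝ) from le_sqrt_of_sq_le (by linarith)]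
    rw [hp]
    have := (abs_le.mp hδ).1
    have : 0 < 1 - 1 / (π * √m) + δ := by linarith
    positivity
  have hrpos : (0 : ℝ) < (pbar (n + 1) : ℝ) / pbar n :=
    div_pos (hpos _ (by omega)) (hpos _ hn)
  obtain ⟨e, he, hL⟩ := log_pbar_ratio_expansion hn hx hβ
  have hinv : ((n : ℝ) + 1)⁻¹ = x ^ 2 / (1 + x ^ 2) := by
    rw [hn2]; field_simp
  obtain ⟨e', he', hY⟩ := div_one_add_sq_expansion (l₁ := π / 2) (l₂ := -1)
    (l₃ := β / 2 - π / 8) (l₄ := 1 / 2 + β ^ 2 / 2) (l₅ := π / 16 + β ^ 3 / 2 - 3 * β / 8)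
    (l₆ := β ^ 4 / 2 - β ^ 2 / 2 - 1 / 3)
    (l₇ := β ^ 5 / 2 - 5 * β ^ 3 / 8 + 5 * β / 16 - 5 * π / 128) hx0 hx1 he
    (abs_le_two_of_mem (by linarith) (by linarith))
    (abs_le_two_of_mem (by linarith) (by linarith))
  obtain ⟨e'', he'', hE⟩ := exp_expansion (a := π / 2) (b := -1) (c := β / 2 - π / 8 - π / 2)
    (d := 1 / 2 + β ^ 2 / 2 - -1) (f := π / 16 + β ^ 3 / 2 - 3 * β / 8 - (β / 2 - π / 8) + π / 2)
    (g := β ^ 4 / 2 - β ^ 2 / 2 - 1 / 3 - (1 / 2 + β ^ 2 / 2) + -1)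
    (h := β ^ 5 / 2 - 5 * β ^ 3 / 8 + 5 * β / 16 - 5 * π / 128 -
      (π / 16 + β ^ 3 / 2 - 3 * β / 8) + (β / 2 - π / 8) - π / 2) hx0 hx1
    (abs_le_two_of_mem (by linarith) (by linarith))
    (abs_le_two_of_mem (by linarith) (by linarith))
    (abs_le_two_of_mem (by linarith) (by linarith))
    (abs_le_two_of_mem (by linarith) (by linarith))
    (abs_le_two_of_mem (by linarith) (by linarith))
    (abs_le_two_of_mem (by linarith) (by linarith))
    (abs_le_two_of_mem (by linarith) (by linarith)) he'
  have hR : ((pbar (n + 1) : ℝ) / (pbar n : ℝ)) ^ (((n : ℝ) + 1)⁻¹) - sPlus n = e'' * x ^ 10 := by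
    rw [rpow_def_of_pos hrpos, hL, hinv, sPlus_eq (by omega) hx hβ]
    rw [show π / 2 * x - x ^ 2 = π / 2 * x + -1 * x ^ 2 by ring, hY, hE]
    have hπβ : π * β = 1 := by rw [hβ]; exact mul_inv_cancel₀ pi_pos.ne'
    linear_combination (x ^ 8 / 4 + x ^ 9 * β / 4) * hπβ
  rw [hR, abs_mul, abs_of_pos (by positivity : 0 < x ^ 10), hn2]
  calc |e''| * x ^ 10 ≤ 50 * x ^ 10 := by gcongr
    _ = _ := by field_simp

/-- Number base in which lists of overpartition numbers are packed. -/
def packBase : ℕ := 2 ^ 160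

/-- The `i`-th digit of a packed list. -/
def packDigit (S i : ℕ) : ℕ := S / packBase ^ i % packBase

/-- `packSum S c m = ∑ j < m, packDigit S ((2 * j + c) ^ 2 - 1)`. -/
def packSum (S c : ℕ) : ℕ → ℕ
  | 0 => 0
  | j + 1 => packSum S c j + packDigit S ((2 * j + c) ^ 2 - 1)

/-- The next overpartition number, computed from the packed list of the previous ones. -/
def packNext (S : ℕ) : ℕ := 2 * packSum S 1 16 - 2 * packSum S 2 16

/-- Call-by-value application, for kernel evaluation. -/
def forceNat {α : Type} (n : ℕ) (f : ℕ → α) : α :=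
  match n with
  | 0 => f 0
  | m + 1 => f (m + 1)

lemma forceNat_eq {α : Type} (n : ℕ) (f : ℕ → α) : forceNat n f = f n := by
  cases n <;> rfl

/-- Newton iteration for the integer square root. -/
def newtonSqrt (N : ℕ) : ℕ → ℕ → ℕ
  | 0, r => r
  | k + 1, r => forceNat ((r + N / r) / 2) (newtonSqrt N k)

/-- Positive part of `10 ^ 24 * n ^ 5 * sPlus n`, with coefficients and `√n` approximated. -/
def sPlusPos (n r : ℕ) : ℕ :=
  10 ^ 24 * n ^ 5 + 10 ^ 12 * (2784361141957 * n ^ 2) +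
    r * (1570796326795 * n ^ 3 + 326653239354 * n + 2946857007700)

/-- Negative part of `10 ^ 24 * n ^ 5 * sPlus n`, with coefficients and `√n` approximated. -/
def sPlusNeg (n r : ℕ) : ℕ :=
  10 ^ 24 * n ^ 3 + 10 ^ 12 * (4263772901189 * n) + r * (1804340465402 * n ^ 2)

/-- Certified comparison of `(q / p) ^ (1 / (n + 1))` with `sPlus n`. -/
def sPlusCheck (n p q : ℕ) : Bool :=
  forceNat (newtonSqrt (n * 10 ^ 24) 12 (4 * 10 ^ 13)) fun r =>
  forceNat ((10 ^ 24 * n ^ 5) ^ (n + 1) * q) fun t =>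
  (Nat.ble (r * r) (n * 10 ^ 24) && Nat.ble (n * 10 ^ 24) ((r + 1) * (r + 1))) &&
  (Nat.ble (sPlusNeg n r) (sPlusPos n r) &&
  (Nat.blt t ((sPlusPos n r + 849 * 10 ^ 24 - sPlusNeg n r) ^ (n + 1) * p) &&
  Nat.blt ((sPlusPos n r - (sPlusNeg n r + 119 * 10 ^ 24)) ^ (n + 1) * p) t))

/-- One step of the verification. The state is a packed list of overpartition numbers followed by
the index of its head. -/
def checkStep (T : ℕ) : ℕ :=
  forceNat (T / packBase) fun S => forceNat (T % packBase) fun n =>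
  forceNat (packNext S) fun q =>
  bif Nat.blt q packBase && sPlusCheck n (packDigit S 0) q then
    (S * packBase + q) * packBase + (n + 1) else 0

/-- The `2 ^ k`-fold iterate of `checkStep`, organised to keep evaluation shallow. -/
def checkIter : ℕ → ℕ → ℕ
  | 0, T => checkStep T
  | k + 1, T => forceNat (checkIter k T) (checkIter k)

lemma checkIter_pos : 0 < checkIter 10 ((packBase + 2) * packBase + 1) := by decide +kernel

lemma checkStep_zero : checkStep 0 = 0 := by decide +kernel

lemma checkIter_eq (k T : ℕ) : checkIter k T = checkStep^[2 ^ k] T := by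
  induction k generalizing T with
  | zero => rfl
  | succ k ih =>
    rw [checkIter, forceNat_eq, ih, ih, ← Function.iterate_add_apply, pow_succ, mul_two]

lemma packSum_eq (S c m : ℕ) :
    packSum S c m = ∑ j ∈ Finset.range m, packDigit S ((2 * j + c) ^ 2 - 1) := by
  induction m with
  | zero => rfl
  | succ m ih => rw [packSum, ih, Finset.sum_range_succ]

lemma sum_range_sq_of_support {f : ℕ → ℝ} (hf : ∀ k, ¬IsSquare k → f k = 0) (m : ℕ) :
    ∑ k ∈ Finset.range (m ^ 2), f k = ∑ j ∈ Finset.range m, f (j ^ 2) := by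
  have hinj : Set.InjOn (fun j : ℕ => j ^ 2) (Finset.range m : Set ℕ) :=
    fun a _ b _ h => Nat.pow_left_injective two_ne_zero h
  rw [← Finset.sum_image (f := f) hinj]
  symm
  refine Finset.sum_subset ?_ fun k hk hk' => hf k ?_
  · intro k hk
    obtain ⟨j, hj, rfl⟩ := Finset.mem_image.mp hk
    exact Finset.mem_range.mpr (Nat.pow_lt_pow_left (Finset.mem_range.mp hj) two_ne_zero)
  · rintro ⟨j, rfl⟩
    refine hk' (Finset.mem_image.mpr ⟨j, Finset.mem_range.mpr ?_, sq j⟩)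
    rw [Finset.mem_range, ← sq] at hk
    exact lt_of_pow_lt_pow_left₀ 2 (Nat.zero_le m) hk

lemma thetaCoeff_sq (j : ℕ) : thetaCoeff ((j + 1) ^ 2) = 2 * (-1) ^ (j + 1) := by
  rw [thetaCoeff, if_neg (by positivity), if_pos ⟨j + 1, sq _⟩, sq, pow_mul]
  rcases Nat.even_or_odd (j + 1) with h | h
  · rw [h.neg_one_pow, one_pow]
  · rw [h.neg_one_pow, h.neg_one_pow]

lemma pbar_succ_eq {n : ℕ} (hn : n + 1 < 33 ^ 2) {G : ℕ → ℕ}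
    (hG : ∀ k, G k = if k ≤ n + 1 then pbar (n + 1 - k) else 0) :
    pbar (n + 1) + 2 * ∑ j ∈ Finset.range 16, G ((2 * j + 2) ^ 2) =
      2 * ∑ j ∈ Finset.range 16, G ((2 * j + 1) ^ 2) := by
  have h := sum_pbar_mul_thetaCoeff (n + 1)
  rw [if_neg (by omega), ← Finset.Nat.sum_antidiagonal_swap,
    Finset.Nat.sum_antidiagonal_eq_sum_range_succ_mk] at h
  have h2 : ∑ k ∈ Finset.range (33 ^ 2), (G k : ℝ) * thetaCoeff k = 0 := by
    rw [← h]
    symm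
    rw [← Finset.sum_subset (Finset.range_mono (by omega : (n + 1).succ ≤ 33 ^ 2))]
    · refine Finset.sum_congr rfl fun k hk => ?_
      rw [hG, if_pos (by rw [Finset.mem_range] at hk; omega)]
      rfl
    · intro k _ hk
      rw [hG, if_neg (by rw [Finset.mem_range] at hk; omega), Nat.cast_zero, zero_mul]
  rw [sum_range_sq_of_support (fun k hk => ?_)] at h2
  · rw [Finset.sum_range_succ'] at h2
    simp_rw [thetaCoeff_sq] at h2
    have h0 : (G (0 ^ 2) : ℝ) * thetaCoeff (0 ^ 2) = pbar (n + 1) := by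
      rw [hG]; simp [thetaCoeff]
    rw [h0] at h2
    have : ((pbar (n + 1) + 2 * ∑ j ∈ Finset.range 16, G ((2 * j + 2) ^ 2) : ℕ) : ℝ) =
        (2 * ∑ j ∈ Finset.range 16, G ((2 * j + 1) ^ 2) : ℕ) := by
      push_cast
      norm_num [Finset.sum_range_succ] at h2 ⊢
      linarith
    exact_mod_cast this
  · have : k ≠ 0 := by rintro rfl; exact hk (IsSquare.zero)
    rw [thetaCoeff, if_neg this, if_neg hk, mul_zero]

/-- `S` is the packed list `pbar n, pbar (n - 1), …, pbar 0`. -/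
def IsPacked (n S : ℕ) : Prop := ∀ i, packDigit S i = if i ≤ n then pbar (n - i) else 0

lemma IsPacked.packNext_eq {n S : ℕ} (h : IsPacked n S) (hn : n + 1 < 33 ^ 2) :
    packNext S = pbar (n + 1) := by
  have key (a : ℕ) (ha : 0 < a) : packDigit S (a ^ 2 - 1) =
      if a ^ 2 ≤ n + 1 then pbar (n + 1 - a ^ 2) else 0 := by
    have : 0 < a ^ 2 := by positivity
    rw [h]
    by_cases hb : a ^ 2 ≤ n + 1
    · rw [if_pos (by omega), if_pos hb]
      congr 1
      omega
    · rw [if_neg (by omega), if_neg hb]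
  have := pbar_succ_eq hn (fun k => rfl)
  rw [packNext, packSum_eq, packSum_eq, Finset.sum_congr rfl fun j _ => key (2 * j + 1) (by omega),
    Finset.sum_congr rfl fun j _ => key (2 * j + 2) (by omega)]
  omega

lemma packBase_pos : 0 < packBase := by unfold packBase; positivity

lemma IsPacked.succ {n S : ℕ} (h : IsPacked n S) (hq : pbar (n + 1) < packBase) :
    IsPacked (n + 1) (S * packBase + pbar (n + 1)) := by
  intro i
  rcases i with _ | i
  · rw [packDigit, pow_zero, Nat.div_one, mul_comm, Nat.mul_add_mod, Nat.mod_eq_of_lt hq]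
    simp
  · have : (S * packBase + pbar (n + 1)) / packBase = S := by
      rw [mul_comm, Nat.mul_add_div packBase_pos, Nat.div_eq_of_lt hq, add_zero]
    rw [packDigit, pow_succ', ← Nat.div_div_eq_div_mul, this]
    refine (h i).trans ?_
    simp

lemma isPacked_one : IsPacked 1 (packBase + 2) := by
  have h0 : pbar 0 = 1 := by
    have := sum_pbar_mul_thetaCoeff 0
    simp [thetaCoeff] at this
    exact_mod_cast this
  have hp0 : IsPacked 0 1 := by
    intro i
    rcases i with _ | i
    · rw [packDigit, pow_zero, Nat.div_one, Nat.mod_eq_of_lt (by norm_num [packBase]),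
        if_pos le_rfl, h0]
    · rw [packDigit, Nat.div_eq_of_lt (Nat.one_lt_pow (by omega) (by norm_num [packBase])),
        Nat.zero_mod, if_neg (by omega)]
  have h1 : pbar 1 = 2 := by
    rw [← hp0.packNext_eq (by norm_num)]
    decide +kernel
  have := hp0.succ (by rw [zero_add, h1]; norm_num [packBase])
  rwa [zero_add, h1, one_mul] at this

lemma checkStep_sound {n S : ℕ} (hn : n + 1 < 33 ^ 2) (h : IsPacked n S)
    (hpos : checkStep (S * packBase + n) ≠ 0) :
    sPlusCheck n (pbar n) (pbar (n + 1)) = true ∧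
      ∃ S', IsPacked (n + 1) S' ∧ checkStep (S * packBase + n) = S' * packBase + (n + 1) := by
  have hnb : n < packBase := lt_of_lt_of_le (by omega : n < 33 ^ 2) (by norm_num [packBase])
  have hdiv : (S * packBase + n) / packBase = S := by
    rw [mul_comm, Nat.mul_add_div packBase_pos, Nat.div_eq_of_lt hnb, add_zero]
  have hmod : (S * packBase + n) % packBase = n := by
    rw [mul_comm, Nat.mul_add_mod, Nat.mod_eq_of_lt hnb]
  have h0 : packDigit S 0 = pbar n := by rw [h]; simp
  have heq : checkStep (S * packBase + n) =
      bif Nat.blt (pbar (n + 1)) packBase && sPlusCheck n (pbar n) (pbar (n + 1)) then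
        (S * packBase + pbar (n + 1)) * packBase + (n + 1) else 0 := by
    rw [checkStep, forceNat_eq, forceNat_eq, forceNat_eq, hdiv, hmod, h.packNext_eq hn, h0]
  cases hc : (Nat.blt (pbar (n + 1)) packBase && sPlusCheck n (pbar n) (pbar (n + 1))) with
  | false => rw [heq, hc] at hpos; exact absurd rfl hpos
  | true =>
    rw [heq, hc]
    rw [Bool.and_eq_true, Nat.blt_eq] at hc
    exact ⟨hc.2, _, h.succ hc.1, rfl⟩

lemma iterate_checkStep_sound {m : ℕ} (hm : m + 1 < 33 ^ 2)
    (h : checkStep^[m] ((packBase + 2) * packBase + 1) ≠ 0) :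
    (∀ n, 1 ≤ n → n ≤ m → sPlusCheck n (pbar n) (pbar (n + 1)) = true) ∧
      ∃ S, IsPacked (m + 1) S ∧
        checkStep^[m] ((packBase + 2) * packBase + 1) = S * packBase + (m + 1) := by
  induction m with
  | zero => exact ⟨fun n h1 h2 => by omega, _, isPacked_one, rfl⟩
  | succ m ih =>
    rw [Function.iterate_succ_apply'] at h ⊢
    obtain ⟨hall, S, hS, heq⟩ := ih (by omega) fun h0 => h (by rw [h0, checkStep_zero])
    rw [heq] at h ⊢
    obtain ⟨hc, hS'⟩ := checkStep_sound (by omega) hS h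
    refine ⟨fun n h1 h2 => ?_, hS'⟩
    rcases eq_or_lt_of_le h2 with rfl | h3
    · exact hc
    · exact hall n h1 (by omega)

lemma sPlusCheck_pbar {n : ℕ} (h1 : 1 ≤ n) (h2 : n ≤ 1024) :
    sPlusCheck n (pbar n) (pbar (n + 1)) = true := by
  have h := checkIter_pos
  rw [checkIter_eq] at h
  exact (iterate_checkStep_sound (by norm_num) h.ne').1 n h1 (by omega)

lemma sPlusCheck_approx {n r : ℕ} (h1 : 1 ≤ n) (h2 : n ≤ 1024) (hr : r * r ≤ n * 10 ^ 24)
    (hr' : n * 10 ^ 24 ≤ (r + 1) * (r + 1)) :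
    |(n : ℝ) ^ 5 * sPlus n - ((sPlusPos n r : ℝ) - sPlusNeg n r) / 10 ^ 24| ≤ 1 := by
  have hn0 : (0 : ℝ) < n := by exact_mod_cast h1
  set y : ℝ := √(n : ℝ) with hy
  have hy2 : y ^ 2 = n := Real.sq_sqrt hn0.le
  have hy0 : 0 < y := Real.sqrt_pos.mpr hn0
  have hn2 : (n : ℝ) ≤ 1024 := by exact_mod_cast h2
  have hy32 : y ≤ 32 := by
    rw [hy, Real.sqrt_le_left (by norm_num)]
    norm_num
    exact h2
  set ρ : ℝ := r / 10 ^ 12 with hρ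
  have hr0 : (r : ℝ) = ρ * 10 ^ 12 := by rw [hρ]; field_simp
  have hρ0 : 0 ≤ ρ := by positivity
  have hρy : ρ ≤ y := by
    have : (r : ℝ) * r ≤ n * 10 ^ 24 := by exact_mod_cast hr
    refine abs_le_of_sq_le_sq' ?_ hy0.le |>.2
    rw [hr0] at this
    rw [hy2]
    linarith
  have hyρ : y ≤ ρ + 1 / 10 ^ 12 := by
    have : (n : ℝ) * 10 ^ 24 ≤ (r + 1) * (r + 1) := by exact_mod_cast hr'
    refine abs_le_of_sq_le_sq' ?_ (by positivity) |>.2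
    rw [hr0] at this
    rw [hy2]
    linarith
  set β := π⁻¹ with hβ
  have hs := sPlus_eq (n := n) (by omega) (x := y⁻¹) (β := β) rfl rfl
  have hs' : (n : ℝ) ^ 5 * sPlus n = (n : ℝ) ^ 5 - n ^ 3
      + (β ^ 2 / 2 + 3 / 2 + π ^ 2 / 8) * n ^ 2
      + (β ^ 4 / 2 - β ^ 2 - 13 / 12 - 5 * π ^ 2 / 16) * n
      + y * (π / 2 * n ^ 3 + (β / 2 - π * 5 / 8) * n ^ 2
        + (β ^ 3 / 2 - 7 * β / 8 + 3 * π / 16) * n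
        + (β ^ 5 / 2 - 9 * β ^ 3 / 8 + 15 * β / 16 + 83 * π / 128 + π ^ 3 / 48)) := by
    rw [hs, ← hy2]
    field_simp
    ring
  have hπ1 := Real.pi_gt_d20
  have hπ2 := Real.pi_lt_d20
  have hβ1 : (0.31830988618379067 : ℝ) < β := by
    rw [hβ, lt_inv_comm₀ (by norm_num) Real.pi_pos]
    exact hπ2.trans (by norm_num)
  have hβ2 : β < 0.31830988618379068 := by
    rw [hβ, inv_lt_comm₀ Real.pi_pos (by norm_num)]
    exact lt_trans (by norm_num) hπ1
  have bd {a b c : ℝ} (ha : 0 ≤ a) (h1 : a < b) (h2 : b < c) (k : ℕ) :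
      a ^ k ≤ b ^ k ∧ b ^ k ≤ c ^ k :=
    ⟨pow_le_pow_left₀ ha h1.le k, pow_le_pow_left₀ (ha.trans h1.le) h2.le k⟩
  have p2 := bd (by norm_num) hπ1 hπ2 2
  have p3 := bd (by norm_num) hπ1 hπ2 3
  have b2 := bd (by norm_num) hβ1 hβ2 2
  have b3 := bd (by norm_num) hβ1 hβ2 3
  have b4 := bd (by norm_num) hβ1 hβ2 4
  have b5 := bd (by norm_num) hβ1 hβ2 5
  norm_num at p2 p3 b2 b3 b4 b5
  have e3 : |π / 2 - 1570796326795 / 10 ^ 12| ≤ 1 / 10 ^ 12 := by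
    rw [abs_le]; constructor <;> linarith
  have e5 : |(β / 2 - π * 5 / 8) + 1804340465402 / 10 ^ 12| ≤ 1 / 10 ^ 12 := by
    rw [abs_le]; constructor <;> linarith
  have e6 : |(β ^ 2 / 2 + 3 / 2 + π ^ 2 / 8) - 2784361141957 / 10 ^ 12| ≤ 1 / 10 ^ 12 := by
    rw [abs_le]; constructor <;> linarith
  have e7 : |(β ^ 3 / 2 - 7 * β / 8 + 3 * π / 16) - 326653239354 / 10 ^ 12| ≤ 1 / 10 ^ 12 := by
    rw [abs_le]; constructor <;> linarith
  have e8 : |(β ^ 4 / 2 - β ^ 2 - 13 / 12 - 5 * π ^ 2 / 16) + 4263772901189 / 10 ^ 12|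
      ≤ 1 / 10 ^ 12 := by
    rw [abs_le]; constructor <;> linarith
  have e9 : |(β ^ 5 / 2 - 9 * β ^ 3 / 8 + 15 * β / 16 + 83 * π / 128 + π ^ 3 / 48)
      - 2946857007700 / 10 ^ 12| ≤ 1 / 10 ^ 12 := by
    rw [abs_le]; constructor <;> linarith
  have hd : |y - ρ| ≤ 1 / 10 ^ 12 := by rw [abs_le]; constructor <;> linarith
  have hn3 : |(n : ℝ) ^ 3| ≤ 1024 ^ 3 := by
    rw [abs_of_nonneg (by positivity)]; exact pow_le_pow_left₀ hn0.le hn2 3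
  have hn22 : |(n : ℝ) ^ 2| ≤ 1024 ^ 2 := by
    rw [abs_of_nonneg (by positivity)]; exact pow_le_pow_left₀ hn0.le hn2 2
  have hn1 : |(n : ℝ)| ≤ 1024 := by rwa [abs_of_nonneg hn0.le]
  have hya : |y| ≤ 32 := by rwa [abs_of_nonneg hy0.le]
  rw [hs', sPlusPos, sPlusNeg]
  generalize π / 2 = a3 at *
  generalize β / 2 - π * 5 / 8 = a5 at *
  generalize β ^ 2 / 2 + 3 / 2 + π ^ 2 / 8 = a6 at *
  generalize β ^ 3 / 2 - 7 * β / 8 + 3 * π / 16 = a7 at *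
  generalize β ^ 4 / 2 - β ^ 2 - 13 / 12 - 5 * π ^ 2 / 16 = a8 at *
  generalize β ^ 5 / 2 - 9 * β ^ 3 / 8 + 15 * β / 16 + 83 * π / 128 + π ^ 3 / 48 = a9 at *
  push_cast
  rw [hr0]
  have f3 := abs_mul_le_mul (abs_mul_le_mul e3 hn3) hya
  have f5 := abs_mul_le_mul (abs_mul_le_mul e5 hn22) hya
  have f7 := abs_mul_le_mul (abs_mul_le_mul e7 hn1) hya
  have f9 := abs_mul_le_mul e9 hya
  have f6 := abs_mul_le_mul e6 hn22
  have f8 := abs_mul_le_mul e8 hn1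
  have g3 := abs_mul_le_mul hd hn3
  have g5 := abs_mul_le_mul hd hn22
  have g7 := abs_mul_le_mul hd hn1
  rw [abs_le] at f3 f5 f7 f9 f6 f8 g3 g5 g7 hd ⊢
  constructor <;> linarith

lemma sPlusCheck_sound {n p q : ℕ} (h1 : 1 ≤ n) (h2 : n ≤ 1024) (h : sPlusCheck n p q = true) :
    sPlus n - 120 / (n : ℝ) ^ 5 < ((q : ℝ) / (p : ℝ)) ^ (((n : ℝ) + 1)⁻¹) ∧
      ((q : ℝ) / (p : ℝ)) ^ (((n : ℝ) + 1)⁻¹) < sPlus n + 850 / (n : ℝ) ^ 5 := by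
  rw [sPlusCheck, forceNat_eq, forceNat_eq] at h
  generalize newtonSqrt (n * 10 ^ 24) 12 (4 * 10 ^ 13) = r at h
  simp only [Bool.and_eq_true, Nat.ble_eq, Nat.blt_eq] at h
  obtain ⟨⟨hr, hr'⟩, hle, hU, hV⟩ := h
  have happ := abs_le.mp (sPlusCheck_approx h1 h2 hr hr')
  generalize sPlusPos n r = P at *
  generalize sPlusNeg n r = N at *
  have hn0 : (0 : ℝ) < n := by exact_mod_cast h1
  have hp : 0 < p := by
    rcases Nat.eq_zero_or_pos p with rfl | hp
    · simp at hU
    · exact hp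
  have hp' : (0 : ℝ) < p := by exact_mod_cast hp
  have hexp (w : ℝ) (hw : 0 ≤ w) : (w ^ (n + 1)) ^ (((n : ℝ) + 1)⁻¹) = w := by
    have := Real.pow_rpow_inv_natCast hw (Nat.succ_ne_zero n)
    rwa [Nat.cast_succ] at this
  have hei : (0 : ℝ) < ((n : ℝ) + 1)⁻¹ := by positivity
  have hD : (0 : ℝ) < 10 ^ 24 * (n : ℝ) ^ 5 := by positivity
  have hq : (0 : ℝ) ≤ q / p := by positivity
  have hn5 : (0 : ℝ) < (n : ℝ) ^ 5 := by positivity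
  constructor
  · set V := P - (N + 119 * 10 ^ 24) with hVdef
    have hVr : (P : ℝ) - (N + 119 * 10 ^ 24) ≤ V := by
      have : P ≤ V + (N + 119 * 10 ^ 24) := by omega
      have : (P : ℝ) ≤ V + (N + 119 * 10 ^ 24) := by exact_mod_cast this
      linarith
    have hV0 : 0 ≤ (V : ℝ) / (10 ^ 24 * (n : ℝ) ^ 5) := div_nonneg (Nat.cast_nonneg _) hD.le
    have hV' : (V : ℝ) ^ (n + 1) * p < (10 ^ 24 * (n : ℝ) ^ 5) ^ (n + 1) * q := by
      exact_mod_cast hV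
    have hlt : ((V : ℝ) / (10 ^ 24 * (n : ℝ) ^ 5)) ^ (n + 1) < q / p := by
      rw [div_pow, div_lt_div_iff₀ (by positivity) hp']
      linarith
    have hfin := Real.rpow_lt_rpow (pow_nonneg hV0 _) hlt hei
    rw [hexp _ hV0] at hfin
    refine lt_of_le_of_lt ?_ hfin
    rw [le_div_iff₀ hD]
    have : (sPlus n - 120 / (n : ℝ) ^ 5) * (10 ^ 24 * (n : ℝ) ^ 5) =
        10 ^ 24 * ((n : ℝ) ^ 5 * sPlus n) - 120 * 10 ^ 24 := by
      field_simp
    rw [this]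
    linarith [happ.2]
  · set U := P + 849 * 10 ^ 24 - N with hUdef
    have hUr : (U : ℝ) = P + 849 * 10 ^ 24 - N := by
      have : U + N = P + 849 * 10 ^ 24 := by omega
      have : (U : ℝ) + N = P + 849 * 10 ^ 24 := by exact_mod_cast this
      linarith
    have hU' : (10 ^ 24 * (n : ℝ) ^ 5) ^ (n + 1) * q < (U : ℝ) ^ (n + 1) * p := by
      exact_mod_cast hU
    have hlt : (q : ℝ) / p < ((U : ℝ) / (10 ^ 24 * (n : ℝ) ^ 5)) ^ (n + 1) := by
      rw [div_pow, div_lt_div_iff₀ hp' (by positivity)]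
      linarith
    have hfin := Real.rpow_lt_rpow hq hlt hei
    rw [hexp _ (by positivity)] at hfin
    refine lt_of_lt_of_le hfin ?_
    rw [div_le_iff₀ hD]
    have : (sPlus n + 850 / (n : ℝ) ^ 5) * (10 ^ 24 * (n : ℝ) ^ 5) =
        10 ^ 24 * ((n : ℝ) ^ 5 * sPlus n) + 850 * 10 ^ 24 := by
      field_simp
    rw [this]
    linarith [happ.1]

theorem stmt10 (n : ℕ) (hn : 1 ≤ n) :
    sPlus n - 120 / (n : ℝ) ^ 5 <
      ((pbar (n + 1) : ℝ) / (pbar n : ℝ)) ^ (((n : ℝ) + 1)⁻¹) ∧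
    ((pbar (n + 1) : ℝ) / (pbar n : ℝ)) ^ (((n : ℝ) + 1)⁻¹) <
      sPlus n + 850 / (n : ℝ) ^ 5 := by
  rcases le_total n 1024 with h | h
  · exact sPlusCheck_sound hn h (sPlusCheck_pbar hn h)
  · have happ := abs_le.mp (abs_rpow_sub_sPlus_le (n := n) (by omega))
    have hn5 : (0 : ℝ) < (n : ℝ) ^ 5 := by positivity
    have h1 : 50 / (n : ℝ) ^ 5 < 120 / (n : ℝ) ^ 5 := by gcongr; norm_num
    have h2 : 50 / (n : ℝ) ^ 5 < 850 / (n : ℝ) ^ 5 := by gcongr; norm_num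
    constructor <;> linarith
end

section
/- Let α ≥ 0 be a real number. For all integers n ≥ Ñ(α), one has 1 + (3α − 2α·log n)/n³ − 2^{7α+14}·(log n)/n⁵ < n^{2α/n} / ( (n−1)^{α/(n−1)} · (n+1)^{α/(n+1)} ) < 1 + (3α − 2α·log n)/n³ + 2^{18α+31}/n⁵. -/
open Real

noncomputable def Nt1 (α : ℝ) : ℝ :=
  max ((⌈Real.sqrt (2 * α)⌉ : ℤ) : ℝ)
    (max ((⌈(3 * α) ^ ((1 : ℝ) / 3)⌉ : ℤ) : ℝ)
      (max ((⌈(11 * α / 3) ^ ((1 : ℝ) / 4)⌉ : ℤ) : ℝ) ((⌈(10 * α) ^ ((1 : ℝ) / 5)⌉ : ℤ) : ℝ)))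

noncomputable def Nt2 (α : ℝ) : ℝ :=
  max (2 : ℝ) (max ((⌈Real.sqrt (2 * α)⌉ : ℤ) : ℝ)
    (max ((⌈(3 * α) ^ ((1 : ℝ) / 3)⌉ : ℤ) : ℝ)
      (max ((⌈(11 * α / 3) ^ ((1 : ℝ) / 4)⌉ : ℤ) : ℝ) ((⌈(12 * α) ^ ((1 : ℝ) / 5)⌉ : ℤ) : ℝ))))

noncomputable def Nt3 (α : ℝ) : ℝ :=
  max (5505 : ℝ) (max ((⌈(4 * α / (α ^ 2 + 1)) ^ ((4 : ℝ) / 3)⌉ : ℤ) : ℝ)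
    ((⌈(4 * α) ^ ((4 : ℝ) / 11)⌉ : ℤ) : ℝ))

noncomputable def Ntil (α : ℝ) : ℝ := max (Nt1 α) (max (Nt2 α) (Nt3 α))

/-- Second-order symmetric combination of `log (1 ± t)`, up to an error of order `t ^ 4`. -/
lemma log_one_add_log_one_sub_bounds {t : ℝ} (ht : 0 < t) (ht' : t ≤ 1 / 10) :
    -3 * t ^ 2 - 4 * t ^ 4 ≤ (1 - t) * log (1 + t) + (1 + t) * log (1 - t) ∧
      (1 - t) * log (1 + t) + (1 + t) * log (1 - t) ≤ -3 * t ^ 2 + 3 * t ^ 4 := by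
  have h₁ := Real.abs_log_sub_add_sum_range_le (x := t) (by rw [abs_of_pos ht]; linarith) 3
  have h₂ := Real.abs_log_sub_add_sum_range_le (x := -t)
    (by rw [abs_neg, abs_of_pos ht]; linarith) 3
  rw [abs_neg] at h₂
  simp only [abs_of_pos ht, Finset.sum_range_succ, Finset.sum_range_zero, sub_neg_eq_add] at h₁ h₂
  have h1t : 0 < 1 - t := by linarith
  have he : t ^ (3 + 1) / (1 - t) ≤ 10 / 9 * t ^ 4 := by
    rw [div_le_iff₀ h1t]
    nlinarith [pow_pos ht 4]
  obtain ⟨h₁l, h₁u⟩ := abs_le.mp (h₁.trans he)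
  obtain ⟨h₂l, h₂u⟩ := abs_le.mp (h₂.trans he)
  norm_num at h₁l h₁u h₂l h₂u
  have a := mul_le_mul_of_nonneg_left h₁l (by linarith : 0 ≤ 1 + t)
  have b := mul_le_mul_of_nonneg_left h₁u (by linarith : 0 ≤ 1 + t)
  have c := mul_le_mul_of_nonneg_left h₂l h1t.le
  have d := mul_le_mul_of_nonneg_left h₂u h1t.le
  have := pow_pos ht 4
  constructor <;> nlinarith

/-- The second central difference of `log x / x` at `x`, with step `1`. -/
noncomputable def logDivSecondDiff (x : ℝ) : ℝ :=
  log (x - 1) / (x - 1) + log (x + 1) / (x + 1) - 2 * log x / x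

lemma logDivSecondDiff_eq {x : ℝ} (hx : 1 < x) :
    logDivSecondDiff x = (2 * log x * x⁻¹ ^ 3 + x⁻¹ *
      ((1 - x⁻¹) * log (1 + x⁻¹) + (1 + x⁻¹) * log (1 - x⁻¹))) / (1 - x⁻¹ ^ 2) := by
  have h0 : x ≠ 0 := by linarith
  have hm : x - 1 ≠ 0 := by linarith
  have hp : x + 1 ≠ 0 := by linarith
  have hlp : log (1 + x⁻¹) = log (x + 1) - log x := by
    rw [← log_div hp h0]; congr 1; field_simp
  have hlm : log (1 - x⁻¹) = log (x - 1) - log x := by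
    rw [← log_div hm h0]; congr 1; field_simp
  have hq : x ^ 2 - 1 ≠ 0 := by nlinarith
  have hq' : 1 - x⁻¹ ^ 2 = (x - 1) * (x + 1) / x ^ 2 := by field_simp; ring
  rw [hlp, hlm, hq', logDivSecondDiff]
  field_simp
  ring

lemma logDivSecondDiff_bounds {x : ℝ} (hx : 10 ≤ x) :
    (2 * log x - 3) * x⁻¹ ^ 3 - 20 * x⁻¹ ^ 5 ≤ logDivSecondDiff x ∧
      logDivSecondDiff x ≤ (2 * log x - 3) * x⁻¹ ^ 3 + (4 * log x + 4) * x⁻¹ ^ 5 := by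
  have ht : 0 < x⁻¹ := by positivity
  have ht' : x⁻¹ ≤ 1 / 10 := by
    rw [one_div]; exact inv_anti₀ (by norm_num) hx
  obtain ⟨hl, hu⟩ := log_one_add_log_one_sub_bounds ht ht'
  have hL : 0 ≤ log x := log_nonneg (by linarith)
  rw [logDivSecondDiff_eq (by linarith)]
  set t := x⁻¹
  set E := (1 - t) * log (1 + t) + (1 + t) * log (1 - t)
  set L := log x
  have ht2 : t ^ 2 ≤ 1 / 100 := by nlinarith
  have hd : 0 < 1 - t ^ 2 := by linarith
  have hl' := mul_le_mul_of_nonneg_left hl ht.le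
  have hu' := mul_le_mul_of_nonneg_left hu ht.le
  have h5 : 0 < t ^ 5 := by positivity
  have h7 : t ^ 7 ≤ t ^ 5 / 100 := by nlinarith
  have h7' : 0 < t ^ 7 := by positivity
  have hL5 : L * t ^ 7 ≤ L * (t ^ 5 / 100) := mul_le_mul_of_nonneg_left h7 hL
  have hL5' : 0 ≤ L * t ^ 5 := by positivity
  rw [le_div_iff₀ hd, div_le_iff₀ hd]
  constructor <;> nlinarith

lemma rpow_quotient_eq_exp {x : ℝ} (hx : 1 < x) (α : ℝ) :
    x ^ (2 * α / x) / ((x - 1) ^ (α / (x - 1)) * (x + 1) ^ (α / (x + 1))) =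
      exp (-(α * logDivSecondDiff x)) := by
  rw [rpow_def_of_pos (by linarith), rpow_def_of_pos (by linarith : 0 < x - 1),
    rpow_def_of_pos (by linarith : 0 < x + 1), ← exp_add, ← exp_sub, logDivSecondDiff]
  congr 1
  ring

lemma exp_neg_le_quadratic {y : ℝ} (hy : 0 ≤ y) : exp (-y) ≤ 1 - y + y ^ 2 / 2 := by
  have h := Real.quadratic_le_exp_of_nonneg hy
  have hp := exp_pos (-y)
  have hm : exp (-y) * exp y = 1 := by rw [← exp_add]; simp
  have hmul : exp (-y) * (1 + y + y ^ 2 / 2) ≤ 1 :=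
    (mul_le_mul_of_nonneg_left h hp.le).trans_eq hm
  have hge : 1 ≤ (1 - y + y ^ 2 / 2) * (1 + y + y ^ 2 / 2) := by
    nlinarith [sq_nonneg (y ^ 2)]
  exact le_of_mul_le_mul_right (hmul.trans hge) (by positivity)

lemma log_sq_le_four_mul {x : ℝ} (hx : 1 ≤ x) : log x ^ 2 ≤ 4 * x := by
  have hs : log x ≤ 2 * √x := by
    have h := log_le_self (sqrt_nonneg x)
    rw [log_sqrt (by linarith)] at h
    linarith
  calc log x ^ 2 ≤ (2 * √x) ^ 2 := pow_le_pow_left₀ (log_nonneg hx) hs 2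
    _ = 4 * x := by rw [mul_pow, sq_sqrt (by linarith)]; norm_num

lemma one_add_le_two_rpow {a : ℝ} (ha : 0 ≤ a) : 1 + a ≤ (2 : ℝ) ^ (2 * a) := by
  rw [rpow_def_of_pos two_pos]
  nlinarith [add_one_le_exp (log 2 * (2 * a)), log_two_gt_d9]

lemma mul_lt_two_rpow {α : ℝ} (hα : 0 ≤ α) : 8 * α < (2 : ℝ) ^ (7 * α + 14) := by
  have h := one_add_le_two_rpow (by linarith : 0 ≤ 7 / 2 * α)
  rw [rpow_add two_pos, show (7 * α : ℝ) = 2 * (7 / 2 * α) by ring]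
  norm_num
  nlinarith

lemma quadratic_lt_two_rpow {α : ℝ} (hα : 0 ≤ α) :
    20 * α + 18 * α ^ 2 < (2 : ℝ) ^ (18 * α + 31) := by
  have h := one_add_le_two_rpow (by linarith : 0 ≤ 9 / 2 * α)
  rw [rpow_add two_pos, show (18 * α : ℝ) = 2 * (9 / 2 * α) + 2 * (9 / 2 * α) by ring,
    rpow_add two_pos]
  norm_num
  nlinarith

lemma two_le_log {x : ℝ} (hx : 8 ≤ x) : 2 ≤ log x := by
  rw [le_log_iff_exp_le (by linarith), show (2 : ℝ) = 1 + 1 by norm_num, exp_add]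
  nlinarith [exp_one_lt_d9, exp_pos 1]

theorem stmt12 (α : ℝ) (hα : 0 ≤ α) (n : ℕ) (hn : Ntil α ≤ (n : ℝ)) :
    1 + (3 * α - 2 * α * Real.log n) / (n : ℝ) ^ 3
        - (2 : ℝ) ^ (7 * α + 14) * Real.log n / (n : ℝ) ^ 5 <
      (n : ℝ) ^ (2 * α / (n : ℝ)) /
        (((n : ℝ) - 1) ^ (α / ((n : ℝ) - 1)) * ((n : ℝ) + 1) ^ (α / ((n : ℝ) + 1))) ∧
    (n : ℝ) ^ (2 * α / (n : ℝ)) /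
        (((n : ℝ) - 1) ^ (α / ((n : ℝ) - 1)) * ((n : ℝ) + 1) ^ (α / ((n : ℝ) + 1))) <
      1 + (3 * α - 2 * α * Real.log n) / (n : ℝ) ^ 3 + (2 : ℝ) ^ (18 * α + 31) / (n : ℝ) ^ 5 := by
  have hx : (10 : ℝ) ≤ n := by
    have : (5505 : ℝ) ≤ Ntil α :=
      (le_max_left _ _).trans ((le_max_right _ _).trans (le_max_right _ _))
    linarith
  rw [rpow_quotient_eq_exp (by linarith)]
  obtain ⟨hl, hu⟩ := logDivSecondDiff_bounds hx
  have hL := two_le_log (by linarith : (8 : ℝ) ≤ n)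
  have hL2 := log_sq_le_four_mul (by linarith : (1 : ℝ) ≤ n)
  have hlow := mul_lt_two_rpow hα
  have hupp := quadratic_lt_two_rpow hα
  have ht : 0 < (n : ℝ)⁻¹ := by positivity
  have ht' : (n : ℝ)⁻¹ ≤ 1 / 10 := by
    rw [one_div]; exact inv_anti₀ (by norm_num) hx
  have hnt : (n : ℝ) * (n : ℝ)⁻¹ = 1 := mul_inv_cancel₀ (by linarith)
  simp only [div_eq_mul_inv, ← inv_pow]
  generalize (2 : ℝ) ^ (7 * α + 14) = A at *
  generalize (2 : ℝ) ^ (18 * α + 31) = B at *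
  generalize logDivSecondDiff n = Δ at *
  generalize Real.log n = L at *
  generalize (n : ℝ)⁻¹ = t at *
  have h3 : 0 < t ^ 3 := by positivity
  have h5 : 0 < t ^ 5 := by positivity
  have ht2 : t ^ 2 ≤ 1 / 100 := by nlinarith
  have h53 : t ^ 5 ≤ t ^ 3 / 100 := by nlinarith
  have hL5 : 0 < L * t ^ 5 := by positivity
  have hL53 : L * t ^ 5 ≤ L * (t ^ 3 / 100) := by gcongr
  have hL3 : 2 * t ^ 3 ≤ L * t ^ 3 := by gcongr
  constructor
  · have he := add_one_le_exp (-(α * Δ))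
    have hα' := mul_le_mul_of_nonneg_left hu hα
    have h4 : α * ((4 * L + 4) * t ^ 5) ≤ α * (8 * (L * t ^ 5)) := by
      apply mul_le_mul_of_nonneg_left _ hα
      nlinarith
    have hA := mul_lt_mul_of_pos_right hlow hL5
    nlinarith
  · have hΔ : 0 ≤ Δ := by nlinarith
    have hΔ' : Δ ≤ 3 * L * t ^ 3 := by nlinarith
    have he := exp_neg_le_quadratic (mul_nonneg hα hΔ)
    have hα' := mul_le_mul_of_nonneg_left hl hα
    have hsq : Δ ^ 2 ≤ 36 * t ^ 5 := by
      calc Δ ^ 2 ≤ (3 * L * t ^ 3) ^ 2 := pow_le_pow_left₀ hΔ hΔ' 2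
        _ = 9 * t ^ 6 * L ^ 2 := by ring
        _ ≤ 9 * t ^ 6 * (4 * n) := by gcongr
        _ = 36 * t ^ 5 * (n * t) := by ring
        _ = 36 * t ^ 5 := by rw [hnt, mul_one]
    have hα2 := mul_le_mul_of_nonneg_left hsq (sq_nonneg α)
    have hB := mul_lt_mul_of_pos_right hupp h5
    nlinarith
end
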